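/- For every ε > 0 there exists a constant C(ε) such that the following holds: for every integer t ≥ 2 and every two pairs of integers (n,m) and (n',m') with 1 ≤ m ≤ n/2, 1 ≤ m' ≤ n'/2, and C(n,m) = C(n',m') = t, one has |m − m'| ≤ C(ε)·exp((log(n+n'))^{2/3+ε}). -/

import Mathlib

namespace Singmaster

open Finset

/-! ### Power sums and Linnik's lemma -/

theorem esymm_eq_of_psum_eq {R : Type*} [CommRing R] {k : ℕ}
    (hunit : ∀ j : ℕ, 1 ≤ j → j ≤ k → IsUnit (j : R)) (x y : Fin k → R)
    (h : ∀ j : ℕ, 1 ≤ j → j ≤ k → ∑ i, x i ^ j = ∑ i, y i ^ j) (n : ℕ) (hn : n ≤ k) :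
    MvPolynomial.aeval x (MvPolynomial.esymm (Fin k) R n) =
      MvPolynomial.aeval y (MvPolynomial.esymm (Fin k) R n) := by
  induction n using Nat.strong_induction_on with
  | _ n ih =>
    rcases Nat.eq_zero_or_pos n with rfl | hpos
    · simp
    · have key := MvPolynomial.mul_esymm_eq_sum (Fin k) R n
      have kx := congrArg (MvPolynomial.aeval x) key
      have ky := congrArg (MvPolynomial.aeval y) key
      simp only [map_mul, map_natCast, map_pow, map_neg, map_one, map_sum] at kx ky
      refine (hunit n hpos hn).mul_left_cancel ?_
      rw [kx, ky]
      congr 1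
      refine Finset.sum_congr rfl fun a ha => ?_
      rw [Finset.mem_filter, HasAntidiagonal.mem_antidiagonal] at ha
      rw [ih a.1 ha.2 (by omega)]
      congr 1
      simp only [MvPolynomial.psum, map_sum, map_pow, MvPolynomial.aeval_X]
      exact h a.2 (by omega) (by omega)

theorem prod_sub_eq_of_psum_eq {R : Type*} [CommRing R] {k : ℕ}
    (hunit : ∀ j : ℕ, 1 ≤ j → j ≤ k → IsUnit (j : R)) (x y : Fin k → R)
    (h : ∀ j : ℕ, 1 ≤ j → j ≤ k → ∑ i, x i ^ j = ∑ i, y i ^ j) (t : R) :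
    ∏ i, (t - x i) = ∏ i, (t - y i) := by
  have key : ∀ z : Fin k → R, ∏ i, (t - z i) =
      ∑ j ∈ Finset.range (k + 1),
        (-1) ^ j * (MvPolynomial.aeval z (MvPolynomial.esymm (Fin k) R j) * t ^ (k - j)) := by
    intro z
    have := congrArg (Polynomial.eval t)
      (Multiset.prod_X_sub_X_eq_sum_esymm (Multiset.map z Finset.univ.val))
    simp only [Multiset.map_map, Polynomial.eval_multiset_prod, Multiset.card_map,
      Polynomial.eval_finsetSum] at this
    simp only [MvPolynomial.aeval_esymm_eq_multiset_esymm]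
    simpa [Finset.prod] using this
  rw [key, key]
  refine Finset.sum_congr rfl fun j hj => ?_
  rw [esymm_eq_of_psum_eq hunit x y h j (by simpa [Nat.lt_succ_iff] using hj)]

/-- In a local ring in which `1, …, k` are invertible, a `k`-tuple whose pairwise differences are
units is determined up to order by its first `k` power sums. -/
theorem exists_perm_of_psum_eq {R : Type*} [CommRing R] [IsLocalRing R] {k : ℕ}
    (hunit : ∀ j : ℕ, 1 ≤ j → j ≤ k → IsUnit (j : R)) (x y : Fin k → R)
    (hx : ∀ i j, i ≠ j → IsUnit (x i - x j)) (hy : ∀ i j, i ≠ j → IsUnit (y i - y j))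
    (h : ∀ j : ℕ, 1 ≤ j → j ≤ k → ∑ i, x i ^ j = ∑ i, y i ^ j) :
    ∃ σ : Equiv.Perm (Fin k), y = x ∘ σ := by
  have hex : ∀ i, ∃ j, y i = x j := by
    intro i
    have h0 : ∏ j, (y i - x j) = 0 := by
      rw [prod_sub_eq_of_psum_eq hunit x y h (y i)]
      exact Finset.prod_eq_zero (Finset.mem_univ i) (sub_self _)
    by_cases hall : ∀ j, IsUnit (y i - x j)
    · have : IsUnit (∏ j, (y i - x j)) := by
        rw [IsUnit.prod_univ_iff]; exact hall
      rw [h0] at this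
      exact absurd this not_isUnit_zero
    · push Not at hall
      obtain ⟨j, hj⟩ := hall
      refine ⟨j, ?_⟩
      have hrest : IsUnit (∏ l ∈ Finset.univ.erase j, (y i - x l)) := by
        rw [IsUnit.prod_iff]
        intro l hl
        by_contra hnu
        have hlj : l ≠ j := Finset.ne_of_mem_erase hl
        have := hx l j hlj
        rw [show x l - x j = (y i - x j) - (y i - x l) by ring] at this
        have hnu' : -(y i - x l) ∈ nonunits R := by
          rw [mem_nonunits_iff, IsUnit.neg_iff]; exact hnu
        have hadd := IsLocalRing.nonunits_add hj hnu'
        rw [← sub_eq_add_neg] at hadd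
        exact hadd this
      rw [← Finset.mul_prod_erase _ _ (Finset.mem_univ j)] at h0
      have := (hrest.mul_left_eq_zero).1 h0
      exact sub_eq_zero.1 this
  choose σ hσ using hex
  have hinj : Function.Injective σ := by
    intro a b hab
    by_contra hne
    have := hy a b hne
    rw [hσ a, hσ b, hab, sub_self] at this
    exact not_isUnit_zero this
  refine ⟨Equiv.ofBijective σ (Finite.injective_iff_bijective.1 hinj), ?_⟩
  funext i
  simpa using hσ i

theorem isLocalRing_zmod_prime_pow {p k : ℕ} (hp : p.Prime) (hk : k ≠ 0) :
    IsLocalRing (ZMod (p ^ k)) := by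
  have : Fact (1 < p ^ k) := ⟨Nat.one_lt_pow hk hp.one_lt⟩
  have : NeZero (p ^ k) := ⟨(pow_pos hp.pos k).ne'⟩
  have hunit : ∀ a : ZMod (p ^ k), IsUnit a ↔ ¬ p ∣ a.val := by
    intro a
    conv_lhs => rw [← ZMod.natCast_zmod_val a]
    rw [ZMod.isUnit_iff_coprime, Nat.coprime_pow_right_iff (Nat.pos_of_ne_zero hk),
      Nat.coprime_comm, hp.coprime_iff_not_dvd]
  refine IsLocalRing.of_nonunits_add fun a b ha hb => ?_
  simp only [mem_nonunits_iff, hunit, not_not] at *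
  rw [ZMod.val_add, Nat.dvd_mod_iff (dvd_pow_self p hk)]
  exact dvd_add ha hb

theorem isUnit_intCast_zmod_prime_pow {p k : ℕ} (hp : p.Prime) {a : ℤ}
    (ha : ¬ (p : ℤ) ∣ a) : IsUnit ((a : ℤ) : ZMod (p ^ k)) := by
  rw [ZMod.coe_int_isUnit_iff_isCoprime]
  push_cast
  exact IsCoprime.pow_left ((Nat.prime_iff_prime_int.mp hp).coprime_iff_not_dvd.mpr ha)

/-- Linnik's lemma. -/
theorem card_le_of_dvd_psum_sub {p k : ℕ} (hp : p.Prime) (hk : k ≠ 0) (hkp : k < p)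
    (lam : ℕ → ℤ) (I : Set ℤ) (hI : ∀ a ∈ I, ∀ b ∈ I, (p : ℤ) ^ k ∣ a - b → a = b)
    (S : Finset (Fin k → ℤ)) (hmem : ∀ x ∈ S, ∀ i, x i ∈ I)
    (hdist : ∀ x ∈ S, ∀ i j, i ≠ j → ¬ (p : ℤ) ∣ x i - x j)
    (hdvd : ∀ x ∈ S, ∀ j ∈ Icc 1 k, (p : ℤ) ^ j ∣ ∑ i, x i ^ j - lam j) :
    #S ≤ k.factorial * p ^ (k * (k - 1) / 2) := by
  classical
  have := isLocalRing_zmod_prime_pow hp hk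
  have hp0 : (p : ℤ) ≠ 0 := by exact_mod_cast hp.ne_zero
  let q : (Fin k → ℤ) → ℕ → ℤ := fun x j => (∑ i, x i ^ j - lam j) / (p : ℤ) ^ j
  have hq : ∀ x ∈ S, ∀ j ∈ Icc 1 k, ∑ i, x i ^ j = lam j + (p : ℤ) ^ j * q x j := by
    intro x hx j hj
    have := Int.mul_ediv_cancel' (hdvd x hx j hj)
    simp only [q]
    linarith
  let T : Finset (Fin k → ℤ) :=
    Fintype.piFinset fun j : Fin k => Finset.Ico (0 : ℤ) ((p : ℤ) ^ (k - (j + 1)))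
  let f : (Fin k → ℤ) → (Fin k → ℤ) := fun x j => q x (j + 1) % (p : ℤ) ^ (k - (j + 1 : ℕ))
  have hT : #T = p ^ (k * (k - 1) / 2) := by
    simp only [T, Fintype.card_piFinset, Int.card_Ico, sub_zero]
    have : ∀ j : Fin k, ((p : ℤ) ^ (k - ((j : ℕ) + 1))).toNat = p ^ (k - 1 - (j : ℕ)) := by
      intro j
      rw [show k - ((j : ℕ) + 1) = k - 1 - j by omega]
      exact_mod_cast Int.toNat_natCast _
    rw [Finset.prod_congr rfl fun j _ => this j, Fin.prod_univ_eq_prod_range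
      (fun j => p ^ (k - 1 - j)) k, Finset.prod_range_reflect (fun j => p ^ j) k,
      Finset.prod_pow_eq_pow_sum, Finset.sum_range_id]
  rw [← hT]
  refine Finset.card_le_mul_card_image_of_maps_to (f := f) ?_ _ ?_
  · intro x _
    simp only [T, f, Fintype.mem_piFinset, Finset.mem_Ico]
    intro j
    exact ⟨Int.emod_nonneg _ (pow_ne_zero _ hp0),
      Int.emod_lt_of_pos _ (pow_pos (by exact_mod_cast hp.pos) _)⟩
  · intro b _
    rcases Finset.eq_empty_or_nonempty {a ∈ S | f a = b} with h | ⟨x0, hx0⟩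
    · simp [h]
    rw [Finset.mem_filter] at hx0
    have key : ∀ y ∈ ({a ∈ S | f a = b} : Finset _), ∃ σ : Equiv.Perm (Fin k), y = x0 ∘ σ := by
      intro y hy
      rw [Finset.mem_filter] at hy
      have hpow : ∀ j ∈ Icc 1 k, (p : ℤ) ^ k ∣ ∑ i, x0 i ^ j - ∑ i, y i ^ j := by
        intro j hj
        rw [hq _ hx0.1 j hj, hq _ hy.1 j hj]
        rw [Finset.mem_Icc] at hj
        have h1 : f x0 ⟨j - 1, by omega⟩ = f y ⟨j - 1, by omega⟩ := by rw [hx0.2, hy.2]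
        simp only [f] at h1
        rw [show j - 1 + 1 = j by omega] at h1
        have h2 : (p : ℤ) ^ (k - j) ∣ q x0 j - q y j := Int.ModEq.dvd (Eq.symm h1)
        have h3 : (p : ℤ) ^ k = (p : ℤ) ^ j * (p : ℤ) ^ (k - j) := by
          rw [← pow_add, Nat.add_sub_cancel' hj.2]
        rw [h3, add_sub_add_left_eq_sub, ← mul_sub]
        exact mul_dvd_mul_left _ h2
      obtain ⟨σ, hσ⟩ := exists_perm_of_psum_eq (R := ZMod (p ^ k))
        (x := fun i => (x0 i : ZMod (p ^ k))) (y := fun i => (y i : ZMod (p ^ k)))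
        (by
          intro j h1 hj
          have := isUnit_intCast_zmod_prime_pow (k := k) hp (a := (j : ℤ))
            (by exact_mod_cast Nat.not_dvd_of_pos_of_lt h1 (hj.trans_lt hkp))
          simpa using this)
        (by
          intro i j hij
          have := isUnit_intCast_zmod_prime_pow (k := k) hp (hdist x0 hx0.1 i j hij)
          simpa using this)
        (by
          intro i j hij
          have := isUnit_intCast_zmod_prime_pow (k := k) hp (hdist y hy.1 i j hij)
          simpa using this)
        (by
          intro j h1 hj
          have := (ZMod.intCast_eq_intCast_iff_dvd_sub _ _ (p ^ k)).mpr
            (by exact_mod_cast hpow j (Finset.mem_Icc.mpr ⟨h1, hj⟩))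
          push_cast at this
          exact this.symm)
      refine ⟨σ, funext fun i => ?_⟩
      refine hI _ (hmem y hy.1 i) _ (hmem x0 hx0.1 _) ?_
      have := congrFun hσ i
      simp only [Function.comp] at this
      have h2 := (ZMod.intCast_eq_intCast_iff_dvd_sub _ _ (p ^ k)).mp this.symm
      exact_mod_cast h2
    calc #({a ∈ S | f a = b} : Finset _)
        ≤ #(Finset.univ.image fun σ : Equiv.Perm (Fin k) => x0 ∘ σ) := by
          refine Finset.card_le_card fun y hy => ?_
          obtain ⟨σ, hσ⟩ := key y hy
          exact Finset.mem_image.mpr ⟨σ, Finset.mem_univ _, hσ.symm⟩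
      _ ≤ k.factorial := by
          refine Finset.card_image_le.trans ?_
          rw [Finset.card_univ, Fintype.card_perm, Fintype.card_fin]

/-! ### Additive energy of vector-valued functions -/

/-- The number of pairs of elements of `T` with the same image under `φ`. -/
def energy {τ G : Type*} [DecidableEq G] (φ : τ → G) (T : Finset τ) : ℕ :=
  #{q ∈ T ×ˢ T | φ q.1 = φ q.2}

theorem card_filter_sub_eq {τ G : Type*} [DecidableEq G] [AddCommGroup G] (φ : τ → G)
    (T : Finset τ) (H : Finset G) (hH : ∀ x ∈ T, φ x ∈ H) (g : G) :
    #{q ∈ T ×ˢ T | φ q.1 = φ q.2 + g} =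
      ∑ h ∈ H, #{x ∈ T | φ x = h + g} * #{x ∈ T | φ x = h} := by
  rw [card_eq_sum_card_fiberwise (f := fun q => φ q.2) (t := H)]
  · refine sum_congr rfl fun h _ => ?_
    rw [← card_product, filter_filter]
    congr 1
    ext ⟨x, y⟩
    simp only [mem_filter, mem_product]
    constructor
    · rintro ⟨⟨h1, h2⟩, h3, h4⟩
      exact ⟨⟨h1, by rw [h3, h4]⟩, h2, h4⟩
    · rintro ⟨⟨h1, h3⟩, h2, h4⟩
      exact ⟨⟨h1, h2⟩, by rw [h3, h4], h4⟩
  · intro q hq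
    simp only [coe_filter, mem_product, Set.mem_ofPred_eq] at hq
    exact hH _ hq.1.2

theorem energy_eq_sum_sq {τ G : Type*} [DecidableEq G] (φ : τ → G)
    (T : Finset τ) (H : Finset G) (hH : ∀ x ∈ T, φ x ∈ H) :
    energy φ T = ∑ h ∈ H, #{x ∈ T | φ x = h} ^ 2 := by
  rw [energy, card_eq_sum_card_fiberwise (f := fun q => φ q.2) (t := H)]
  · refine sum_congr rfl fun h _ => ?_
    rw [sq, ← card_product, filter_filter]
    congr 1
    ext ⟨x, y⟩
    simp only [mem_filter, mem_product]
    constructor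
    · rintro ⟨⟨h1, h2⟩, h3, h4⟩
      exact ⟨⟨h1, by rw [h3, h4]⟩, h2, h4⟩
    · rintro ⟨⟨h1, h3⟩, h2, h4⟩
      exact ⟨⟨h1, h2⟩, by rw [h3, h4], h4⟩
  · intro q hq
    simp only [coe_filter, mem_product, Set.mem_ofPred_eq] at hq
    exact hH _ hq.1.2

theorem card_filter_sub_le_energy {τ G : Type*} [DecidableEq G] [AddCommGroup G] (φ : τ → G)
    (T : Finset τ) (g : G) :
    #{q ∈ T ×ˢ T | φ q.1 = φ q.2 + g} ≤ energy φ T := by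
  classical
  set H := T.image φ
  have hH : ∀ x ∈ T, φ x ∈ H := fun x hx => mem_image_of_mem φ hx
  let r : G → ℕ := fun h => #{x ∈ T | φ x = h}
  have hr : ∀ h, h ∉ H → r h = 0 := by
    intro h hh
    simp only [r, card_eq_zero, filter_eq_empty_iff]
    rintro x hx rfl
    exact hh (hH x hx)
  have h1 : ∑ h ∈ H, r (h + g) ^ 2 ≤ ∑ h ∈ H, r h ^ 2 := by
    calc ∑ h ∈ H, r (h + g) ^ 2 = ∑ h ∈ H.map (addRightEmbedding g), r h ^ 2 := by
          simp
      _ = ∑ h ∈ (H.map (addRightEmbedding g)).filter (· ∈ H), r h ^ 2 := by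
          refine (sum_filter_of_ne fun x _ hx => ?_).symm
          by_contra hc
          exact hx (by rw [hr x hc]; rfl)
      _ ≤ ∑ h ∈ H, r h ^ 2 :=
          sum_le_sum_of_subset fun x hx => (mem_filter.mp hx).2
  rw [card_filter_sub_eq φ T H hH, energy_eq_sum_sq φ T H hH]
  have h2 : 2 * ∑ h ∈ H, r (h + g) * r h ≤ ∑ h ∈ H, r (h + g) ^ 2 + ∑ h ∈ H, r h ^ 2 := by
    rw [mul_sum, ← sum_add_distrib]
    refine sum_le_sum fun h _ => ?_
    nlinarith [two_mul_le_add_sq (r (h + g)) (r h)]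
  change ∑ h ∈ H, r (h + g) * r h ≤ ∑ h ∈ H, r h ^ 2
  linarith

theorem energy_le_of_cover {τ G γ : Type*} [DecidableEq G] (φ : τ → G)
    (T : Finset τ) (L : Finset γ) (S : γ → Finset τ) (h : ∀ x ∈ T, ∃ l ∈ L, x ∈ S l) :
    energy φ T ≤ #L * ∑ l ∈ L, energy φ (S l) := by
  classical
  set H := T.image φ ∪ L.biUnion fun l => (S l).image φ
  have hH : ∀ x ∈ T, φ x ∈ H := fun x hx => mem_union_left _ (mem_image_of_mem φ hx)
  have hS : ∀ l ∈ L, ∀ x ∈ S l, φ x ∈ H := fun l hl x hx =>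
    mem_union_right _ (mem_biUnion.mpr ⟨l, hl, mem_image_of_mem φ hx⟩)
  rw [energy_eq_sum_sq φ T H hH, sum_congr rfl fun l hl => energy_eq_sum_sq φ (S l) H (hS l hl),
    sum_comm, mul_sum]
  refine sum_le_sum fun h' _ => ?_
  refine le_trans (Nat.pow_le_pow_left ?_ 2) (sq_sum_le_card_mul_sum_sq (s := L)
    (f := fun l => #{x ∈ S l | φ x = h'}))
  refine le_trans (card_le_card ?_) card_biUnion_le
  intro x hx
  rw [mem_filter] at hx
  obtain ⟨l, hl, hxl⟩ := h x hx.1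
  exact mem_biUnion.mpr ⟨l, hl, mem_filter.mpr ⟨hxl, hx.2⟩⟩

theorem energy_comp {τ G G' : Type*} [DecidableEq G] [DecidableEq G'] (φ : τ → G) (π : G → G')
    (T : Finset τ) (h : Set.InjOn π (φ '' T)) :
    energy (fun x => π (φ x)) T = energy φ T := by
  unfold energy
  congr 1
  refine filter_congr fun q hq => ?_
  rw [mem_product] at hq
  exact h.eq_iff (Set.mem_image_of_mem _ hq.1) (Set.mem_image_of_mem _ hq.2)

theorem energy_mul_card_eq {τ G : Type*} [DecidableEq G] [AddCommGroup G] [Fintype G]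
    (φ : τ → G) (T : Finset τ) :
    (energy φ T * Fintype.card G : ℝ) = ∑ ψ : AddChar G ℂ, ‖∑ x ∈ T, ψ (φ x)‖ ^ 2 := by
  have h1 : ∀ ψ : AddChar G ℂ, ((‖∑ x ∈ T, ψ (φ x)‖ ^ 2 : ℝ) : ℂ) =
      ∑ q ∈ T ×ˢ T, ψ (φ q.1 - φ q.2) := by
    intro ψ
    rw [sum_product]
    push_cast
    rw [← Complex.mul_conj', map_sum, sum_mul_sum]
    refine sum_congr rfl fun x _ => sum_congr rfl fun y _ => ?_
    rw [sub_eq_add_neg, AddChar.map_add_eq_mul, AddChar.map_neg_eq_conj]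
  have h2 : ((∑ ψ : AddChar G ℂ, ‖∑ x ∈ T, ψ (φ x)‖ ^ 2 : ℝ) : ℂ) =
      energy φ T * Fintype.card G := by
    push_cast
    simp_rw [← Complex.ofReal_pow, h1]
    rw [sum_comm]
    simp_rw [AddChar.sum_apply_eq_ite, sub_eq_zero]
    rw [← sum_filter, sum_const, energy, nsmul_eq_mul]
  exact_mod_cast h2.symm

theorem addChar_map_sum {ι G : Type*} [AddCommGroup G] (ψ : AddChar G ℂ) (S : Finset ι)
    (f : ι → G) : ψ (∑ i ∈ S, f i) = ∏ i ∈ S, ψ (f i) := by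
  classical
  induction S using Finset.induction_on with
  | empty => simp
  | insert a S ha ih => rw [sum_insert ha, prod_insert ha, AddChar.map_add_eq_mul, ih]

theorem energy_prod_pow_le_of_fintype {τ α γ G : Type*} [DecidableEq G] [AddCommGroup G]
    [Fintype G] [DecidableEq γ]
    (φ : τ → G) (F : Finset τ) (b : α → G) (A : Finset α) {s : ℕ} (hs : 1 ≤ s)
    (C : Finset γ) (cl : α → γ) (hcl : ∀ a ∈ A, cl a ∈ C) :
    energy (fun q : τ × (Fin s → α) => φ q.1 + ∑ i, b (q.2 i))
        (F ×ˢ Fintype.piFinset fun _ => A) ≤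
      #C ^ (2 * s - 1) * ∑ c ∈ C, energy (fun q : τ × (Fin s → α) => φ q.1 + ∑ i, b (q.2 i))
        (F ×ˢ Fintype.piFinset fun _ => {a ∈ A | cl a = c}) := by
  have hG : (0 : ℝ) < Fintype.card G := by exact_mod_cast Fintype.card_pos
  have hsum : ∀ (A : Finset α) (ψ : AddChar G ℂ),
      ∑ q ∈ F ×ˢ Fintype.piFinset (fun _ : Fin s => A), ψ (φ q.1 + ∑ i, b (q.2 i)) =
      (∑ x ∈ F, ψ (φ x)) * (∑ a ∈ A, ψ (b a)) ^ s := by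
    intro A ψ
    have : (∑ a ∈ A, ψ (b a)) ^ s = ∏ _i : Fin s, ∑ a ∈ A, ψ (b a) := by simp
    rw [this, prod_univ_sum, sum_mul_sum, sum_product]
    refine sum_congr rfl fun x _ => sum_congr rfl fun u _ => ?_
    rw [AddChar.map_add_eq_mul, addChar_map_sum]
  have h : ((energy (fun q : τ × (Fin s → α) => φ q.1 + ∑ i, b (q.2 i))
        (F ×ˢ Fintype.piFinset fun _ => A) : ℕ) : ℝ) ≤
      ((#C ^ (2 * s - 1) * ∑ c ∈ C, energy (fun q : τ × (Fin s → α) => φ q.1 + ∑ i, b (q.2 i))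
        (F ×ˢ Fintype.piFinset fun _ => {a ∈ A | cl a = c}) : ℕ) : ℝ) := by
    refine le_of_mul_le_mul_right ?_ hG
    push_cast
    rw [mul_assoc, sum_mul]
    simp_rw [energy_mul_card_eq, hsum]
    rw [sum_comm, mul_sum]
    refine sum_le_sum fun ψ _ => ?_
    simp_rw [norm_mul, mul_pow, ← mul_sum, norm_pow]
    rw [mul_left_comm]
    refine mul_le_mul_of_nonneg_left ?_ (by positivity)
    have hf : ∑ a ∈ A, ψ (b a) = ∑ c ∈ C, ∑ a ∈ A with cl a = c, ψ (b a) :=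
      (sum_fiberwise_of_maps_to hcl _).symm
    rw [hf]
    obtain ⟨n, hn⟩ : ∃ n, 2 * s = n + 1 := ⟨2 * s - 1, by omega⟩
    simp_rw [← pow_mul, mul_comm s 2, hn, Nat.add_sub_cancel]
    calc ‖∑ c ∈ C, ∑ a ∈ A with cl a = c, ψ (b a)‖ ^ (n + 1)
        ≤ (∑ c ∈ C, ‖∑ a ∈ A with cl a = c, ψ (b a)‖) ^ (n + 1) := by
          gcongr
          exact norm_sum_le _ _
      _ ≤ _ := pow_sum_le_card_mul_sum_pow (fun _ _ => norm_nonneg _) n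
  exact_mod_cast h

theorem exists_zmod_injOn {k : ℕ} (V : Finset (Fin k → ℤ)) :
    ∃ Q : ℕ, Q ≠ 0 ∧ Set.InjOn (fun (v : Fin k → ℤ) j => ((v j : ℤ) : ZMod Q)) V := by
  set M := ∑ v ∈ V, ∑ j, (v j).natAbs
  have hM : ∀ v ∈ V, ∀ j, |v j| ≤ M := by
    intro v hv j
    rw [Int.abs_eq_natAbs]
    norm_cast
    exact (single_le_sum (f := fun j => (v j).natAbs) (fun _ _ => Nat.zero_le _)
      (mem_univ j)).trans (single_le_sum (f := fun v : Fin k → ℤ => ∑ j, (v j).natAbs)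
        (fun _ _ => Nat.zero_le _) hv)
  refine ⟨2 * M + 1, by omega, ?_⟩
  intro v hv w hw h
  funext j
  have h1 := congrFun h j
  simp only at h1
  rw [ZMod.intCast_eq_intCast_iff_dvd_sub] at h1
  have h2 := abs_le.mp (hM v hv j)
  have h3 := abs_le.mp (hM w hw j)
  have h4 : w j - v j = 0 := by
    refine Int.eq_zero_of_abs_lt_dvd h1 ?_
    rw [abs_lt]
    push_cast
    constructor <;> linarith
  linarith

theorem energy_prod_pow_le {τ α γ : Type*} {k : ℕ} [DecidableEq γ]
    (φ : τ → Fin k → ℤ) (F : Finset τ) (b : α → Fin k → ℤ) (A : Finset α) {s : ℕ} (hs : 1 ≤ s)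
    (C : Finset γ) (cl : α → γ) (hcl : ∀ a ∈ A, cl a ∈ C) :
    energy (fun q : τ × (Fin s → α) => φ q.1 + ∑ i, b (q.2 i))
        (F ×ˢ Fintype.piFinset fun _ => A) ≤
      #C ^ (2 * s - 1) * ∑ c ∈ C, energy (fun q : τ × (Fin s → α) => φ q.1 + ∑ i, b (q.2 i))
        (F ×ˢ Fintype.piFinset fun _ => {a ∈ A | cl a = c}) := by
  classical
  set Φ := fun q : τ × (Fin s → α) => φ q.1 + ∑ i, b (q.2 i)
  obtain ⟨Q, hQ, hinj⟩ := exists_zmod_injOn ((F ×ˢ Fintype.piFinset fun _ => A).image Φ)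
  have : NeZero Q := ⟨hQ⟩
  let π : (Fin k → ℤ) → (Fin k → ZMod Q) := fun v j => ((v j : ℤ) : ZMod Q)
  have hadd : ∀ q : τ × (Fin s → α), π (Φ q) = π (φ q.1) + ∑ i, π (b (q.2 i)) := by
    intro q
    funext j
    simp [π, Φ]
  have key : ∀ T ⊆ F ×ˢ Fintype.piFinset (fun _ : Fin s => A), energy Φ T =
      energy (fun q : τ × (Fin s → α) => π (φ q.1) + ∑ i, π (b (q.2 i))) T := by
    intro T hT
    rw [← energy_comp Φ π T (hinj.mono ?_)]
    · simp_rw [hadd]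
    · rw [coe_image]
      exact Set.image_mono (by exact_mod_cast hT)
  have hsub : ∀ c, F ×ˢ Fintype.piFinset (fun _ : Fin s => {a ∈ A | cl a = c}) ⊆
      F ×ˢ Fintype.piFinset (fun _ : Fin s => A) := fun c =>
    product_subset_product_right (Fintype.piFinset_subset _ _ fun _ => filter_subset _ _)
  rw [key _ subset_rfl, sum_congr rfl fun c _ => key _ (hsub c)]
  exact energy_prod_pow_le_of_fintype (fun x => π (φ x)) F (fun a => π (b a)) A hs C cl hcl

/-! ### Vinogradov's mean value theorem -/

/-- The vector `(x, x ^ 2, …, x ^ k)`. -/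
def mom (k : ℕ) (x : ℤ) : Fin k → ℤ := fun j => x ^ ((j : ℕ) + 1)

/-- Vinogradov's mean value: the number of solutions of the Vinogradov system of degree `k`
in `s + s` variables from `{1, …, X}`. -/
noncomputable def vmv (s k X : ℕ) : ℕ :=
  energy (fun u : Fin s → ℤ => ∑ i, mom k (u i)) (Fintype.piFinset fun _ => Icc (1 : ℤ) X)

theorem energy_le_of_injOn {τ τ' G : Type*} [DecidableEq G] {φ : τ → G} {φ' : τ' → G}
    {S : Finset τ} {S' : Finset τ'} (f : τ → τ') (hf : Set.InjOn f S) (hm : ∀ x ∈ S, f x ∈ S')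
    (hφ : ∀ x ∈ S, φ' (f x) = φ x) : energy φ S ≤ energy φ' S' := by
  refine card_le_card_of_injOn (fun q => (f q.1, f q.2)) ?_ ?_
  · rintro ⟨x, y⟩ h
    simp only [coe_filter, mem_product, Set.mem_ofPred_eq] at h ⊢
    exact ⟨⟨hm _ h.1.1, hm _ h.1.2⟩, by rw [hφ _ h.1.1, hφ _ h.1.2, h.2]⟩
  · rintro ⟨x, y⟩ h ⟨x', y'⟩ h' he
    simp only [coe_filter, mem_product, Set.mem_ofPred_eq] at h h'
    simp only [Prod.mk.injEq] at he ⊢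
    exact ⟨hf h.1.1 h'.1.1 he.1, hf h.1.2 h'.1.2 he.2⟩

theorem sum_sub_pow_eq {ι : Type*} [Fintype ι] {k : ℕ} {w w' : ι → ℤ}
    (h : ∑ i, mom k (w i) = ∑ i, mom k (w' i)) (c : ℤ) {j : ℕ} (hj : j ≤ k) :
    ∑ i, (w i - c) ^ j = ∑ i, (w' i - c) ^ j := by
  have hpow : ∀ m ≤ k, ∑ i, w i ^ m = ∑ i, w' i ^ m := by
    intro m hm
    rcases Nat.eq_zero_or_pos m with rfl | hm0
    · simp
    have := congrFun h ⟨m - 1, by omega⟩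
    simp only [Finset.sum_apply, mom] at this
    rwa [show m - 1 + 1 = m by omega] at this
  simp_rw [sub_eq_add_neg, add_pow]
  rw [sum_comm, sum_comm (t := range (j + 1))]
  refine sum_congr rfl fun m hm => ?_
  simp_rw [mul_assoc]
  rw [← sum_mul, ← sum_mul, hpow m (by rw [mem_range] at hm; omega)]

/-- Tuples from `{1, …, X}` with entries pairwise incongruent modulo `p`. -/
noncomputable def distinctTuples (k X p : ℕ) : Finset (Fin k → ℤ) :=
  {x ∈ Fintype.piFinset fun _ : Fin k => Icc (1 : ℤ) X | ∀ i j, i ≠ j → ¬ (p : ℤ) ∣ x i - x j}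

theorem energy_residue_le {s k X p : ℕ} (hp : p.Prime) (hk : k ≠ 0) (hkp : k < p)
    (hX : X ≤ p ^ k) (c : ℤ) :
    energy (fun q : (Fin k → ℤ) × (Fin s → ℤ) => ∑ i, mom k (q.1 i) + ∑ i, mom k (q.2 i))
      (distinctTuples k X p ×ˢ Fintype.piFinset fun _ => {a ∈ Icc (1 : ℤ) X | a % p = c}) ≤
    vmv s k (X / p + 1) * (X ^ k * (k.factorial * p ^ (k * (k - 1) / 2))) := by
  classical
  set F := distinctTuples k X p
  set A := Fintype.piFinset fun _ : Fin s => {a ∈ Icc (1 : ℤ) X | a % p = c}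
  have hp0 : (0 : ℤ) < p := by exact_mod_cast hp.pos
  set d : ℤ := c - p with hd
  have hA : ∀ u ∈ A, ∀ i, u i = d + p * (u i / p + 1) ∧
      u i / p + 1 ∈ Icc (1 : ℤ) ((X / p + 1 : ℕ) : ℤ) := by
    intro u hu i
    simp only [A, Fintype.mem_piFinset, mem_filter, mem_Icc] at hu
    obtain ⟨⟨h1, h2⟩, h3⟩ := hu i
    refine ⟨?_, ?_⟩
    · have := Int.emod_add_mul_ediv (u i) p
      rw [h3] at this
      rw [hd]
      linarith
    · rw [mem_Icc]
      have h4 : 0 ≤ u i / p := Int.ediv_nonneg (by linarith) hp0.le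
      have h5 : u i / p ≤ (X : ℤ) / p := Int.ediv_le_ediv hp0 h2
      push_cast
      constructor <;> linarith
  let P : Finset ((Fin k → ℤ) × (Fin k → ℤ)) :=
    {q ∈ F ×ˢ F | ∀ j ∈ Icc 1 k, (p : ℤ) ^ j ∣ ∑ i, (q.1 i - d) ^ j - ∑ i, (q.2 i - d) ^ j}
  have hP : #P ≤ X ^ k * (k.factorial * p ^ (k * (k - 1) / 2)) := by
    have hF : #F ≤ X ^ k := by
      refine (card_filter_le _ _).trans ?_
      simp
    refine le_trans ?_ (Nat.mul_le_mul_right _ hF)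
    rw [mul_comm]
    refine card_le_mul_card_image_of_maps_to (f := Prod.snd) ?_ _ ?_
    · intro q hq
      exact (mem_product.mp (mem_filter.mp hq).1).2
    · intro y hy
      let S : Finset (Fin k → ℤ) := {q ∈ P | q.2 = y}.image fun q i => q.1 i - d
      have hS : #{q ∈ P | q.2 = y} = #S := by
        refine (card_image_of_injOn ?_).symm
        rintro ⟨x, z⟩ h ⟨x', z'⟩ h' he
        simp only [coe_filter, Set.mem_ofPred_eq] at h h'
        have h1 : x = x' := by
          funext i
          have := congrFun he i
          simp only at this
          linarith
        rw [h1, h.2, h'.2]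
      have hmemF : ∀ x ∈ F, (∀ i, x i ∈ Icc (1 : ℤ) X) ∧
          ∀ i j, i ≠ j → ¬ (p : ℤ) ∣ x i - x j := by
        intro x hx
        simpa only [F, distinctTuples, mem_filter, Fintype.mem_piFinset] using hx
      have hSmem : ∀ w ∈ S, ∃ x ∈ F, (x, y) ∈ P ∧ w = fun i => x i - d := by
        intro w hw
        obtain ⟨⟨x, z⟩, hq, rfl⟩ := mem_image.mp hw
        obtain ⟨h1, h2⟩ := mem_filter.mp hq
        simp only at h2
        subst h2
        exact ⟨x, (mem_product.mp (mem_filter.mp h1).1).1, h1, rfl⟩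
      rw [hS]
      refine card_le_of_dvd_psum_sub hp hk hkp (fun j => ∑ i, (y i - d) ^ j)
        {a | a + d ∈ Icc (1 : ℤ) X} ?_ S ?_ ?_ ?_
      · intro a ha b hb hab
        simp only [Set.mem_ofPred_eq, mem_Icc] at ha hb
        have : a - b = 0 := by
          refine Int.eq_zero_of_abs_lt_dvd hab ?_
          have : (X : ℤ) ≤ (p : ℤ) ^ k := by exact_mod_cast hX
          rw [abs_lt]
          constructor <;> linarith
        linarith
      · intro w hw i
        obtain ⟨x, hx, -, rfl⟩ := hSmem w hw
        simpa using (hmemF x hx).1 i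
      · intro w hw i j hij
        obtain ⟨x, hx, -, rfl⟩ := hSmem w hw
        simpa using (hmemF x hx).2 i j hij
      · intro w hw j hj
        obtain ⟨x, hx, hxP, rfl⟩ := hSmem w hw
        exact (mem_filter.mp hxP).2 j hj
  refine le_trans ?_ (Nat.mul_le_mul_left _ hP)
  unfold energy
  refine card_le_mul_card_image_of_maps_to (f := fun q => (q.1.1, q.2.1)) ?_ _ ?_
  · rintro ⟨⟨x, u⟩, ⟨y, v⟩⟩ h
    simp only [mem_filter, mem_product] at h
    obtain ⟨⟨⟨hx, hu⟩, hy, hv⟩, heq⟩ := h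
    refine mem_filter.mpr ⟨mem_product.mpr ⟨hx, hy⟩, fun j hj => ?_⟩
    have h1 := sum_sub_pow_eq (w := Sum.elim x u) (w' := Sum.elim y v)
      (by simpa only [Fintype.sum_sum_type, Sum.elim_inl, Sum.elim_inr] using heq) d
      (mem_Icc.mp hj).2
    simp only [Fintype.sum_sum_type, Sum.elim_inl, Sum.elim_inr] at h1
    have h2 : ∀ u ∈ A, (p : ℤ) ^ j ∣ ∑ i, (u i - d) ^ j := by
      intro u hu
      refine dvd_sum fun i _ => pow_dvd_pow_of_dvd ?_ j
      rw [(hA u hu i).1]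
      simp
    have h3 : ∑ i, (x i - d) ^ j - ∑ i, (y i - d) ^ j =
        ∑ i, (v i - d) ^ j - ∑ i, (u i - d) ^ j := by linarith
    simp only
    rw [h3]
    exact dvd_sub (h2 v hv) (h2 u hu)
  · rintro ⟨x, y⟩ hxy
    let g : Fin k → ℤ := fun j =>
      (∑ i, (y i - d) ^ ((j : ℕ) + 1) - ∑ i, (x i - d) ^ ((j : ℕ) + 1)) / (p : ℤ) ^ ((j : ℕ) + 1)
    refine le_trans ?_ (card_filter_sub_le_energy (fun u : Fin s → ℤ => ∑ i, mom k (u i))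
      (Fintype.piFinset fun _ => Icc (1 : ℤ) ((X / p + 1 : ℕ) : ℤ)) g)
    refine card_le_card_of_injOn
      (fun q => (fun i => q.1.2 i / p + 1, fun i => q.2.2 i / p + 1)) ?_ ?_
    · rintro ⟨⟨x', u⟩, ⟨y', v⟩⟩ h
      simp only [coe_filter, mem_product, Set.mem_ofPred_eq, mem_filter, Prod.mk.injEq] at h
      obtain ⟨⟨⟨⟨hx, hu⟩, hy, hv⟩, heq⟩, rfl, rfl⟩ := h
      simp only [coe_filter, mem_product, Set.mem_ofPred_eq, Fintype.mem_piFinset]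
      refine ⟨⟨fun i => (hA u hu i).2, fun i => (hA v hv i).2⟩, ?_⟩
      funext j
      simp only [Finset.sum_apply, Pi.add_apply, mom, g]
      have h1 := sum_sub_pow_eq (w := Sum.elim x' u) (w' := Sum.elim y' v)
        (by simpa only [Fintype.sum_sum_type, Sum.elim_inl, Sum.elim_inr] using heq) d
        (show (j : ℕ) + 1 ≤ k from j.2)
      simp only [Fintype.sum_sum_type, Sum.elim_inl, Sum.elim_inr] at h1
      have h2 : ∀ u ∈ A, ∑ i, (u i - d) ^ ((j : ℕ) + 1) =
          (p : ℤ) ^ ((j : ℕ) + 1) * ∑ i, (u i / p + 1) ^ ((j : ℕ) + 1) := by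
        intro u hu
        rw [mul_sum]
        refine sum_congr rfl fun i _ => ?_
        rw [← mul_pow]
        congr 1
        have := (hA u hu i).1
        linarith
      have h3 : ∑ i, (y' i - d) ^ ((j : ℕ) + 1) - ∑ i, (x' i - d) ^ ((j : ℕ) + 1) =
          (p : ℤ) ^ ((j : ℕ) + 1) * (∑ i, (u i / p + 1) ^ ((j : ℕ) + 1) -
            ∑ i, (v i / p + 1) ^ ((j : ℕ) + 1)) := by
        rw [mul_sub, ← h2 u hu, ← h2 v hv]
        linarith
      rw [h3, Int.mul_ediv_cancel_left _ (pow_ne_zero _ hp0.ne')]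
      ring
    · rintro ⟨⟨x', u⟩, ⟨y', v⟩⟩ h ⟨⟨x'', u'⟩, ⟨y'', v'⟩⟩ h' he
      simp only [coe_filter, mem_product, Set.mem_ofPred_eq, mem_filter, Prod.mk.injEq] at h h' he
      obtain ⟨⟨⟨⟨hx, hu⟩, hy, hv⟩, heq⟩, rfl, rfl⟩ := h
      obtain ⟨⟨⟨⟨hx', hu'⟩, hy', hv'⟩, heq'⟩, rfl, rfl⟩ := h'
      have huu : ∀ u ∈ A, ∀ u' ∈ A, ((fun i => u i / p + 1) = fun i => u' i / p + 1) →
          u = u' := by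
        intro u hu u' hu' h
        funext i
        rw [(hA u hu i).1, (hA u' hu' i).1, congrFun h i]
      rw [huu u hu u' hu' he.1, huu v hv v' hv' he.2]

theorem card_lt_of_forall_dvd {k X : ℕ} (hk : k ≠ 0) (Q : Finset ℕ) (hQ : ∀ p ∈ Q, p.Prime ∧ X ≤ p ^ k)
    {d : ℤ} (hd : d ≠ 0) (hdX : |d| < X) (hdvd : ∀ p ∈ Q, (p : ℤ) ∣ d) : #Q < k := by
  by_contra! h
  have h1 : (∏ p ∈ Q, p) ∣ d.natAbs := by
    refine Finset.prod_primes_dvd _ (fun p hp => (hQ p hp).1.prime) fun p hp => ?_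
    exact Int.natCast_dvd.mp (hdvd p hp)
  have h2 : ∏ p ∈ Q, p < X := by
    refine lt_of_le_of_lt (Nat.le_of_dvd (Int.natAbs_pos.mpr hd) h1) ?_
    rw [Int.abs_eq_natAbs] at hdX
    exact_mod_cast hdX
  have hX : 1 ≤ X := by omega
  have h3 : X ^ #Q ≤ (∏ p ∈ Q, p) ^ k := by
    rw [← prod_pow, ← prod_const]
    exact prod_le_prod' fun p hp => (hQ p hp).2
  have h4 : X ^ k ≤ X ^ #Q := Nat.pow_le_pow_right hX h
  exact absurd (h4.trans h3) (not_le.mpr (Nat.pow_lt_pow_left h2 hk))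

theorem exists_prime_distinct {k X : ℕ} (Q : Finset ℕ) (hQ : ∀ p ∈ Q, p.Prime ∧ X ≤ p ^ k)
    (hcard : k ^ 3 ≤ #Q) (hk : k ≠ 0) (x : Fin k → ℤ) (hx : ∀ i, x i ∈ Icc (1 : ℤ) X)
    (hinj : Function.Injective x) :
    ∃ p ∈ Q, ∀ i j, i ≠ j → ¬ (p : ℤ) ∣ x i - x j := by
  by_contra! h
  have hcov : Q ⊆ (univ : Finset (Fin k)).offDiag.biUnion
      fun ij => {p ∈ Q | (p : ℤ) ∣ x ij.1 - x ij.2} := by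
    intro p hp
    obtain ⟨i, j, hij, hd⟩ := h p hp
    exact mem_biUnion.mpr ⟨(i, j), by simpa using hij, mem_filter.mpr ⟨hp, hd⟩⟩
  have h1 : #Q ≤ #(univ : Finset (Fin k)).offDiag * k := by
    refine (card_le_card hcov).trans (card_biUnion_le_card_mul _ _ _ fun ij hij => ?_)
    refine (card_lt_of_forall_dvd hk (X := X) (d := x ij.1 - x ij.2) _
      (fun p hp => hQ p (mem_filter.mp hp).1) ?_ ?_ (fun p hp => (mem_filter.mp hp).2)).le
    · intro h0
      simp only [mem_offDiag, mem_univ, true_and] at hij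
      exact hij (hinj (by linarith))
    · have h2 := mem_Icc.mp (hx ij.1)
      have h3 := mem_Icc.mp (hx ij.2)
      rw [abs_lt]
      constructor <;> linarith
  rw [offDiag_card, card_univ, Fintype.card_fin] at h1
  have h2 : (k * k - k) * k < k ^ 3 := by
    have : k * k - k < k * k := Nat.sub_lt (by positivity) (by omega)
    calc (k * k - k) * k < k * k * k := Nat.mul_lt_mul_of_pos_right this (by omega)
      _ = k ^ 3 := by ring
  omega

theorem card_few_values_le {ι : Type*} [Fintype ι] [DecidableEq ι] [Nonempty ι] {k : ℕ}
    (A : Finset ℤ) :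
    #{w ∈ Fintype.piFinset fun _ : ι => A | #(univ.image w) ≤ k} ≤
      #A ^ k * k ^ Fintype.card ι := by
  have h1 : #A ^ k * k ^ Fintype.card ι =
      #((Fintype.piFinset fun _ : Fin k => A) ×ˢ (univ : Finset (ι → Fin k))) := by
    simp
  rw [h1]
  refine le_trans (card_le_card ?_) (card_image_le (f := fun q => q.1 ∘ q.2))
  intro w hw
  simp only [mem_filter, Fintype.mem_piFinset] at hw
  obtain ⟨hwA, hwk⟩ := hw
  let V := univ.image w
  have hV : ∀ i, w i ∈ V := fun i => mem_image_of_mem _ (mem_univ i)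
  obtain ⟨e⟩ : Nonempty (V ↪ Fin k) :=
    Function.Embedding.nonempty_of_card_le (by simpa [V] using hwk)
  let i0 : ι := Classical.arbitrary ι
  rw [mem_image]
  refine ⟨(Function.extend e (fun a => (a : ℤ)) fun _ => w i0, fun i => e ⟨w i, hV i⟩), ?_, ?_⟩
  · simp only [mem_product, Fintype.mem_piFinset, mem_univ, and_true]
    intro j
    by_cases hj : ∃ a, e a = j
    · obtain ⟨a, rfl⟩ := hj
      rw [e.injective.extend_apply]
      obtain ⟨i, -, hi⟩ := mem_image.mp a.2
      rw [← hi]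
      exact hwA i
    · rw [Function.extend_apply' _ _ _ hj]
      exact hwA _
  · funext i
    simp only [Function.comp]
    rw [e.injective.extend_apply]

theorem exists_perm_injective {k s : ℕ} (w : Fin k ⊕ Fin s → ℤ) (h : k ≤ #(univ.image w)) :
    ∃ σ : Equiv.Perm (Fin k ⊕ Fin s), Function.Injective fun i => w (σ (Sum.inl i)) := by
  classical
  obtain ⟨V, hV, hVk⟩ := exists_subset_card_eq h
  have e : Fin k ≃ V := (Fintype.equivFinOfCardEq (by simpa using hVk)).symm
  have hex : ∀ i : Fin k, ∃ a, w a = e i := fun i => by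
    obtain ⟨a, -, ha⟩ := mem_image.mp (hV (e i).2)
    exact ⟨a, ha⟩
  choose f hf using hex
  have hfinj : Function.Injective f := fun i j hij => by
    have : (e i : ℤ) = e j := by rw [← hf, ← hf, hij]
    exact e.injective (Subtype.ext this)
  let g : Fin k ⊕ Fin s → Fin k ⊕ Fin s := Sum.elim f Sum.inr
  obtain ⟨σ, hσ⟩ := Finset.exists_equiv_extend_of_card_eq (α := Fin k ⊕ Fin s)
    (t := univ) (by simp) (s := univ.image Sum.inl) (f := g) (subset_univ _) (by
      intro a ha b hb hab
      simp only [coe_image, coe_univ, Set.image_univ, Set.mem_range] at ha hb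
      obtain ⟨i, rfl⟩ := ha
      obtain ⟨j, rfl⟩ := hb
      exact congrArg _ (hfinj hab))
  refine ⟨σ.trans (Equiv.subtypeUnivEquiv fun _ => mem_univ _), fun i j hij => ?_⟩
  have h1 : ∀ i, ((σ (Sum.inl i) : _) : Fin k ⊕ Fin s) = f i := fun i =>
    hσ _ (mem_image_of_mem _ (mem_univ i))
  simp only [Equiv.trans_apply, Equiv.subtypeUnivEquiv_apply, h1, hf] at hij
  exact e.injective (Subtype.ext hij)

theorem energy_distinct_le {s k X p : ℕ} (hp : p.Prime) (hk : k ≠ 0) (hs : s ≠ 0)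
    (hkp : k < p) (hX : X ≤ p ^ k) :
    energy (fun q : (Fin k → ℤ) × (Fin s → ℤ) => ∑ i, mom k (q.1 i) + ∑ i, mom k (q.2 i))
      (distinctTuples k X p ×ˢ Fintype.piFinset fun _ => Icc (1 : ℤ) X) ≤
    p ^ (2 * s) * (vmv s k (X / p + 1) * (X ^ k * (k.factorial * p ^ (k * (k - 1) / 2)))) := by
  have hp0 : (p : ℤ) ≠ 0 := by exact_mod_cast hp.ne_zero
  refine (energy_prod_pow_le (fun x : Fin k → ℤ => ∑ i, mom k (x i)) _ (mom k) _
    (Nat.one_le_iff_ne_zero.mpr hs) (Ico (0 : ℤ) p) (fun a => a % (p : ℤ)) ?_).trans ?_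
  · intro a _
    exact mem_Ico.mpr ⟨Int.emod_nonneg _ hp0,
      Int.emod_lt_of_pos _ (by exact_mod_cast hp.pos)⟩
  · calc _ ≤ #(Ico (0 : ℤ) p) ^ (2 * s - 1) * ∑ c ∈ Ico (0 : ℤ) p,
          vmv s k (X / p + 1) * (X ^ k * (k.factorial * p ^ (k * (k - 1) / 2))) :=
          Nat.mul_le_mul_left _ (sum_le_sum fun c _ => energy_residue_le hp hk hkp hX c)
      _ = _ := by
          rw [sum_const, smul_eq_mul, Int.card_Ico, sub_zero, Int.toNat_natCast, ← mul_assoc,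
            ← pow_succ, show 2 * s - 1 + 1 = 2 * s by omega]

theorem vmv_le_sum {k s X : ℕ} (hk : k ≠ 0) (hs : s ≠ 0) (Q : Finset ℕ)
    (hQ : ∀ p ∈ Q, p.Prime ∧ k < p ∧ X ≤ p ^ k) (hcard : k ^ 3 ≤ #Q) :
    vmv (k + s) k X ≤ (1 + (k + s).factorial * #Q) * ((X ^ (k - 1) * (k - 1) ^ (k + s)) ^ 2 +
      (k + s).factorial * ∑ p ∈ Q, p ^ (2 * s) * (vmv s k (X / p + 1) *
        (X ^ k * (k.factorial * p ^ (k * (k - 1) / 2))))) := by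
  classical
  set φ : (Fin k ⊕ Fin s → ℤ) → Fin k → ℤ := fun w => ∑ i, mom k (w i) with hφ
  set T := Fintype.piFinset fun _ : Fin k ⊕ Fin s => Icc (1 : ℤ) X
  have h1 : vmv (k + s) k X ≤ energy φ T := by
    refine energy_le_of_injOn (fun u i => u (finSumFinEquiv i)) ?_ ?_ ?_
    · intro u _ v _ h
      funext i
      have := congrFun h (finSumFinEquiv.symm i)
      simpa using this
    · intro u hu
      rw [Fintype.mem_piFinset] at hu ⊢
      exact fun i => hu _
    · intro u _
      exact Equiv.sum_comp finSumFinEquiv fun i => mom k (u i)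
  refine h1.trans ?_
  let S : Option (Equiv.Perm (Fin k ⊕ Fin s) × ℕ) → Finset (Fin k ⊕ Fin s → ℤ)
    | none => {w ∈ T | #(univ.image w) ≤ k - 1}
    | some (σ, p) => {w ∈ T | ∀ i j, i ≠ j →
        ¬ (p : ℤ) ∣ w (σ (Sum.inl i)) - w (σ (Sum.inl j))}
  let L := insertNone ((univ : Finset (Equiv.Perm (Fin k ⊕ Fin s))) ×ˢ Q)
  have hL : #L = 1 + (k + s).factorial * #Q := by
    simp only [L, card_insertNone, card_product, card_univ, Fintype.card_perm, Fintype.card_sum,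
      Fintype.card_fin, add_comm]
  rw [← hL]
  refine (energy_le_of_cover φ T L S ?_).trans (Nat.mul_le_mul_left _ ?_)
  · intro w hw
    by_cases hk' : #(univ.image w) ≤ k - 1
    · exact ⟨none, by simp [L], mem_filter.mpr ⟨hw, hk'⟩⟩
    · obtain ⟨σ, hσ⟩ := exists_perm_injective w (by omega)
      obtain ⟨p, hp, hpd⟩ := exists_prime_distinct (X := X) Q (fun p hp => ⟨(hQ p hp).1, (hQ p hp).2.2⟩)
        hcard hk _ (fun i => Fintype.mem_piFinset.mp hw _) hσ
      exact ⟨some (σ, p), by simp [L, hp], mem_filter.mpr ⟨hw, hpd⟩⟩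
  · have hne : Nonempty (Fin k ⊕ Fin s) := ⟨Sum.inl ⟨0, by omega⟩⟩
    rw [sum_insertNone]
    refine add_le_add ?_ ?_
    · calc energy φ (S none) ≤ #(S none ×ˢ S none) := card_filter_le _ _
        _ = #(S none) ^ 2 := by rw [card_product, sq]
        _ ≤ _ := by
          refine Nat.pow_le_pow_left ?_ 2
          refine (card_few_values_le (ι := Fin k ⊕ Fin s) _).trans ?_
          simp
    · rw [sum_product]
      have : ∀ σ ∈ (univ : Finset (Equiv.Perm (Fin k ⊕ Fin s))),
          ∑ p ∈ Q, energy φ (S (some (σ, p))) ≤ ∑ p ∈ Q, p ^ (2 * s) * (vmv s k (X / p + 1) *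
        (X ^ k * (k.factorial * p ^ (k * (k - 1) / 2)))) := by
        intro σ _
        refine sum_le_sum fun p hp => ?_
        refine le_trans ?_ (energy_distinct_le (hQ p hp).1 hk hs (hQ p hp).2.1 (hQ p hp).2.2)
        refine energy_le_of_injOn
          (fun w => (fun i => w (σ (Sum.inl i)), fun i => w (σ (Sum.inr i)))) ?_ ?_ ?_
        · intro w _ w' _ h
          simp only [Prod.mk.injEq] at h
          have : ∀ a, w (σ a) = w' (σ a) := by
            rintro (a | a)
            · exact congrFun h.1 a
            · exact congrFun h.2 a
          funext a
          simpa using this (σ.symm a)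
        · intro w hw
          obtain ⟨hw1, hw2⟩ := mem_filter.mp hw
          rw [Fintype.mem_piFinset] at hw1
          exact mem_product.mpr ⟨mem_filter.mpr ⟨Fintype.mem_piFinset.mpr fun i => hw1 _, hw2⟩,
            Fintype.mem_piFinset.mpr fun i => hw1 _⟩
        · intro w _
          simp only [hφ]
          rw [← Equiv.sum_comp σ, Fintype.sum_sum_type]
      refine (sum_le_sum this).trans ?_
      rw [sum_const, card_univ, Fintype.card_perm, Fintype.card_sum, Fintype.card_fin,
        Fintype.card_fin, smul_eq_mul]

theorem exists_forall_le_theta_sub :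
    ∃ P₁ : ℕ, 2 ≤ P₁ ∧ ∀ P : ℕ, P₁ ≤ P →
      (P : ℝ) ≤ Chebyshev.theta ((8 * P : ℕ) : ℝ) - Chebyshev.theta (P : ℝ) := by
  have h1 : ∀ᶠ x : ℝ in Filter.atTop, Real.log x ≤ 1 / 100 * x ^ (1 / 2 : ℝ) := by
    have := (isLittleO_log_rpow_atTop (r := 1 / 2) (by norm_num)).bound
      (show (0 : ℝ) < 1 / 100 by norm_num)
    filter_upwards [this, Filter.eventually_ge_atTop 1] with x hx hx1
    rw [Real.norm_of_nonneg (Real.log_nonneg hx1), Real.norm_of_nonneg (by positivity)] at hx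
    exact hx
  obtain ⟨x₀, hx₀⟩ := Filter.eventually_atTop.mp h1
  refine ⟨max 2 ⌈x₀⌉₊, le_max_left _ _, fun P hP => ?_⟩
  have hP2 : (2 : ℝ) ≤ P := by exact_mod_cast (le_max_left _ _).trans hP
  have hPx : x₀ ≤ P := (Nat.le_ceil _).trans (by exact_mod_cast (le_max_right _ _).trans hP)
  have hu := Chebyshev.theta_le_log4_mul_x (x := (P : ℝ)) (by linarith)
  have hl := Chebyshev.theta_ge (8 * P)
  have h8 := hx₀ (8 * P) (by linarith)
  have h9 := hx₀ (8 * P + 1) (by linarith)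
  rw [← Real.sqrt_eq_rpow] at h8 h9
  have h4 : Real.log 4 = 2 * Real.log 2 := by
    rw [show (4 : ℝ) = 2 ^ 2 by norm_num, Real.log_pow]; norm_num
  have hs : √(8 * (P : ℝ)) * √(8 * (P : ℝ)) = 8 * P := Real.mul_self_sqrt (by linarith)
  have hs1 : √(8 * (P : ℝ) + 1) ≤ 8 * P + 1 := by
    rw [Real.sqrt_le_left (by linarith)]
    nlinarith
  have hlog2 := Real.log_two_gt_d9
  push_cast at hl ⊢
  rw [h4] at hu
  have h10 : 2 * √(8 * (P : ℝ)) * Real.log (8 * P) ≤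
      2 * √(8 * (P : ℝ)) * (1 / 100 * √(8 * P)) := by gcongr
  nlinarith

theorem exists_primes_between :
    ∃ c₁ : ℕ, 16 ≤ c₁ ∧ ∀ k P : ℕ, k ≠ 0 → c₁ * k ^ 4 ≤ P →
      ∃ Q : Finset ℕ, #Q = k ^ 3 ∧ ∀ p ∈ Q, p.Prime ∧ P < p ∧ p ≤ 8 * P := by
  obtain ⟨P₁, hP₁, h⟩ := exists_forall_le_theta_sub
  refine ⟨P₁ + 4096, by omega, fun k P hk hP => ?_⟩
  have hk4 : 1 ≤ k ^ 4 := Nat.one_le_pow _ _ (by omega)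
  have hPP : P₁ ≤ P := by nlinarith
  have hPk : 4096 * k ^ 4 ≤ P := by nlinarith
  have hP0 : (0 : ℝ) < P := by
    have : 0 < P := by omega
    exact_mod_cast this
  have hth := h P hPP
  let R := {p ∈ Ioc P (8 * P) | p.Prime}
  have hsum : Chebyshev.theta ((8 * P : ℕ) : ℝ) - Chebyshev.theta (P : ℝ) =
      ∑ p ∈ R, Real.log p := by
    simp only [Chebyshev.theta, Nat.floor_natCast]
    rw [sub_eq_iff_eq_add, ← sum_union]
    · congr 1
      ext p
      simp only [R, mem_filter, mem_Ioc, mem_union]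
      have : p ≤ P → p ≤ 8 * P := by omega
      have : P < p ∨ p ≤ P := by omega
      have : P < p → 0 < p := by omega
      tauto
    · rw [disjoint_left]
      intro p hp hp'
      simp only [R, mem_filter, mem_Ioc] at hp hp'
      omega
  have hcard : (P : ℝ) ≤ #R * Real.log (8 * P) := by
    refine (hsum ▸ hth).trans ?_
    rw [← nsmul_eq_mul]
    refine sum_le_card_nsmul _ _ _ fun p hp => ?_
    simp only [R, mem_filter, mem_Ioc] at hp
    refine Real.log_le_log (by exact_mod_cast hp.2.pos) (by exact_mod_cast hp.1.2)
  have hlog : Real.log (8 * P) ≤ 8 * (P : ℝ) ^ (1 / 4 : ℝ) := by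
    refine (Real.log_le_rpow_div (by positivity) (ε := 1 / 4) (by norm_num)).trans ?_
    rw [Real.mul_rpow (by norm_num) (by positivity)]
    have : (8 : ℝ) ^ (1 / 4 : ℝ) ≤ 2 := by
      calc (8 : ℝ) ^ (1 / 4 : ℝ) ≤ (16 : ℝ) ^ (1 / 4 : ℝ) := by gcongr; norm_num
        _ = 2 := by
          rw [show (16 : ℝ) = 2 ^ (4 : ℝ) by norm_num, ← Real.rpow_mul (by norm_num)]; norm_num
    have h0 : 0 ≤ (P : ℝ) ^ (1 / 4 : ℝ) := by positivity
    nlinarith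
  set y := (P : ℝ) ^ (1 / 4 : ℝ)
  have hy0 : 0 < y := by positivity
  have hy4 : y ^ 4 = P := by
    rw [← Real.rpow_natCast, ← Real.rpow_mul hP0.le]; norm_num
  have hyk : 8 * (k : ℝ) ≤ y := by
    refine le_of_pow_le_pow_left₀ (n := 4) (by norm_num) hy0.le ?_
    rw [hy4, mul_pow]
    have : ((4096 * k ^ 4 : ℕ) : ℝ) ≤ P := by exact_mod_cast hPk
    push_cast at this
    linarith
  have hR : k ^ 3 ≤ #R := by
    have h1 : y ^ 4 ≤ #R * (8 * y) := by
      rw [hy4]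
      exact hcard.trans (by gcongr)
    have h2 : y ^ 3 ≤ #R * 8 := by
      refine le_of_mul_le_mul_right ?_ hy0
      nlinarith
    have h3 : (8 * (k : ℝ)) ^ 3 ≤ y ^ 3 := by gcongr
    have h4 : ((k ^ 3 : ℕ) : ℝ) ≤ (#R : ℝ) := by
      push_cast
      nlinarith [show (0 : ℝ) ≤ (k : ℝ) ^ 3 by positivity]
    exact_mod_cast h4
  obtain ⟨Q, hQ, hQc⟩ := exists_subset_card_eq hR
  refine ⟨Q, hQc, fun p hp => ?_⟩
  have := hQ hp
  simp only [R, mem_filter, mem_Ioc] at this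
  exact ⟨this.2, this.1.1, this.1.2⟩

theorem vmv_summand_le {k s X p P : ℕ} {η D : ℝ} (hk : 2 ≤ k) (hX : 1 ≤ X) (hp : 1 ≤ p)
    (hpX : p ≤ X) (hpP : p ≤ 8 * P) (hPX : P ^ k ≤ 2 ^ k * X) (hD : 0 ≤ D)
    (hη0 : 0 ≤ η) (hη : η ≤ k * (k + 1) / 2) (he : 0 ≤ 2 * (s : ℝ) - k * (k + 1) / 2 + η)
    (hv : ∀ Y : ℕ, 1 ≤ Y → (vmv s k Y : ℝ) ≤ D * (Y : ℝ) ^ (2 * (s : ℝ) - k * (k + 1) / 2 + η)) :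
    ((p ^ (2 * s) * (vmv s k (X / p + 1) *
        (X ^ k * (k.factorial * p ^ (k * (k - 1) / 2)))) : ℕ) : ℝ) ≤
      k.factorial * 4 ^ s * 16 ^ (k ^ 2) * D *
        (X : ℝ) ^ (2 * ((k + s : ℕ) : ℝ) - k * (k + 1) / 2 + η * (1 - 1 / k)) := by
  set e := 2 * (s : ℝ) - k * (k + 1) / 2 + η with he_def
  have hk0 : (0 : ℝ) < k := by exact_mod_cast (by omega : 0 < k)
  have hX0 : (0 : ℝ) < X := by exact_mod_cast hX
  have hp0 : (0 : ℝ) < p := by exact_mod_cast hp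
  have hkk : (2 : ℝ) ≤ k := by exact_mod_cast hk
  have hη2 : η ≤ k ^ 2 := by nlinarith
  have hY : ((X / p + 1 : ℕ) : ℝ) ≤ 2 * (X / p) := by
    have h1 : ((X / p : ℕ) : ℝ) ≤ X / p := Nat.cast_div_le
    have h2 : (1 : ℝ) ≤ X / p := by
      rw [one_le_div hp0]
      exact_mod_cast hpX
    push_cast
    linarith
  have h1 : (vmv s k (X / p + 1) : ℝ) ≤ D * (4 ^ s * (X / p : ℝ) ^ e) := by
    refine (hv _ (Nat.le_add_left 1 _)).trans (mul_le_mul_of_nonneg_left ?_ hD)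
    refine (Real.rpow_le_rpow (by positivity) hY he).trans ?_
    rw [Real.mul_rpow (by norm_num) (by positivity)]
    refine mul_le_mul_of_nonneg_right ?_ (by positivity)
    calc (2 : ℝ) ^ e ≤ 2 ^ (2 * (s : ℝ)) := by
          refine Real.rpow_le_rpow_of_exponent_le (by norm_num) ?_
          linarith
      _ = 4 ^ s := by
          rw [Real.rpow_mul (by norm_num), Real.rpow_natCast]; norm_num
  have hpk : (p : ℝ) ≤ 16 * (X : ℝ) ^ (1 / k : ℝ) := by
    have h2 : (P : ℝ) ≤ 2 * (X : ℝ) ^ (1 / k : ℝ) := by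
      refine le_of_pow_le_pow_left₀ (n := k) (by omega) (by positivity) ?_
      rw [mul_pow, ← Real.rpow_natCast ((X : ℝ) ^ (1 / k : ℝ)), ← Real.rpow_mul hX0.le,
        one_div_mul_cancel hk0.ne', Real.rpow_one]
      exact_mod_cast hPX
    have h3 : (p : ℝ) ≤ 8 * P := by exact_mod_cast hpP
    linarith
  have h2 : (p : ℝ) ^ ((k : ℝ) ^ 2 - η) ≤ 16 ^ (k ^ 2) * (X : ℝ) ^ ((k : ℝ) - η / k) := by
    refine (Real.rpow_le_rpow hp0.le hpk (by linarith)).trans ?_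
    rw [Real.mul_rpow (by norm_num) (by positivity), ← Real.rpow_mul hX0.le]
    have h3 : 1 / (k : ℝ) * ((k : ℝ) ^ 2 - η) = k - η / k := by field_simp
    rw [h3]
    refine mul_le_mul_of_nonneg_right ?_ (by positivity)
    have h4 : (16 : ℝ) ^ (k ^ 2) = 16 ^ ((k ^ 2 : ℕ) : ℝ) := (Real.rpow_natCast _ _).symm
    rw [h4]
    refine Real.rpow_le_rpow_of_exponent_le (by norm_num) ?_
    push_cast
    linarith
  have htri : ((k * (k - 1) / 2 : ℕ) : ℝ) = k ^ 2 - k * (k + 1) / 2 := by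
    rw [Nat.cast_div (Nat.even_mul_pred_self k).two_dvd (by norm_num)]
    push_cast [Nat.cast_sub (by omega : 1 ≤ k)]
    ring
  have h3 : (p : ℝ) ^ (2 * s) * (X ^ k * (p : ℝ) ^ (k * (k - 1) / 2)) * (X / p : ℝ) ^ e =
      (X : ℝ) ^ (k + e) * (p : ℝ) ^ ((k : ℝ) ^ 2 - η) := by
    rw [Real.div_rpow hX0.le hp0.le, Real.rpow_add hX0 (k : ℝ) e, Real.rpow_natCast,
      show (k : ℝ) ^ 2 - η = ((2 * s : ℕ) : ℝ) + ((k * (k - 1) / 2 : ℕ) : ℝ) - e by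
        rw [htri, he_def]; push_cast; ring,
      Real.rpow_sub hp0 _ e, Real.rpow_add hp0 ((2 * s : ℕ) : ℝ), Real.rpow_natCast,
      Real.rpow_natCast]
    ring
  have h4 : (X : ℝ) ^ (k + e) * (X : ℝ) ^ ((k : ℝ) - η / k) =
      (X : ℝ) ^ (2 * ((k + s : ℕ) : ℝ) - k * (k + 1) / 2 + η * (1 - 1 / k)) := by
    rw [← Real.rpow_add hX0]
    congr 1
    rw [he_def]
    push_cast
    ring
  push_cast
  calc (p : ℝ) ^ (2 * s) * ((vmv s k (X / p + 1) : ℝ) *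
        ((X : ℝ) ^ k * (k.factorial * (p : ℝ) ^ (k * (k - 1) / 2))))
      ≤ (p : ℝ) ^ (2 * s) * ((D * (4 ^ s * (X / p : ℝ) ^ e)) *
        ((X : ℝ) ^ k * (k.factorial * (p : ℝ) ^ (k * (k - 1) / 2)))) := by gcongr
    _ = k.factorial * 4 ^ s * D * ((p : ℝ) ^ (2 * s) *
        (X ^ k * (p : ℝ) ^ (k * (k - 1) / 2)) * (X / p : ℝ) ^ e) := by ring
    _ ≤ k.factorial * 4 ^ s * D * ((X : ℝ) ^ (k + e) *
        (16 ^ (k ^ 2) * (X : ℝ) ^ ((k : ℝ) - η / k))) := by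
        rw [h3]; gcongr
    _ = _ := by
        push_cast at h4
        rw [← h4]; ring

/-- The loss of one step of the recursion for Vinogradov's mean value. -/
noncomputable def stepConst (k s : ℕ) : ℝ :=
  (1 + (k + s).factorial * k ^ 3) *
    (k ^ (2 * (k + s)) + (k + s).factorial * k ^ 3 * (k.factorial * 4 ^ s * 16 ^ (k ^ 2)))

theorem vmv_step {k s X P : ℕ} {η D : ℝ} (Q : Finset ℕ) (hQc : #Q = k ^ 3)
    (hQ : ∀ p ∈ Q, p.Prime ∧ P < p ∧ p ≤ 8 * P) (hk : 2 ≤ k) (hs : s ≠ 0) (hX : 1 ≤ X)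
    (hkP : k ≤ P) (h8 : 8 * P ≤ X) (hXP : X ≤ P ^ k) (hPX : P ^ k ≤ 2 ^ k * X) (hD : 1 ≤ D)
    (hη0 : 0 ≤ η) (hη : η ≤ k * (k + 1) / 2) (he : 0 ≤ 2 * (s : ℝ) - k * (k + 1) / 2 + η)
    (he' : 2 * (k : ℝ) - 2 ≤ 2 * ((k + s : ℕ) : ℝ) - k * (k + 1) / 2 + η * (1 - 1 / k))
    (hv : ∀ Y : ℕ, 1 ≤ Y → (vmv s k Y : ℝ) ≤ D * (Y : ℝ) ^ (2 * (s : ℝ) - k * (k + 1) / 2 + η)) :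
    (vmv (k + s) k X : ℝ) ≤ stepConst k s * D *
      (X : ℝ) ^ (2 * ((k + s : ℕ) : ℝ) - k * (k + 1) / 2 + η * (1 - 1 / k)) := by
  have hX0 : (0 : ℝ) < X := by exact_mod_cast hX
  have hX1 : (1 : ℝ) ≤ X := by exact_mod_cast hX
  set e' := 2 * ((k + s : ℕ) : ℝ) - k * (k + 1) / 2 + η * (1 - 1 / k)
  have h1 := vmv_le_sum (k := k) (s := s) (X := X) (by omega) hs Q
    (fun p hp => ⟨(hQ p hp).1, hkP.trans_lt (hQ p hp).2.1,
      hXP.trans (Nat.pow_le_pow_left (hQ p hp).2.1.le k)⟩) hQc.ge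
  have h2 : ((∑ p ∈ Q, p ^ (2 * s) * (vmv s k (X / p + 1) *
        (X ^ k * (k.factorial * p ^ (k * (k - 1) / 2)))) : ℕ) : ℝ) ≤
      k ^ 3 * (k.factorial * 4 ^ s * 16 ^ (k ^ 2) * D * (X : ℝ) ^ e') := by
    rw [Nat.cast_sum]
    have := sum_le_card_nsmul Q _ _ fun p hp => vmv_summand_le (s := s) hk hX (hQ p hp).1.one_le
      ((hQ p hp).2.2.trans h8) (hQ p hp).2.2 hPX (zero_le_one.trans hD) hη0 hη he hv
    rw [nsmul_eq_mul, hQc, Nat.cast_pow] at this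
    exact this
  have h3 : (((X ^ (k - 1) * (k - 1) ^ (k + s)) ^ 2 : ℕ) : ℝ) ≤
      k ^ (2 * (k + s)) * D * (X : ℝ) ^ e' := by
    have h4 : ((X : ℝ) ^ (k - 1)) ^ 2 ≤ (X : ℝ) ^ e' := by
      rw [← pow_mul, ← Real.rpow_natCast]
      refine Real.rpow_le_rpow_of_exponent_le hX1 ?_
      push_cast [Nat.cast_sub (by omega : 1 ≤ k)]
      linarith
    have h5 : (((k - 1 : ℕ) : ℝ) ^ (k + s)) ^ 2 ≤ k ^ (2 * (k + s)) := by
      rw [← pow_mul, mul_comm 2]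
      gcongr
      omega
    push_cast
    rw [mul_pow]
    calc _ ≤ (X : ℝ) ^ e' * (k : ℝ) ^ (2 * (k + s)) := by gcongr
      _ = (k : ℝ) ^ (2 * (k + s)) * 1 * (X : ℝ) ^ e' := by ring
      _ ≤ _ := by gcongr
  have h6 : (vmv (k + s) k X : ℝ) ≤ (1 + (k + s).factorial * k ^ 3) *
      (k ^ (2 * (k + s)) * D * (X : ℝ) ^ e' + (k + s).factorial *
        (k ^ 3 * (k.factorial * 4 ^ s * 16 ^ (k ^ 2) * D * (X : ℝ) ^ e'))) := by
    have h7 := (Nat.cast_le (α := ℝ)).mpr h1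
    rw [hQc, Nat.cast_mul, Nat.cast_add (_ ^ 2), Nat.cast_mul ((k + s).factorial)] at h7
    refine h7.trans ?_
    have h8 : ((1 + (k + s).factorial * k ^ 3 : ℕ) : ℝ) = 1 + (k + s).factorial * k ^ 3 := by
      push_cast; ring
    rw [h8]
    gcongr
  refine h6.trans (le_of_eq ?_)
  unfold stepConst
  ring

theorem vmv_le_pow (s k X : ℕ) : vmv s k X ≤ X ^ (2 * s) := by
  unfold vmv energy
  refine (card_filter_le _ _).trans ?_
  rw [card_product]
  simp [two_mul, pow_add]

theorem stepConst_le {k s : ℕ} (hk : 2 ≤ k) (hs : s ≤ 10 * k ^ 2) :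
    stepConst k s ≤ 2 ^ (105 * k ^ 3) := by
  have hk2 : k ≤ 2 ^ k := Nat.lt_two_pow_self.le
  have h16 : 2 ^ 4 ≤ 2 ^ (2 * k) := Nat.pow_le_pow_right (by norm_num) (by omega)
  have hkk : k ≤ k ^ 2 := by nlinarith
  have hk3 : k ^ 2 * 2 ≤ k ^ 3 := by
    rw [pow_succ k 2]
    exact Nat.mul_le_mul_left _ hk
  have hks : k + s ≤ 11 * k ^ 2 := by omega
  have hb : k + s ≤ 2 ^ (4 * k) := by
    calc k + s ≤ 11 * k ^ 2 := hks
      _ ≤ 2 ^ (2 * k) * (2 ^ k) ^ 2 := Nat.mul_le_mul (by omega) (Nat.pow_le_pow_left hk2 2)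
      _ = 2 ^ (4 * k) := by rw [← pow_mul, ← pow_add]; congr 1; ring
  have hL : (k + s).factorial ≤ 2 ^ (44 * k ^ 3) := by
    calc (k + s).factorial ≤ (k + s) ^ (k + s) := Nat.factorial_le_pow _
      _ ≤ (2 ^ (4 * k)) ^ (k + s) := Nat.pow_le_pow_left hb _
      _ ≤ (2 ^ (4 * k)) ^ (11 * k ^ 2) := Nat.pow_le_pow_right (by positivity) hks
      _ = 2 ^ (44 * k ^ 3) := by rw [← pow_mul]; congr 1; ring
  have h3 : k ^ 3 ≤ 2 ^ (2 * k ^ 3) := by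
    calc k ^ 3 ≤ (2 ^ k) ^ 3 := Nat.pow_le_pow_left hk2 3
      _ = 2 ^ (k * 3) := by rw [← pow_mul]
      _ ≤ _ := Nat.pow_le_pow_right (by norm_num) (by omega)
  have hp : k ^ (2 * (k + s)) ≤ 2 ^ (22 * k ^ 3) := by
    calc k ^ (2 * (k + s)) ≤ (2 ^ k) ^ (2 * (k + s)) := Nat.pow_le_pow_left hk2 _
      _ ≤ (2 ^ k) ^ (22 * k ^ 2) := Nat.pow_le_pow_right (by positivity) (by omega)
      _ = _ := by rw [← pow_mul]; congr 1; ring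
  have hf : k.factorial ≤ 2 ^ (k ^ 2) := by
    calc k.factorial ≤ k ^ k := Nat.factorial_le_pow _
      _ ≤ (2 ^ k) ^ k := Nat.pow_le_pow_left hk2 _
      _ = _ := by rw [← pow_mul, sq]
  have h4 : 4 ^ s ≤ 2 ^ (20 * k ^ 2) := by
    rw [show 4 = 2 ^ 2 by norm_num, ← pow_mul]
    exact Nat.pow_le_pow_right (by norm_num) (by omega)
  have h5 : 16 ^ (k ^ 2) = 2 ^ (4 * k ^ 2) := by
    rw [show 16 = 2 ^ 4 by norm_num, ← pow_mul]
  have h6 : 1 + (k + s).factorial * k ^ 3 ≤ 2 ^ (46 * k ^ 3 + 1) := by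
    calc 1 + (k + s).factorial * k ^ 3 ≤ 1 + 2 ^ (44 * k ^ 3) * 2 ^ (2 * k ^ 3) := by gcongr
      _ = 1 + 2 ^ (46 * k ^ 3) := by rw [← pow_add]; congr 2; ring
      _ ≤ _ := by rw [pow_succ 2 (46 * k ^ 3)]; have := Nat.one_le_two_pow (n := 46 * k ^ 3); omega
  have h7 : k ^ (2 * (k + s)) + (k + s).factorial * k ^ 3 * (k.factorial * 4 ^ s * 16 ^ (k ^ 2)) ≤
      2 ^ (46 * k ^ 3 + 25 * k ^ 2 + 1) := by
    calc _ ≤ 2 ^ (22 * k ^ 3) + 2 ^ (44 * k ^ 3) * 2 ^ (2 * k ^ 3) *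
          (2 ^ (k ^ 2) * 2 ^ (20 * k ^ 2) * 2 ^ (4 * k ^ 2)) := by
          rw [h5]; gcongr
      _ = 2 ^ (22 * k ^ 3) + 2 ^ (46 * k ^ 3 + 25 * k ^ 2) := by
          simp_rw [← pow_add]; congr 2; ring
      _ ≤ _ := by
          rw [pow_succ 2 (46 * k ^ 3 + 25 * k ^ 2)]
          have : 2 ^ (22 * k ^ 3) ≤ 2 ^ (46 * k ^ 3 + 25 * k ^ 2) :=
            Nat.pow_le_pow_right (by norm_num) (by omega)
          omega
  have h8 : (1 + (k + s).factorial * k ^ 3) * (k ^ (2 * (k + s)) +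
      (k + s).factorial * k ^ 3 * (k.factorial * 4 ^ s * 16 ^ (k ^ 2))) ≤ 2 ^ (105 * k ^ 3) := by
    refine (Nat.mul_le_mul h6 h7).trans ?_
    rw [← pow_add]
    refine Nat.pow_le_pow_right (by norm_num) ?_
    have : 2 ≤ k ^ 2 * 2 := by nlinarith
    omega
  unfold stepConst
  exact_mod_cast h8

theorem exists_root_approx {k X : ℕ} (hk : k ≠ 0) :
    ∃ P : ℕ, X ≤ P ^ k ∧ ∀ P', P' < P → P' ^ k < X := by
  have hex : ∃ P : ℕ, X ≤ P ^ k := ⟨X, Nat.le_self_pow hk X⟩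
  classical
  exact ⟨Nat.find hex, Nat.find_spec hex, fun P' h => not_le.mp (Nat.find_min hex h)⟩

/-- Vinogradov's mean value theorem, in the form needed for exponential sums. -/
theorem exists_vmv_le : ∃ C : ℝ, 1 ≤ C ∧ ∀ k r X : ℕ, 2 ≤ k → r ≤ 10 * k → 1 ≤ X →
    (vmv (k * (r + 1)) k X : ℝ) ≤ C ^ (k ^ 4) *
      (X : ℝ) ^ (2 * ((k * (r + 1) : ℕ) : ℝ) - k * (k + 1) / 2 +
        k * (k + 1) / 2 * (1 - 1 / k) ^ r) := by
  obtain ⟨c₁, hc₁, hprimes⟩ := exists_primes_between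
  have hc₁' : (16 : ℝ) ≤ c₁ := by exact_mod_cast hc₁
  refine ⟨2 ^ 1054 * c₁, ?_, ?_⟩
  · have : (1 : ℝ) ≤ 2 ^ 1054 := one_le_pow₀ (by norm_num)
    exact one_le_mul_of_one_le_of_one_le this (by linarith)
  intro k r X hk hr hX
  have hkk : (2 : ℝ) ≤ k := by exact_mod_cast hk
  set Z : ℝ := ((c₁ * k ^ 4 : ℕ) : ℝ) ^ (k ^ 3) with hZ
  have hZ1 : 1 ≤ Z := by
    refine one_le_pow₀ ?_
    have : 1 ≤ c₁ * k ^ 4 := by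
      have : 1 ≤ k ^ 4 := Nat.one_le_pow _ _ (by omega)
      nlinarith
    exact_mod_cast this
  set ρ : ℝ := 1 - 1 / k with hρ
  have hρ0 : 0 ≤ ρ := by
    rw [hρ, sub_nonneg, div_le_one (by linarith)]
    linarith
  have hρ1 : ρ ≤ 1 := by
    rw [hρ]
    have : (0 : ℝ) ≤ 1 / k := by positivity
    linarith
  have hexp : ∀ r : ℕ, (2 * (k : ℝ) ≤ 2 * ((k * (r + 1) : ℕ) : ℝ) - k * (k + 1) / 2 +
        k * (k + 1) / 2 * ρ ^ r) := by
    intro r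
    have h1 : 1 - (r : ℝ) / k ≤ ρ ^ r := by
      have := one_add_mul_le_pow (a := -(1 / (k : ℝ))) (by
        have : 1 / (k : ℝ) ≤ 1 := by rw [div_le_one (by linarith)]; linarith
        linarith) r
      calc 1 - (r : ℝ) / k = 1 + r * -(1 / (k : ℝ)) := by ring
        _ ≤ _ := this
        _ = ρ ^ r := by rw [hρ]; ring
    have h2 : (k : ℝ) * (k + 1) / 2 * (1 - (r : ℝ) / k) ≤ k * (k + 1) / 2 * ρ ^ r := by gcongr
    have h3 : (k : ℝ) * (k + 1) / 2 * (1 - (r : ℝ) / k) = k * (k + 1) / 2 - (k + 1) / 2 * r := by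
      field_simp
    push_cast
    have hr0 : (0 : ℝ) ≤ r := by positivity
    nlinarith
  have htriv : ∀ r X : ℕ, 1 ≤ X → X ≤ (c₁ * k ^ 4) ^ k →
      (vmv (k * (r + 1)) k X : ℝ) ≤ Z * (X : ℝ) ^ (2 * ((k * (r + 1) : ℕ) : ℝ) -
        k * (k + 1) / 2 + k * (k + 1) / 2 * ρ ^ r) := by
    intro r X hX hXZ
    have hX0 : (0 : ℝ) < X := by exact_mod_cast hX
    have hX1 : (1 : ℝ) ≤ X := by exact_mod_cast hX
    have h1 : (vmv (k * (r + 1)) k X : ℝ) ≤ (X : ℝ) ^ (2 * ((k * (r + 1) : ℕ) : ℝ)) := by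
      have h2 : (2 * ((k * (r + 1) : ℕ) : ℝ)) = ((2 * (k * (r + 1)) : ℕ) : ℝ) := by push_cast; ring
      rw [h2, Real.rpow_natCast]
      exact_mod_cast vmv_le_pow _ _ _
    refine h1.trans ?_
    have h2 : (X : ℝ) ^ (k ^ 2) ≤ Z := by
      have h3 : (X : ℝ) ≤ ((c₁ * k ^ 4 : ℕ) : ℝ) ^ k := by exact_mod_cast hXZ
      calc (X : ℝ) ^ (k ^ 2) ≤ (((c₁ * k ^ 4 : ℕ) : ℝ) ^ k) ^ (k ^ 2) := by gcongr
        _ = Z := by rw [hZ, ← pow_mul]; congr 1; ring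
    refine le_trans ?_ (mul_le_mul_of_nonneg_right h2 (by positivity))
    rw [← Real.rpow_natCast, ← Real.rpow_add hX0]
    refine Real.rpow_le_rpow_of_exponent_le hX1 ?_
    have : (0 : ℝ) ≤ k * (k + 1) / 2 * ρ ^ r := by positivity
    push_cast
    nlinarith
  have main : ∀ r ≤ 10 * k, ∀ X : ℕ, 1 ≤ X →
      (vmv (k * (r + 1)) k X : ℝ) ≤ ((2 : ℝ) ^ (105 * k ^ 3)) ^ r * Z *
        (X : ℝ) ^ (2 * ((k * (r + 1) : ℕ) : ℝ) - k * (k + 1) / 2 +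
          k * (k + 1) / 2 * ρ ^ r) := by
    intro r
    induction r with
    | zero =>
      intro _ X hX
      have h1 : (vmv (k * (0 + 1)) k X : ℝ) ≤ (X : ℝ) ^ (2 * k) := by
        have := vmv_le_pow k k X
        simp only [zero_add, mul_one]
        exact_mod_cast this
      refine h1.trans ?_
      have h2 : 2 * ((k * (0 + 1) : ℕ) : ℝ) - k * (k + 1) / 2 + k * (k + 1) / 2 * ρ ^ 0 =
          ((2 * k : ℕ) : ℝ) := by push_cast; ring
      rw [h2, Real.rpow_natCast, pow_zero, one_mul]
      exact le_mul_of_one_le_left (by positivity) hZ1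
    | succ r ih =>
      intro hr X hX
      have hM : (1 : ℝ) ≤ 2 ^ (105 * k ^ 3) := one_le_pow₀ (by norm_num)
      obtain ⟨P, hXP, hP⟩ := exists_root_approx (k := k) (X := X) (by omega)
      rcases lt_or_ge P (c₁ * k ^ 4) with hlt | hge
      · refine (htriv (r + 1) X hX (hXP.trans (Nat.pow_le_pow_left hlt.le k))).trans ?_
        refine mul_le_mul_of_nonneg_right ?_ (by positivity)
        exact le_mul_of_one_le_left (zero_le_one.trans hZ1) (one_le_pow₀ hM)
      · obtain ⟨Q, hQc, hQ⟩ := hprimes k P (by omega) hge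
        have hk4 : k ≤ k ^ 4 := Nat.le_self_pow (by norm_num) k
        have hP16 : 16 * k ≤ P := (Nat.mul_le_mul hc₁ hk4).trans hge
        obtain ⟨m, rfl⟩ : ∃ m, P = m + 1 := ⟨P - 1, by omega⟩
        have hmX := hP m (by omega)
        have hm2 : m ^ 2 ≤ m ^ k := Nat.pow_le_pow_right (by omega) hk
        have h8 : 8 * (m + 1) ≤ X := by nlinarith
        have hPX : (m + 1) ^ k ≤ 2 ^ k * X := by
          calc (m + 1) ^ k ≤ (2 * m) ^ k := Nat.pow_le_pow_left (by omega) k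
            _ = 2 ^ k * m ^ k := mul_pow _ _ _
            _ ≤ _ := Nat.mul_le_mul_left _ hmX.le
        have hs : k * (r + 1) ≤ 10 * k ^ 2 := by nlinarith
        have hρr : ρ ^ r ≤ 1 := pow_le_one₀ hρ0 hρ1
        have hηE : k * (k + 1) / 2 * ρ ^ r ≤ (k : ℝ) * (k + 1) / 2 :=
          mul_le_of_le_one_right (by positivity) hρr
        have hsucc : k + k * (r + 1) = k * (r + 1 + 1) := by ring
        have hηs : (k : ℝ) * (k + 1) / 2 * ρ ^ r * (1 - 1 / k) = k * (k + 1) / 2 * ρ ^ (r + 1) := by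
          rw [← hρ]; ring
        have hst := vmv_step (s := k * (r + 1)) (η := k * (k + 1) / 2 * ρ ^ r)
          (D := ((2 : ℝ) ^ (105 * k ^ 3)) ^ r * Z) Q hQc hQ hk
          (by positivity) hX (by omega) h8 hXP hPX
          (one_le_mul_of_one_le_of_one_le (one_le_pow₀ hM) hZ1) (by positivity) hηE
          (by have := hexp r; linarith)
          (by rw [hηs, hsucc]; have := hexp (r + 1); linarith)
          (ih (by omega))
        rw [hηs, hsucc] at hst
        refine hst.trans ?_
        refine mul_le_mul_of_nonneg_right ?_ (by positivity)
        rw [pow_succ' _ r, mul_assoc (2 ^ (105 * k ^ 3))]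
        exact mul_le_mul_of_nonneg_right (stepConst_le hk hs) (by positivity)
  refine (main r hr X hX).trans (mul_le_mul_of_nonneg_right ?_ (by positivity))
  have h1 : ((2 : ℝ) ^ (105 * k ^ 3)) ^ r ≤ (2 ^ 1050) ^ (k ^ 4) := by
    rw [← pow_mul, ← pow_mul]
    refine pow_le_pow_right₀ (by norm_num) ?_
    calc 105 * k ^ 3 * r ≤ 105 * k ^ 3 * (10 * k) := Nat.mul_le_mul_left _ hr
      _ = _ := by ring
  have h2 : Z ≤ (2 ^ 4 * (c₁ : ℝ)) ^ (k ^ 4) := by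
    have hk34 : k ^ 3 ≤ k ^ 4 := Nat.pow_le_pow_right (by omega) (by norm_num)
    have h3 : (k : ℝ) ≤ 2 ^ k := by exact_mod_cast Nat.lt_two_pow_self.le
    rw [hZ]
    push_cast
    rw [mul_pow, mul_pow]
    calc (c₁ : ℝ) ^ (k ^ 3) * ((k : ℝ) ^ 4) ^ (k ^ 3)
        ≤ (c₁ : ℝ) ^ (k ^ 4) * (((2 : ℝ) ^ k) ^ 4) ^ (k ^ 3) := by
          gcongr
          linarith
      _ = (2 ^ 4) ^ (k ^ 4) * (c₁ : ℝ) ^ (k ^ 4) := by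
          rw [mul_comm]
          congr 1
          simp_rw [← pow_mul]
          congr 1
          ring
  calc _ ≤ ((2 : ℝ) ^ 1050) ^ (k ^ 4) * (2 ^ 4 * (c₁ : ℝ)) ^ (k ^ 4) := by gcongr
    _ = (2 ^ 1054 * (c₁ : ℝ)) ^ (k ^ 4) := by
      rw [← mul_pow, ← mul_assoc, ← pow_add]

/-! ### Bilinear exponential sums -/

/-- The additive character `x ↦ exp (2 π i x)`. -/
noncomputable def e (x : ℝ) : ℂ := Complex.exp (2 * Real.pi * x * Complex.I)

theorem e_add (x y : ℝ) : e (x + y) = e x * e y := by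
  rw [e, e, e, ← Complex.exp_add]
  push_cast
  ring_nf

@[simp] theorem e_zero : e 0 = 1 := by simp [e]

@[simp] theorem norm_e (x : ℝ) : ‖e x‖ = 1 := by
  rw [e, show (2 * Real.pi * x * Complex.I : ℂ) = ((2 * Real.pi * x : ℝ) : ℂ) * Complex.I by
    push_cast; ring]
  exact Complex.norm_exp_ofReal_mul_I _

theorem e_neg (x : ℝ) : e (-x) = (e x)⁻¹ := by
  exact eq_inv_of_mul_eq_one_left (by rw [← e_add, neg_add_cancel, e_zero])

theorem conj_e (x : ℝ) : (starRingEnd ℂ) (e x) = e (-x) := by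
  rw [e_neg, Complex.inv_eq_conj (norm_e x)]

theorem e_sum {ι : Type*} (s : Finset ι) (f : ι → ℝ) : e (∑ i ∈ s, f i) = ∏ i ∈ s, e (f i) := by
  classical
  induction s using Finset.induction_on with
  | empty => simp
  | insert a s ha ih => rw [sum_insert ha, prod_insert ha, e_add, ih]

theorem e_natCast_mul (n : ℕ) (x : ℝ) : e (n * x) = e x ^ n := by
  rw [e, e, ← Complex.exp_nat_mul]
  push_cast
  ring_nf

theorem norm_e_sub_one_le (x : ℝ) : ‖e x - 1‖ ≤ 2 * Real.pi * |x| := by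
  have h := Real.norm_exp_I_mul_ofReal_sub_one_le (x := 2 * Real.pi * x)
  have : (Complex.I * ((2 * Real.pi * x : ℝ) : ℂ)) = 2 * Real.pi * x * Complex.I := by
    push_cast; ring
  rw [this] at h
  rw [e]
  refine h.trans_eq ?_
  rw [Real.norm_eq_abs, abs_mul, abs_of_pos (by positivity)]

theorem norm_e_sub_e_le (x y : ℝ) : ‖e x - e y‖ ≤ 2 * Real.pi * |x - y| := by
  have : e x - e y = e y * (e (x - y) - 1) := by
    rw [mul_sub, ← e_add, mul_one]; congr 2; ring
  rw [this, norm_mul, norm_e, one_mul]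
  exact norm_e_sub_one_le _

/-- The vector of power sums of a tuple. -/
def psumVec (s k : ℕ) (u : Fin s → ℤ) : Fin k → ℤ := ∑ i, mom k (u i)

theorem norm_pow_two_mul_sum_e {s k U : ℕ} (c : Fin k → ℝ) :
    ((‖∑ x ∈ Icc (1 : ℤ) U, e (∑ j, c j * (mom k x j : ℤ))‖ ^ (2 * s) : ℝ) : ℂ) =
      ∑ q ∈ (Fintype.piFinset fun _ : Fin s => Icc (1 : ℤ) U) ×ˢ
          (Fintype.piFinset fun _ : Fin s => Icc (1 : ℤ) U),
        e (∑ j, c j * ((psumVec s k q.1 - psumVec s k q.2) j : ℤ)) := by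
  have hpow : ∀ d : Fin k → ℝ, (∑ x ∈ Icc (1 : ℤ) U, e (∑ j, d j * (mom k x j : ℤ))) ^ s =
      ∑ v ∈ Fintype.piFinset fun _ : Fin s => Icc (1 : ℤ) U,
        e (∑ j, d j * (psumVec s k v j : ℤ)) := by
    intro d
    have h := prod_const (s := (univ : Finset (Fin s)))
      (∑ x ∈ Icc (1 : ℤ) U, e (∑ j, d j * (mom k x j : ℤ)))
    rw [card_univ, Fintype.card_fin] at h
    rw [← h, prod_univ_sum]
    refine sum_congr rfl fun v _ => ?_
    rw [← e_sum, sum_comm]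
    congr 1
    refine sum_congr rfl fun j _ => ?_
    rw [← mul_sum]
    simp [psumVec]
  have hconj : (starRingEnd ℂ) (∑ x ∈ Icc (1 : ℤ) U, e (∑ j, c j * (mom k x j : ℤ))) =
      ∑ x ∈ Icc (1 : ℤ) U, e (∑ j, (-c j) * (mom k x j : ℤ)) := by
    rw [map_sum]
    refine sum_congr rfl fun x _ => ?_
    rw [conj_e, ← sum_neg_distrib]
    simp
  rw [pow_mul]
  push_cast
  rw [← Complex.mul_conj', mul_pow, hconj, hpow, hpow, sum_mul_sum, sum_product]
  refine sum_congr rfl fun v _ => sum_congr rfl fun w _ => ?_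
  rw [← e_add, ← sum_add_distrib]
  congr 1
  refine sum_congr rfl fun j _ => ?_
  simp only [Pi.sub_apply]
  push_cast
  ring

/-- The box containing all differences of power sum vectors. -/
noncomputable def psumBox (s k U : ℕ) : Finset (Fin k → ℤ) :=
  Fintype.piFinset fun j : Fin k => Icc (-((s : ℤ) * (U : ℤ) ^ ((j : ℕ) + 1)))
    ((s : ℤ) * (U : ℤ) ^ ((j : ℕ) + 1))

/-- The tuples counted by `vmv`. -/
noncomputable def tuples (s U : ℕ) : Finset (Fin s → ℤ) :=
  Fintype.piFinset fun _ => Icc (1 : ℤ) U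

theorem card_tuples (s U : ℕ) : #(tuples s U) = U ^ s := by
  simp [tuples]

theorem psumVec_mem {s k U : ℕ} {v : Fin s → ℤ} (hv : v ∈ tuples s U) (j : Fin k) :
    0 ≤ psumVec s k v j ∧ psumVec s k v j ≤ (s : ℤ) * (U : ℤ) ^ ((j : ℕ) + 1) := by
  simp only [tuples, Fintype.mem_piFinset, mem_Icc] at hv
  simp only [psumVec, Finset.sum_apply, mom]
  refine ⟨sum_nonneg fun i _ => pow_nonneg (by linarith [(hv i).1]) _, ?_⟩
  calc _ ≤ ∑ _i : Fin s, (U : ℤ) ^ ((j : ℕ) + 1) :=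
        sum_le_sum fun i _ => pow_le_pow_left₀ (by linarith [(hv i).1]) (hv i).2 _
    _ = _ := by simp

theorem psumVec_sub_mem_psumBox {s k U : ℕ} {q : (Fin s → ℤ) × (Fin s → ℤ)}
    (hq : q ∈ tuples s U ×ˢ tuples s U) :
    psumVec s k q.1 - psumVec s k q.2 ∈ psumBox s k U := by
  rw [mem_product] at hq
  simp only [psumBox, Fintype.mem_piFinset, mem_Icc, Pi.sub_apply]
  intro j
  have h1 := psumVec_mem hq.1 j
  have h2 := psumVec_mem hq.2 j
  constructor <;> linarith

theorem sum_psumVec_sub_le {s k U : ℕ} (g : (Fin k → ℤ) → ℝ) (hg : ∀ l, 0 ≤ g l) :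
    ∑ q ∈ tuples s U ×ˢ tuples s U, g (psumVec s k q.1 - psumVec s k q.2) ≤
      vmv s k U * ∑ l ∈ psumBox s k U, g l := by
  rw [← sum_fiberwise_of_maps_to (t := psumBox s k U)
    (g := fun q : (Fin s → ℤ) × (Fin s → ℤ) => psumVec s k q.1 - psumVec s k q.2)
    (fun q hq => psumVec_sub_mem_psumBox hq), mul_sum]
  refine sum_le_sum fun l _ => ?_
  have h1 : ∑ q ∈ tuples s U ×ˢ tuples s U with psumVec s k q.1 - psumVec s k q.2 = l,
      g (psumVec s k q.1 - psumVec s k q.2) =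
      ∑ q ∈ tuples s U ×ˢ tuples s U with psumVec s k q.1 - psumVec s k q.2 = l, g l :=
    sum_congr rfl fun q hq => by rw [(mem_filter.mp hq).2]
  rw [h1, sum_const, nsmul_eq_mul]
  refine mul_le_mul_of_nonneg_right ?_ (hg l)
  have h2 := card_filter_sub_le_energy (fun u : Fin s → ℤ => ∑ i, mom k (u i)) (tuples s U) l
  refine Nat.cast_le.mpr (le_trans (card_le_card ?_) h2)
  intro q hq
  rw [mem_filter] at hq ⊢
  refine ⟨hq.1, ?_⟩
  have := hq.2
  simp only [psumVec] at this
  rw [← this]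
  abel

/-- The bilinear sum attached to one coefficient. -/
noncomputable def wsum (L : ℕ) (α : ℝ) : ℝ :=
  ∑ μ ∈ Icc (-(L : ℤ)) L, ‖∑ l ∈ Icc (-(L : ℤ)) L, e (α * l * μ)‖

theorem wsum_nonneg (L : ℕ) (α : ℝ) : 0 ≤ wsum L α := sum_nonneg fun _ _ => norm_nonneg _

theorem sum_psumBox_norm_pow_le (s k U : ℕ) (α : Fin k → ℝ) :
    ∑ l ∈ psumBox s k U,
        ‖∑ x ∈ Icc (1 : ℤ) U, e (∑ j, α j * (l j : ℤ) * (mom k x j : ℤ))‖ ^ (2 * s) ≤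
      vmv s k U * ∏ j : Fin k, wsum (s * U ^ ((j : ℕ) + 1)) (α j) := by
  have hprod : ∏ j : Fin k, wsum (s * U ^ ((j : ℕ) + 1)) (α j) = ∑ μ ∈ psumBox s k U,
      ∏ j : Fin k, ‖∑ l ∈ Icc (-((s : ℤ) * (U : ℤ) ^ ((j : ℕ) + 1)))
        ((s : ℤ) * (U : ℤ) ^ ((j : ℕ) + 1)), e (α j * l * μ j)‖ := by
    simp only [wsum, psumBox]
    rw [prod_univ_sum]
    push_cast
    rfl
  rw [hprod]
  refine le_trans ?_ (sum_psumVec_sub_le _ fun μ => prod_nonneg fun j _ => norm_nonneg _)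
  have h1 : ((∑ l ∈ psumBox s k U,
        ‖∑ x ∈ Icc (1 : ℤ) U, e (∑ j, α j * (l j : ℤ) * (mom k x j : ℤ))‖ ^ (2 * s) : ℝ) : ℂ) =
      ∑ q ∈ tuples s U ×ˢ tuples s U, ∏ j : Fin k,
        ∑ l ∈ Icc (-((s : ℤ) * (U : ℤ) ^ ((j : ℕ) + 1))) ((s : ℤ) * (U : ℤ) ^ ((j : ℕ) + 1)),
          e (α j * l * ((psumVec s k q.1 - psumVec s k q.2) j : ℤ)) := by
    rw [Complex.ofReal_sum]
    simp_rw [norm_pow_two_mul_sum_e, prod_univ_sum, ← e_sum]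
    rw [sum_comm]
    rfl
  rw [← Complex.norm_of_nonneg (sum_nonneg fun l _ => pow_nonneg (norm_nonneg _) _), h1]
  refine (norm_sum_le _ _).trans_eq (sum_congr rfl fun q _ => ?_)
  rw [norm_prod]

theorem bilinear_bound (s k U : ℕ) (hs : 1 ≤ s) (α : Fin k → ℝ) :
    ‖∑ u ∈ Icc (1 : ℤ) U, ∑ v ∈ Icc (1 : ℤ) U, e (∑ j, α j * (u * v : ℤ) ^ ((j : ℕ) + 1))‖ ^
        (2 * s * (2 * s)) ≤
      (U : ℝ) ^ (4 * s * (2 * s - 1)) * (vmv s k U : ℝ) ^ 2 *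
        ∏ j : Fin k, wsum (s * U ^ ((j : ℕ) + 1)) (α j) := by
  have hS : ∀ u : ℤ, ∑ v ∈ Icc (1 : ℤ) U, e (∑ j, α j * (u * v : ℤ) ^ ((j : ℕ) + 1)) =
      ∑ v ∈ Icc (1 : ℤ) U, e (∑ j, (α j * (mom k u j : ℤ)) * (mom k v j : ℤ)) := by
    intro u
    refine sum_congr rfl fun v _ => ?_
    congr 1
    refine sum_congr rfl fun j _ => ?_
    simp only [mom]
    push_cast
    ring
  simp_rw [hS]
  obtain ⟨m, hm⟩ : ∃ m, 2 * s = m + 1 := ⟨2 * s - 1, by omega⟩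
  set S : ℤ → ℂ := fun u => ∑ v ∈ Icc (1 : ℤ) U,
    e (∑ j, (α j * (mom k u j : ℤ)) * (mom k v j : ℤ)) with hSdef
  set a : (Fin k → ℤ) → ℝ := fun l =>
    ‖∑ x ∈ Icc (1 : ℤ) U, e (∑ j, α j * (l j : ℤ) * (mom k x j : ℤ))‖ with ha
  have hstep1 : ‖∑ u ∈ Icc (1 : ℤ) U, S u‖ ^ (2 * s) ≤
      (U : ℝ) ^ m * ∑ u ∈ Icc (1 : ℤ) U, ‖S u‖ ^ (2 * s) := by
    have h := pow_sum_le_card_mul_sum_pow (s := Icc (1 : ℤ) U) (f := fun u => ‖S u‖)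
      (fun _ _ => norm_nonneg _) m
    rw [Int.card_Icc, ← hm] at h
    refine (pow_le_pow_left₀ (norm_nonneg _) (norm_sum_le _ _) _).trans ?_
    simpa using h
  have hstep2 : ∑ u ∈ Icc (1 : ℤ) U, ‖S u‖ ^ (2 * s) ≤
      ∑ q ∈ tuples s U ×ˢ tuples s U, a (psumVec s k q.1 - psumVec s k q.2) := by
    have h1 : ((∑ u ∈ Icc (1 : ℤ) U, ‖S u‖ ^ (2 * s) : ℝ) : ℂ) =
        ∑ q ∈ tuples s U ×ˢ tuples s U, ∑ x ∈ Icc (1 : ℤ) U,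
          e (∑ j, α j * ((psumVec s k q.1 - psumVec s k q.2) j : ℤ) * (mom k x j : ℤ)) := by
      rw [Complex.ofReal_sum]
      simp_rw [hSdef, norm_pow_two_mul_sum_e]
      rw [sum_comm]
      refine sum_congr rfl fun q _ => sum_congr rfl fun x _ => ?_
      congr 1
      exact sum_congr rfl fun j _ => by ring
    rw [← Complex.norm_of_nonneg (sum_nonneg fun l _ => pow_nonneg (norm_nonneg _) _), h1]
    exact norm_sum_le _ _
  have hstep3 : (∑ q ∈ tuples s U ×ˢ tuples s U, a (psumVec s k q.1 - psumVec s k q.2)) ^ (2 * s) ≤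
      ((U : ℝ) ^ (2 * s)) ^ m * ((vmv s k U : ℝ) * (vmv s k U *
        ∏ j : Fin k, wsum (s * U ^ ((j : ℕ) + 1)) (α j))) := by
    have h := pow_sum_le_card_mul_sum_pow (s := tuples s U ×ˢ tuples s U)
      (f := fun q => a (psumVec s k q.1 - psumVec s k q.2))
      (fun _ _ => norm_nonneg _) m
    rw [card_product, card_tuples, ← hm] at h
    refine h.trans ?_
    have h2 : (((U ^ s * U ^ s : ℕ) : ℝ)) = (U : ℝ) ^ (2 * s) := by push_cast; ring
    rw [h2]
    refine mul_le_mul_of_nonneg_left ?_ (by positivity)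
    refine (sum_psumVec_sub_le (fun l => a l ^ (2 * s))
      fun l => pow_nonneg (norm_nonneg _) _).trans ?_
    exact mul_le_mul_of_nonneg_left (sum_psumBox_norm_pow_le s k U α) (by positivity)
  rw [pow_mul]
  have hs2 : 2 * s - 1 = m := by omega
  calc _ ≤ ((U : ℝ) ^ m * ∑ q ∈ tuples s U ×ˢ tuples s U,
          a (psumVec s k q.1 - psumVec s k q.2)) ^ (2 * s) := by
        refine pow_le_pow_left₀ (by positivity) (hstep1.trans ?_) _
        exact mul_le_mul_of_nonneg_left hstep2 (by positivity)
    _ ≤ ((U : ℝ) ^ m) ^ (2 * s) * (((U : ℝ) ^ (2 * s)) ^ m * ((vmv s k U : ℝ) * (vmv s k U *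
        ∏ j : Fin k, wsum (s * U ^ ((j : ℕ) + 1)) (α j)))) := by
        rw [mul_pow]
        exact mul_le_mul_of_nonneg_left hstep3 (by positivity)
    _ = _ := by
        rw [hs2, show 4 * s * m = m * (2 * s) + 2 * s * m by ring, pow_add, pow_mul, pow_mul]
        ring

theorem norm_e_sub_one (x : ℝ) : ‖e x - 1‖ = 2 * |Real.sin (Real.pi * x)| := by
  have h := Complex.norm_exp_I_mul_ofReal_sub_one (x := 2 * Real.pi * x)
  have : (Complex.I * ((2 * Real.pi * x : ℝ) : ℂ)) = 2 * Real.pi * x * Complex.I := by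
    push_cast; ring
  rw [this] at h
  rw [e, h, Real.norm_eq_abs, abs_mul, show 2 * Real.pi * x / 2 = Real.pi * x by ring]
  norm_num

theorem four_mul_abs_le_norm_e_sub_one {x : ℝ} (hx : |x| ≤ 1 / 2) : 4 * |x| ≤ ‖e x - 1‖ := by
  rw [norm_e_sub_one]
  have hpi := Real.pi_pos
  have h := Real.mul_abs_le_abs_sin (x := Real.pi * x) (by
    rw [abs_mul, abs_of_pos hpi]; nlinarith)
  rw [abs_mul, abs_of_pos hpi] at h
  have : 2 / Real.pi * (Real.pi * |x|) = 2 * |x| := by field_simp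
  linarith

theorem sum_int_Icc_eq (f : ℤ → ℂ) (a b : ℤ) :
    ∑ l ∈ Icc a b, f l = ∑ i ∈ range (b + 1 - a).toNat, f (a + i) := by
  rw [Int.Icc_eq_finset_map, sum_map]
  simp

theorem norm_sum_e_mul_le {x : ℝ} (hx : |x| ≤ 1 / 2) (hx0 : x ≠ 0) (a b : ℤ) :
    ‖∑ l ∈ Icc a b, e (x * l)‖ ≤ 1 / (2 * |x|) := by
  have hpos : 0 < |x| := abs_pos.mpr hx0
  have h4 := four_mul_abs_le_norm_e_sub_one hx
  have hne : e x ≠ 1 := by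
    intro h
    rw [h, sub_self, norm_zero] at h4
    linarith
  have h1 : ∑ l ∈ Icc a b, e (x * l) = e (x * a) * ∑ i ∈ range (b + 1 - a).toNat, e x ^ i := by
    rw [sum_int_Icc_eq, mul_sum]
    refine sum_congr rfl fun i _ => ?_
    rw [← e_natCast_mul, ← e_add]
    congr 1
    push_cast
    ring
  rw [h1, norm_mul, norm_e, one_mul, geom_sum_eq hne, norm_div, div_le_div_iff₀ (by linarith) (by positivity)]
  have : ‖e x ^ (b + 1 - a).toNat - 1‖ ≤ 2 := by
    refine (norm_sub_le _ _).trans ?_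
    rw [norm_pow, norm_e, one_pow, norm_one]
    norm_num
  nlinarith

theorem wsum_le_sq (L : ℕ) (α : ℝ) : wsum L α ≤ (2 * L + 1) ^ 2 := by
  have hcard : (#(Icc (-(L : ℤ)) L) : ℝ) = 2 * L + 1 := by
    rw [Int.card_Icc]
    have : ((L : ℤ) + 1 - -L).toNat = 2 * L + 1 := by omega
    rw [this]
    push_cast
    ring
  unfold wsum
  calc _ ≤ ∑ _μ ∈ Icc (-(L : ℤ)) L, (2 * (L : ℝ) + 1) := by
        refine sum_le_sum fun μ _ => (norm_sum_le _ _).trans_eq ?_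
        simp only [norm_e, sum_const, nsmul_eq_mul, mul_one, hcard]
    _ = _ := by rw [sum_const, nsmul_eq_mul, hcard]; ring

theorem wsum_le {L : ℕ} {α : ℝ} (hα : α ≠ 0) (hL : L * |α| ≤ 1 / 2) :
    wsum L α ≤ (2 * L + 1) + (1 + Real.log L) / |α| := by
  have hpos : 0 < |α| := abs_pos.mpr hα
  set F : ℤ → ℝ := fun μ => ‖∑ l ∈ Icc (-(L : ℤ)) L, e (α * l * μ)‖ with hF
  have hsplit : wsum L α ≤ F 0 + ∑ i ∈ range L, (F ((i : ℤ) + 1) + F (-((i : ℤ) + 1))) := by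
    have hsub : Icc (-(L : ℤ)) L ⊆ {0} ∪ ((range L).image (fun i : ℕ => (i : ℤ) + 1) ∪
        (range L).image (fun i : ℕ => -((i : ℤ) + 1))) := by
      intro μ hμ
      rw [mem_Icc] at hμ
      simp only [mem_union, mem_singleton, mem_image, mem_range]
      rcases lt_trichotomy μ 0 with h | h | h
      · exact Or.inr (Or.inr ⟨(-μ - 1).toNat, by omega, by omega⟩)
      · exact Or.inl h
      · exact Or.inr (Or.inl ⟨(μ - 1).toNat, by omega, by omega⟩)
    have hF0 : ∀ μ, 0 ≤ F μ := fun _ => norm_nonneg _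
    have hun : ∀ A B : Finset ℤ, ∑ μ ∈ A ∪ B, F μ ≤ ∑ μ ∈ A, F μ + ∑ μ ∈ B, F μ := by
      intro A B
      rw [← sum_union_inter]
      exact le_add_of_nonneg_right (sum_nonneg fun _ _ => hF0 _)
    calc wsum L α ≤ _ := sum_le_sum_of_subset_of_nonneg hsub fun _ _ _ => hF0 _
      _ ≤ _ := (hun _ _).trans (add_le_add_right (hun _ _) _)
      _ = _ := by
        rw [sum_singleton, sum_image (fun a _ b _ h => by simpa using h),
          sum_image (fun a _ b _ h => by simpa using h), sum_add_distrib]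
  have hF0 : F 0 ≤ 2 * L + 1 := by
    simp only [hF, Int.cast_zero, mul_zero, e_zero, sum_const, Int.card_Icc]
    have : ((L : ℤ) + 1 - -L).toNat = 2 * L + 1 := by omega
    rw [this]
    simpa using (Complex.norm_natCast (2 * L + 1)).le
  have hFμ : ∀ μ : ℤ, μ ≠ 0 → |μ| ≤ L → F μ ≤ 1 / (2 * |α| * |(μ : ℝ)|) := by
    intro μ hμ hμL
    have h1 : |α * μ| ≤ 1 / 2 := by
      rw [abs_mul]
      have : |(μ : ℝ)| ≤ L := by exact_mod_cast hμL
      nlinarith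
    have h2 := norm_sum_e_mul_le h1 (mul_ne_zero hα (by exact_mod_cast hμ)) (-(L : ℤ)) L
    rw [abs_mul, ← mul_assoc] at h2
    refine le_trans (le_of_eq ?_) h2
    simp only [hF]
    congr 1
    exact sum_congr rfl fun l _ => by congr 1; ring
  have hsum : ∑ i ∈ range L, (F ((i : ℤ) + 1) + F (-((i : ℤ) + 1))) ≤
      (1 / |α|) * ∑ i ∈ range L, ((i : ℝ) + 1)⁻¹ := by
    rw [mul_sum]
    refine sum_le_sum fun i hi => ?_
    rw [mem_range] at hi
    have h1 := hFμ ((i : ℤ) + 1) (by omega) (by rw [abs_le]; omega)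
    have h2 := hFμ (-((i : ℤ) + 1)) (by omega) (by rw [abs_le]; omega)
    have h3 : (0 : ℝ) < (i : ℝ) + 1 := by positivity
    push_cast at h1 h2
    rw [abs_neg] at h2
    rw [abs_of_pos h3] at h1 h2
    calc _ ≤ 1 / (2 * |α| * ((i : ℝ) + 1)) + 1 / (2 * |α| * ((i : ℝ) + 1)) := add_le_add h1 h2
      _ = _ := by field_simp; norm_num
  have hharm : ∑ i ∈ range L, ((i : ℝ) + 1)⁻¹ ≤ 1 + Real.log L := by
    have := harmonic_le_one_add_log L
    rw [harmonic] at this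
    push_cast at this
    exact this
  calc wsum L α ≤ _ := hsplit
    _ ≤ (2 * L + 1) + (1 / |α|) * (1 + Real.log L) := by
      refine add_le_add hF0 (hsum.trans ?_)
      exact mul_le_mul_of_nonneg_left hharm (by positivity)
    _ = _ := by ring

theorem prod_pow_succ_sq (U : ℝ) (k : ℕ) :
    ∏ j : Fin k, (U ^ ((j : ℕ) + 1)) ^ 2 = U ^ (k * (k + 1)) := by
  induction k with
  | zero => simp
  | succ k ih =>
    rw [Fin.prod_univ_castSucc]
    simp only [Fin.val_castSucc, Fin.val_last, ih]
    rw [← pow_mul, ← pow_add]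
    congr 1
    ring

theorem one_sub_inv_pow_le {k : ℕ} (hk : 1 ≤ k) :
    (1 - 1 / (k : ℝ)) ^ (10 * k) ≤ 1 / 20000 := by
  have hk' : (1 : ℝ) ≤ k := by exact_mod_cast hk
  have h0 : 0 ≤ 1 - 1 / (k : ℝ) := by
    rw [sub_nonneg, div_le_one (by linarith)]
    exact hk'
  calc (1 - 1 / (k : ℝ)) ^ (10 * k) ≤ (Real.exp (-(1 / (k : ℝ)))) ^ (10 * k) :=
        pow_le_pow_left₀ h0 (Real.one_sub_le_exp_neg _) _
    _ = (Real.exp 1 ^ 10)⁻¹ := by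
        rw [← Real.exp_nat_mul, ← Real.exp_nat_mul, ← Real.exp_neg]
        congr 1
        push_cast
        field_simp
    _ ≤ 1 / 20000 := by
        rw [inv_eq_one_div]
        refine one_div_le_one_div_of_le (by norm_num) ?_
        calc (20000 : ℝ) ≤ 2.7 ^ 10 := by norm_num
          _ ≤ _ := pow_le_pow_left₀ (by norm_num) (by linarith [Real.exp_one_gt_d9]) _

set_option maxHeartbeats 400000 in
theorem wsum_good_le {q j s U : ℕ} {x Y a lK : ℝ} (hq : 1 ≤ q)
    (hj1 : 2 * q + 2 ≤ j) (hj2 : j ≤ 4 * q) (hs1 : 1 ≤ s) (hs : (s : ℝ) ≤ 1600 * q ^ 2)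
    (hlK : (q : ℝ) ^ 2 ≤ lK) (hx : 2 ^ 20 * lK ^ 2 ≤ x) (hxK : x ≤ Real.exp lK)
    (hU1 : (U : ℝ) ≤ x ^ 8) (hU2 : x ^ 8 ≤ 2 * U)
    (hY1 : x ^ (20 * q) ≤ Y * x ^ 2) (hY2 : Y ≤ x ^ (20 * q + 18))
    (ha1 : Y ≤ 4 * |a| * (2 * x ^ 20) ^ j) (ha2 : |a| * (x ^ 20) ^ j ≤ (j + 1) * Y) :
    wsum (s * U ^ j) a ≤ 9 * ((s : ℝ) * U ^ j) ^ 2 * (x ^ q)⁻¹ := by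
  have hq' : (1 : ℝ) ≤ q := by exact_mod_cast hq
  have hlK1 : 1 ≤ lK := by nlinarith
  have hx15 : (2 : ℝ) ^ 20 ≤ x := by nlinarith
  have hx1 : 1 ≤ x := by linarith [show (1 : ℝ) ≤ 2 ^ 20 by norm_num]
  have hx0 : 0 < x := by linarith
  have hU1' : (1 : ℝ) ≤ U := by
    have : x ≤ x ^ 8 := le_self_pow₀ hx1 (by norm_num)
    linarith
  have hs1' : (1 : ℝ) ≤ s := by exact_mod_cast hs1
  set L : ℝ := (s : ℝ) * (U : ℝ) ^ j with hLdef
  have hLc : ((s * U ^ j : ℕ) : ℝ) = L := by push_cast; rfl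
  have hL1 : 1 ≤ L := one_le_mul_of_one_le_of_one_le hs1' (one_le_pow₀ hU1')
  have hYpos : 0 < Y := by
    have : 0 < x ^ (20 * q) := by positivity
    by_contra h
    nlinarith [pow_pos hx0 2]
  have hapos : 0 < |a| := by
    by_contra h
    have h0 : |a| = 0 := le_antisymm (not_lt.mp h) (abs_nonneg _)
    rw [h0] at ha1
    simp at ha1
    linarith
  have ha0 : a ≠ 0 := abs_pos.mp hapos
  have hj' : (j : ℝ) ≤ 4 * q := by exact_mod_cast hj2
  have hq3 : (q : ℝ) ^ 3 ≤ lK ^ 2 := by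
    calc (q : ℝ) ^ 3 ≤ (q ^ 2) ^ 2 := by rw [← pow_mul]; exact pow_le_pow_right₀ hq' (by norm_num)
      _ ≤ _ := by gcongr
  -- the small coefficient condition
  have hgood : L * |a| ≤ 1 / 2 := by
    have h1 : L ≤ s * (x ^ 8) ^ j := by rw [hLdef]; gcongr
    have h2 : L * |a| * x ^ (12 * j) ≤ s * ((j + 1) * x ^ (20 * q + 18)) := by
      calc L * |a| * x ^ (12 * j) ≤ s * (x ^ 8) ^ j * |a| * x ^ (12 * j) := by gcongr
        _ = s * (|a| * (x ^ 20) ^ j) := by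
          rw [← pow_mul, ← pow_mul, show 20 * j = 8 * j + 12 * j by ring, pow_add]; ring
        _ ≤ s * ((j + 1) * Y) := by gcongr
        _ ≤ _ := by gcongr
    have h3 : (s : ℝ) * (j + 1) ≤ x / 2 := by
      calc (s : ℝ) * (j + 1) ≤ 1600 * q ^ 2 * (5 * q) := by gcongr; linarith
        _ = 8000 * q ^ 3 := by ring
        _ ≤ 8000 * lK ^ 2 := by gcongr
        _ ≤ _ := by nlinarith
    have h4 : x ^ (20 * q + 19) ≤ x ^ (12 * j) := pow_le_pow_right₀ hx1 (by omega)
    have h5 : 0 < x ^ (20 * q + 18) := by positivity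
    have h6 : L * |a| * x ^ (20 * q + 19) ≤ 1 / 2 * x ^ (20 * q + 19) := by
      calc L * |a| * x ^ (20 * q + 19) ≤ L * |a| * x ^ (12 * j) := by gcongr
        _ ≤ s * (j + 1) * x ^ (20 * q + 18) := by linarith
        _ ≤ x / 2 * x ^ (20 * q + 18) := by gcongr
        _ = _ := by rw [pow_succ x (20 * q + 18)]; ring
    exact le_of_mul_le_mul_right h6 (by positivity)
  have hw := wsum_le (L := s * U ^ j) ha0 (by rw [hLc]; exact hgood)
  rw [hLc] at hw
  have hlogL : 1 + Real.log L ≤ 64 * lK ^ 2 := by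
    have h1 : L ≤ Real.exp (lK * (1 + 32 * q)) := by
      have h2 : (s : ℝ) ≤ Real.exp lK := by
        calc (s : ℝ) ≤ 1600 * q ^ 2 := hs
          _ ≤ 1600 * lK := by gcongr
          _ ≤ x := by nlinarith
          _ ≤ Real.exp lK := hxK
      calc L ≤ Real.exp lK * (Real.exp lK ^ 8) ^ j := by
            rw [hLdef]
            have : (U : ℝ) ≤ Real.exp lK ^ 8 :=
              hU1.trans (pow_le_pow_left₀ hx0.le hxK 8)
            gcongr
        _ ≤ Real.exp lK * (Real.exp lK ^ 8) ^ (4 * q) := by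
            have : (1 : ℝ) ≤ Real.exp lK ^ 8 := one_le_pow₀ (Real.one_le_exp (by linarith))
            gcongr
        _ = _ := by
            rw [← pow_mul, ← Real.exp_nat_mul, ← Real.exp_add]
            congr 1
            push_cast
            ring
    have h2 : Real.log L ≤ lK * (1 + 32 * q) := by
      rw [Real.log_le_iff_le_exp (by linarith)]
      exact h1
    have h3 : (q : ℝ) ≤ lK := (le_self_pow₀ hq' (by norm_num)).trans hlK
    have h4 : lK * q ≤ lK * lK := by gcongr
    have h5 : lK ≤ lK * lK := le_mul_of_one_le_left (by linarith) hlK1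
    linarith [sq lK]
  have hxq : 0 < x ^ q := by positivity
  have hfirst : 3 * x ^ q ≤ L := by
    have h1 : x ^ 7 ≤ U := by nlinarith [pow_pos hx0 7, pow_succ x 7]
    calc 3 * x ^ q ≤ x * x ^ q := by gcongr; linarith [show (3 : ℝ) ≤ 2 ^ 20 by norm_num]
      _ = x ^ (q + 1) := (pow_succ' x q).symm
      _ ≤ x ^ (7 * j) := pow_le_pow_right₀ hx1 (by omega)
      _ = (x ^ 7) ^ j := pow_mul x 7 j
      _ ≤ (U : ℝ) ^ j := by gcongr
      _ ≤ L := le_mul_of_one_le_left (by positivity) hs1'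
  have hsecond : 8 * lK ^ 2 * x ^ q ≤ L ^ 2 * |a| := by
    have h1 : (x ^ 8) ^ j ≤ 2 ^ j * L := by
      calc (x ^ 8) ^ j ≤ (2 * (U : ℝ)) ^ j := by gcongr
        _ = 2 ^ j * (U : ℝ) ^ j := mul_pow _ _ _
        _ ≤ _ := by
          gcongr
          exact le_mul_of_one_le_left (by positivity) hs1'
    have h2 : ((x ^ 8) ^ j) ^ 2 ≤ (2 ^ j * L) ^ 2 := by gcongr
    have h3 : x ^ (16 * j) * x ^ (20 * q) ≤ L ^ 2 * |a| * (4 * 8 ^ j * x ^ (20 * j + 2)) := by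
      calc x ^ (16 * j) * x ^ (20 * q) ≤ (2 ^ j * L) ^ 2 * (Y * x ^ 2) := by
            refine mul_le_mul ?_ hY1 (by positivity) (by positivity)
            refine le_trans (le_of_eq ?_) h2
            rw [← pow_mul, ← pow_mul]; congr 1; ring
        _ ≤ (2 ^ j * L) ^ 2 * (4 * |a| * (2 * x ^ 20) ^ j * x ^ 2) := by gcongr
        _ = _ := by
            have h8 : (8 : ℝ) ^ j = 2 ^ j * 2 ^ j * 2 ^ j := by
              rw [← mul_pow, ← mul_pow]; norm_num
            rw [h8, pow_add x, mul_pow 2 (x ^ 20), ← pow_mul x 20 j]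
            ring
    have h4 : x ^ (20 * q) ≤ L ^ 2 * |a| * (4 * 8 ^ (4 * q) * x ^ (16 * q + 2)) := by
      have h5 : x ^ (16 * j) * x ^ (20 * q) ≤
          x ^ (16 * j) * (L ^ 2 * |a| * (4 * 8 ^ (4 * q) * x ^ (16 * q + 2))) := by
        refine h3.trans ?_
        rw [show 20 * j + 2 = 16 * j + (4 * j + 2) by ring, pow_add x]
        have h6 : x ^ (4 * j + 2) ≤ x ^ (16 * q + 2) := pow_le_pow_right₀ hx1 (by omega)
        have h7 : (8 : ℝ) ^ j ≤ 8 ^ (4 * q) := pow_le_pow_right₀ (by norm_num) hj2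
        calc _ = x ^ (16 * j) * (L ^ 2 * |a| * (4 * 8 ^ j * x ^ (4 * j + 2))) := by ring
          _ ≤ _ := by gcongr
      exact le_of_mul_le_mul_left h5 (by positivity)
    have h5 : (2 ^ 12) ^ q * (32 * lK ^ 2) ≤ x ^ q := by
      have h8 : 1 ≤ 2 ^ 8 * lK ^ 2 := by nlinarith
      calc (2 ^ 12) ^ q * (32 * lK ^ 2) ≤ (2 ^ 12) ^ q * (2 ^ 8 * lK ^ 2) ^ q := by
            gcongr
            calc 32 * lK ^ 2 ≤ 2 ^ 8 * lK ^ 2 := by nlinarith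
              _ ≤ _ := le_self_pow₀ h8 (by omega)
        _ = (2 ^ 20 * lK ^ 2) ^ q := by rw [← mul_pow]; congr 1; ring
        _ ≤ _ := by gcongr
    have h6 : 8 * lK ^ 2 * x ^ q * (4 * 8 ^ (4 * q) * x ^ (16 * q + 2)) ≤ x ^ (20 * q) := by
      calc _ = (2 ^ 12) ^ q * (32 * lK ^ 2) * x ^ (17 * q + 2) := by
            rw [pow_mul (8 : ℝ), show (8 : ℝ) ^ 4 = 2 ^ 12 by norm_num,
              show 17 * q + 2 = q + (16 * q + 2) by ring, pow_add x q]
            ring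
        _ ≤ x ^ q * x ^ (17 * q + 2) := by gcongr
        _ = x ^ (18 * q + 2) := by rw [← pow_add]; congr 1; ring
        _ ≤ _ := pow_le_pow_right₀ hx1 (by omega)
    exact le_of_mul_le_mul_right (h6.trans h4) (by positivity)
  have hinv : x ^ q * (x ^ q)⁻¹ = 1 := mul_inv_cancel₀ hxq.ne'
  have h1 : 3 * L ≤ L ^ 2 * (x ^ q)⁻¹ := by
    rw [← div_eq_mul_inv, le_div_iff₀ hxq]
    calc 3 * L * x ^ q = L * (3 * x ^ q) := by ring
      _ ≤ L * L := by gcongr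
      _ = L ^ 2 := (sq L).symm
  have h2 : (1 + Real.log L) / |a| ≤ 8 * (L ^ 2 * (x ^ q)⁻¹) := by
    rw [← div_eq_mul_inv, div_le_iff₀ hapos, ← mul_div_assoc, div_mul_eq_mul_div, le_div_iff₀ hxq]
    calc (1 + Real.log L) * x ^ q ≤ 64 * lK ^ 2 * x ^ q := by gcongr
      _ = 8 * (8 * lK ^ 2 * x ^ q) := by ring
      _ ≤ 8 * (L ^ 2 * |a|) := by gcongr
      _ = _ := by ring
  linarith

theorem prod_wsum_le {k s U q : ℕ} {x : ℝ} {α : ℕ → ℝ} (hU : 1 ≤ U) (hs1 : 1 ≤ s) (hq : 1 ≤ q)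
    (hkq : 4 * q ≤ k) (hx : 1 ≤ x)
    (hgood : ∀ j, 2 * q + 2 ≤ j → j ≤ 4 * q →
      wsum (s * U ^ j) (α j) ≤ 9 * ((s : ℝ) * U ^ j) ^ 2 * (x ^ q)⁻¹) :
    ∏ j : Fin k, wsum (s * U ^ ((j : ℕ) + 1)) (α ((j : ℕ) + 1)) ≤
      (9 * (s : ℝ) ^ 2) ^ k * (U : ℝ) ^ (k * (k + 1)) * ((x ^ q)⁻¹) ^ q := by
  have hx0 : 0 < x := by linarith
  have hinv : (x ^ q)⁻¹ ≤ 1 := inv_le_one_of_one_le₀ (one_le_pow₀ hx)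
  set G : Finset (Fin k) := univ.filter fun j => 2 * q + 2 ≤ (j : ℕ) + 1 ∧ (j : ℕ) + 1 ≤ 4 * q
  have hcard : q ≤ #G := by
    have : #(range q) ≤ #G := by
      refine card_le_card_of_injOn
        (fun i => if h : i < q then (⟨2 * q + 1 + i, by omega⟩ : Fin k) else ⟨0, by omega⟩) ?_ ?_
      · intro i hi
        have hi' : i < q := by simpa using hi
        simp only [hi', dif_pos, G, coe_filter, Set.mem_ofPred_eq, mem_univ, true_and]
        omega
      · intro i hi j hj h
        have hi' : i < q := by simpa using hi
        have hj' : j < q := by simpa using hj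
        simp only [hi', hj', dif_pos, Fin.mk.injEq] at h
        omega
    simpa using this
  have hL1 : ∀ j : ℕ, (1 : ℝ) ≤ (s : ℝ) * U ^ j := fun j =>
    one_le_mul_of_one_le_of_one_le (by exact_mod_cast hs1)
      (one_le_pow₀ (by exact_mod_cast hU))
  calc ∏ j : Fin k, wsum (s * U ^ ((j : ℕ) + 1)) (α ((j : ℕ) + 1))
      ≤ ∏ j : Fin k, ((9 * (s : ℝ) ^ 2) * ((U : ℝ) ^ ((j : ℕ) + 1)) ^ 2 *
          if j ∈ G then (x ^ q)⁻¹ else 1) := by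
        refine prod_le_prod (fun j _ => wsum_nonneg _ _) fun j _ => ?_
        split_ifs with h
        · simp only [G, mem_filter, mem_univ, true_and] at h
          refine (hgood _ h.1 h.2).trans (le_of_eq ?_)
          ring
        · refine (wsum_le_sq _ _).trans ?_
          have h1 := hL1 ((j : ℕ) + 1)
          push_cast
          nlinarith
    _ = (9 * (s : ℝ) ^ 2) ^ k * (U : ℝ) ^ (k * (k + 1)) * ((x ^ q)⁻¹) ^ #G := by
        rw [prod_mul_distrib, prod_mul_distrib, prod_pow_succ_sq, prod_const, card_univ,
          Fintype.card_fin, prod_ite_mem, univ_inter, prod_const]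
    _ ≤ _ := by
        refine mul_le_mul_of_nonneg_left ?_ (by positivity)
        exact pow_le_pow_of_le_one (by positivity) hinv hcard

set_option maxHeartbeats 1000000 in
/-- The bilinear form of Vinogradov's estimate for a polynomial phase whose coefficients are
like those of the Taylor expansion of `y / x` or `y / x ^ 2` near a point of size `X ^ 20`. -/
theorem exists_bilinear_le : ∃ C : ℝ, 1 ≤ C ∧ ∀ (q U : ℕ) (x Y lK : ℝ) (α : ℕ → ℝ), 1 ≤ q →
    (q : ℝ) ^ 2 ≤ lK → 2 ^ 20 * lK ^ 2 ≤ x → x ≤ Real.exp lK → (U : ℝ) ≤ x ^ 8 →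
    x ^ 8 ≤ 2 * U → x ^ (20 * q) ≤ Y * x ^ 2 → Y ≤ x ^ (20 * q + 18) →
    (∀ j, Y ≤ 4 * |α j| * (2 * x ^ 20) ^ j) → (∀ j, |α j| * (x ^ 20) ^ j ≤ (j + 1) * Y) →
    ‖∑ u ∈ Icc (1 : ℤ) U, ∑ v ∈ Icc (1 : ℤ) U,
      e (∑ j : Fin (10 * q + 2), α ((j : ℕ) + 1) * (u * v : ℤ) ^ ((j : ℕ) + 1))‖ ≤
      C * (U : ℝ) ^ 2 * x ^ (-(1 / (10 ^ 8 * (q : ℝ) ^ 2))) := by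
  obtain ⟨C, hC, hvmv⟩ := exists_vmv_le
  refine ⟨2 * C, by linarith, ?_⟩
  intro q U x Y lK α hq hlK hx hxK hU1 hU2 hY1 hY2 ha1 ha2
  have hq' : (1 : ℝ) ≤ q := by exact_mod_cast hq
  have hlK1 : 1 ≤ lK := by nlinarith
  have hx1 : 1 ≤ x := by nlinarith
  have hx0 : 0 < x := by linarith
  have hU : 1 ≤ U := by
    have : x ≤ x ^ 8 := le_self_pow₀ hx1 (by norm_num)
    by_contra h
    have h0 : U = 0 := by omega
    rw [h0] at hU2
    simp at hU2
    linarith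
  have hUr : (0 : ℝ) < U := by exact_mod_cast hU
  have hUr1 : (1 : ℝ) ≤ U := by exact_mod_cast hU
  obtain ⟨k, hk⟩ : ∃ k, k = 10 * q + 2 := ⟨_, rfl⟩
  rw [← hk]
  have hk2 : 2 ≤ k := by omega
  obtain ⟨s, hs⟩ : ∃ s, s = k * (10 * k + 1) := ⟨_, rfl⟩
  have hsk : 10 * k ^ 2 ≤ s := by rw [hs]; nlinarith
  have hs1 : 2 ≤ s := by nlinarith
  have hks : k ≤ s := by nlinarith
  have hk12 : (k : ℝ) ≤ 12 * q := by
    rw [hk]; push_cast; linarith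
  have hs1600 : (s : ℝ) ≤ 1600 * q ^ 2 := by
    have h1 : k ≤ 12 * q := by omega
    have : s ≤ 1600 * q ^ 2 := by
      rw [hs]
      calc k * (10 * k + 1) ≤ 12 * q * (10 * (12 * q) + q) := by gcongr
        _ ≤ _ := by nlinarith
    exact_mod_cast this
  have hprod := prod_wsum_le (k := k) (s := s) (U := U) (q := q) (x := x) (α := α) hU (by omega) hq
    (by omega) hx1 fun j h1 h2 => wsum_good_le hq h1 h2 (by omega) hs1600 hlK hx hxK hU1 hU2
      hY1 hY2 (ha1 j) (ha2 j)
  have hbil := bilinear_bound s k U (by omega) fun j => α ((j : ℕ) + 1)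
  set N := ‖∑ u ∈ Icc (1 : ℤ) U, ∑ v ∈ Icc (1 : ℤ) U,
      e (∑ j : Fin k, α ((j : ℕ) + 1) * (u * v : ℤ) ^ ((j : ℕ) + 1))‖ with hN
  have hJ := hvmv k (10 * k) U hk2 le_rfl hU
  rw [← hs] at hJ
  set ρ : ℝ := (1 - 1 / (k : ℝ)) ^ (10 * k) with hρ
  have hρle : ρ ≤ 1 / 20000 := one_sub_inv_pow_le (by omega)
  have hρ0 : 0 ≤ ρ := Even.pow_nonneg ⟨5 * k, by ring⟩ _
  set E : ℝ := 2 * (s : ℝ) - k * (k + 1) / 2 + k * (k + 1) / 2 * ρ with hE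
  have hδ : (k : ℝ) * (k + 1) * ρ ≤ q ^ 2 / 100 := by
    calc (k : ℝ) * (k + 1) * ρ ≤ 12 * q * (12 * q + q) * (1 / 20000) := by gcongr
      _ ≤ _ := by nlinarith
  -- the mean value loses only a small power
  have hUJ : (vmv s k U : ℝ) ^ 2 * (U : ℝ) ^ (k * (k + 1)) ≤
      C ^ (2 * k ^ 4) * ((U : ℝ) ^ (4 * s) * x ^ ((q : ℝ) ^ 2 / 2)) := by
    have h1 : (vmv s k U : ℝ) ^ 2 ≤ (C ^ (k ^ 4) * (U : ℝ) ^ E) ^ 2 := by gcongr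
    have h2 : ((U : ℝ) ^ E) ^ 2 * (U : ℝ) ^ (k * (k + 1)) =
        (U : ℝ) ^ (4 * s) * (U : ℝ) ^ ((k : ℝ) * (k + 1) * ρ) := by
      rw [← Real.rpow_natCast, ← Real.rpow_natCast, ← Real.rpow_natCast, ← Real.rpow_mul hUr.le,
        ← Real.rpow_add hUr, ← Real.rpow_add hUr]
      congr 1
      rw [hE]
      push_cast
      ring
    have h3 : (U : ℝ) ^ ((k : ℝ) * (k + 1) * ρ) ≤ x ^ ((q : ℝ) ^ 2 / 2) := by
      calc (U : ℝ) ^ ((k : ℝ) * (k + 1) * ρ) ≤ (U : ℝ) ^ ((q : ℝ) ^ 2 / 100) :=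
            Real.rpow_le_rpow_of_exponent_le hUr1 hδ
        _ ≤ (x ^ 8) ^ ((q : ℝ) ^ 2 / 100) := by gcongr
        _ = x ^ (8 * ((q : ℝ) ^ 2 / 100)) := by
            rw [← Real.rpow_natCast, ← Real.rpow_mul hx0.le]
            norm_num
        _ ≤ _ := Real.rpow_le_rpow_of_exponent_le hx1 (by nlinarith)
    calc _ ≤ (C ^ (k ^ 4) * (U : ℝ) ^ E) ^ 2 * (U : ℝ) ^ (k * (k + 1)) := by gcongr
      _ = C ^ (2 * k ^ 4) * (((U : ℝ) ^ E) ^ 2 * (U : ℝ) ^ (k * (k + 1))) := by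
          rw [mul_pow, ← pow_mul, mul_comm (k ^ 4) 2]; ring
      _ ≤ _ := by rw [h2]; gcongr
  have hconst : (9 * (s : ℝ) ^ 2) ^ k ≤ 2 ^ (4 * s ^ 2) := by
    have h1 : (9 * (s : ℝ) ^ 2) ≤ 2 ^ (4 * s) := by
      have h2 : (s : ℝ) ≤ 2 ^ s := by exact_mod_cast Nat.lt_two_pow_self.le
      have h3 : (2 : ℝ) ^ 4 ≤ 2 ^ (2 * s) := pow_le_pow_right₀ (by norm_num) (by omega)
      calc 9 * (s : ℝ) ^ 2 ≤ 2 ^ (2 * s) * (2 ^ s) ^ 2 := by gcongr; linarith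
        _ = _ := by rw [← pow_mul, ← pow_add]; congr 1; ring
    calc (9 * (s : ℝ) ^ 2) ^ k ≤ (2 ^ (4 * s)) ^ k := by gcongr
      _ = 2 ^ (4 * s * k) := (pow_mul _ _ _).symm
      _ ≤ _ := pow_le_pow_right₀ (by norm_num) (by nlinarith)
  have hCpow : C ^ (2 * k ^ 4) ≤ C ^ (4 * s ^ 2) := by
    refine pow_le_pow_right₀ hC ?_
    have := Nat.pow_le_pow_left hsk 2
    nlinarith
  have hxpow : x ^ ((q : ℝ) ^ 2 / 2) * ((x ^ q)⁻¹) ^ q ≤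
      (x ^ (-(1 / (10 ^ 8 * (q : ℝ) ^ 2)))) ^ (4 * s ^ 2) := by
    have hA : ((x ^ q)⁻¹) ^ q = x ^ (-(q : ℝ) ^ 2) := by
      rw [Real.rpow_neg hx0.le, inv_pow, ← pow_mul, ← Real.rpow_natCast x, Nat.cast_mul, sq]
    rw [hA, ← Real.rpow_mul_natCast hx0.le, ← Real.rpow_add hx0]
    refine Real.rpow_le_rpow_of_exponent_le hx1 ?_
    have h1 : 1 / (10 ^ 8 * (q : ℝ) ^ 2) * ((4 * s ^ 2 : ℕ) : ℝ) ≤ q ^ 2 / 2 := by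
      rw [div_mul_eq_mul_div, one_mul, div_le_div_iff₀ (by positivity) (by norm_num)]
      push_cast
      calc 4 * (s : ℝ) ^ 2 * 2 ≤ 4 * (1600 * (q : ℝ) ^ 2) ^ 2 * 2 := by gcongr
        _ = 20480000 * (q : ℝ) ^ 4 := by ring
        _ ≤ 100000000 * (q : ℝ) ^ 4 := by gcongr; norm_num
        _ = _ := by ring
    linarith
  have hfin : N ^ (4 * s ^ 2) ≤
      (2 * C * (U : ℝ) ^ 2 * x ^ (-(1 / (10 ^ 8 * (q : ℝ) ^ 2)))) ^ (4 * s ^ 2) := by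
    calc N ^ (4 * s ^ 2) = N ^ (2 * s * (2 * s)) := by congr 1; ring
      _ ≤ _ := hbil
      _ ≤ (U : ℝ) ^ (4 * s * (2 * s - 1)) * (vmv s k U : ℝ) ^ 2 *
          ((9 * (s : ℝ) ^ 2) ^ k * (U : ℝ) ^ (k * (k + 1)) * ((x ^ q)⁻¹) ^ q) := by gcongr
      _ = (9 * (s : ℝ) ^ 2) ^ k * (U : ℝ) ^ (4 * s * (2 * s - 1)) *
          ((vmv s k U : ℝ) ^ 2 * (U : ℝ) ^ (k * (k + 1))) * ((x ^ q)⁻¹) ^ q := by ring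
      _ ≤ 2 ^ (4 * s ^ 2) * (U : ℝ) ^ (4 * s * (2 * s - 1)) *
          (C ^ (4 * s ^ 2) * ((U : ℝ) ^ (4 * s) * x ^ ((q : ℝ) ^ 2 / 2))) * ((x ^ q)⁻¹) ^ q := by
          have := hUJ.trans (mul_le_mul_of_nonneg_right hCpow (by positivity))
          gcongr
      _ = 2 ^ (4 * s ^ 2) * C ^ (4 * s ^ 2) *
          ((U : ℝ) ^ (4 * s * (2 * s - 1)) * (U : ℝ) ^ (4 * s)) *
          (x ^ ((q : ℝ) ^ 2 / 2) * ((x ^ q)⁻¹) ^ q) := by ring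
      _ ≤ 2 ^ (4 * s ^ 2) * C ^ (4 * s ^ 2) * ((U : ℝ) ^ 2) ^ (4 * s ^ 2) *
          (x ^ (-(1 / (10 ^ 8 * (q : ℝ) ^ 2)))) ^ (4 * s ^ 2) := by
          have hexp : 4 * s * (2 * s - 1) + 4 * s = 2 * (4 * s ^ 2) := by
            obtain ⟨m, rfl⟩ : ∃ m, s = m + 1 := ⟨s - 1, by omega⟩
            have : 2 * (m + 1) - 1 = 2 * m + 1 := by omega
            rw [this]
            ring
          rw [← pow_add (U : ℝ), hexp, pow_mul (U : ℝ)]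
          gcongr
      _ = _ := by rw [← mul_pow, ← mul_pow, ← mul_pow]
  exact le_of_pow_le_pow_left₀ (by positivity) (by positivity) hfin

/-! ### Exponential sums with reciprocal phases -/

section Vinogradov

theorem norm_sum_Icc_shift_sub_le (g : ℤ → ℂ) (hg : ∀ n, ‖g n‖ ≤ 1) (A B : ℤ) (h : ℕ) :
    ‖∑ n ∈ Icc A B, g n - ∑ n ∈ Icc A B, g (n + h)‖ ≤ 2 * h := by
  have h1 : ∑ n ∈ Icc A B, g (n + h) = ∑ n ∈ Icc (A + h) (B + h), g n := by
    rw [← map_add_right_Icc, sum_map]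
    rfl
  have hsd : ∀ S T : Finset ℤ, #(S \ T) ≤ h → ‖∑ n ∈ S \ T, g n‖ ≤ h := by
    intro S T hST
    calc ‖∑ n ∈ S \ T, g n‖ ≤ ∑ n ∈ S \ T, (1 : ℝ) := norm_sum_le_of_le _ fun n _ => hg n
      _ = #(S \ T) := by simp
      _ ≤ h := by exact_mod_cast hST
  have hc1 : #(Icc A B \ Icc (A + h) (B + h)) ≤ h := by
    calc _ ≤ #(Icc A (A + h - 1)) := by
          refine card_le_card fun n hn => ?_
          simp only [mem_sdiff, mem_Icc, not_and, not_le] at hn ⊢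
          by_contra hcon
          have := hn.2 (by omega)
          omega
      _ ≤ h := by rw [Int.card_Icc]; omega
  have hc2 : #(Icc (A + h) (B + h) \ Icc A B) ≤ h := by
    calc _ ≤ #(Icc (B + 1) (B + h)) := by
          refine card_le_card fun n hn => ?_
          simp only [mem_sdiff, mem_Icc, not_and, not_le] at hn ⊢
          have := hn.2 (by omega)
          omega
      _ ≤ h := by rw [Int.card_Icc]; omega
  rw [h1]
  have h2 := sum_sdiff_sub_sum_sdiff (s₁ := Icc (A + h) (B + h)) (s₂ := Icc A B) (f := g)
  rw [← h2]
  refine (norm_sub_le _ _).trans ?_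
  linarith [hsd _ _ hc1, hsd _ _ hc2]

theorem norm_sum_le_of_shift (f : ℤ → ℝ) (A B : ℤ) (U : ℕ) (hU : 1 ≤ U) (M : ℝ)
    (hM : ∀ b ∈ Icc A B, ‖∑ u ∈ Icc (1 : ℤ) U, ∑ v ∈ Icc (1 : ℤ) U, e (f (b + u * v))‖ ≤
      (U : ℝ) ^ 2 * M) :
    ‖∑ n ∈ Icc A B, e (f n)‖ ≤ #(Icc A B) * M + 2 * (U : ℝ) ^ 2 := by
  have hU' : (0 : ℝ) < U := by exact_mod_cast hU
  have hcard : (#(Icc (1 : ℤ) U) : ℝ) = U := by simp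
  set S := ∑ n ∈ Icc A B, e (f n) with hS
  have h1 : (U : ℂ) ^ 2 * S = ∑ u ∈ Icc (1 : ℤ) U, ∑ v ∈ Icc (1 : ℤ) U,
      (S - ∑ n ∈ Icc A B, e (f (n + u * v))) +
      ∑ n ∈ Icc A B, ∑ u ∈ Icc (1 : ℤ) U, ∑ v ∈ Icc (1 : ℤ) U, e (f (n + u * v)) := by
    have : ∑ n ∈ Icc A B, ∑ u ∈ Icc (1 : ℤ) U, ∑ v ∈ Icc (1 : ℤ) U, e (f (n + u * v)) =
        ∑ u ∈ Icc (1 : ℤ) U, ∑ v ∈ Icc (1 : ℤ) U, ∑ n ∈ Icc A B, e (f (n + u * v)) := by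
      rw [sum_comm]
      exact sum_congr rfl fun u _ => sum_comm
    rw [this, ← sum_add_distrib]
    simp_rw [← sum_add_distrib, sub_add_cancel, sum_const]
    simp
    ring
  have h2 : ‖∑ u ∈ Icc (1 : ℤ) U, ∑ v ∈ Icc (1 : ℤ) U,
      (S - ∑ n ∈ Icc A B, e (f (n + u * v)))‖ ≤ (U : ℝ) * (U * (2 * U ^ 2)) := by
    calc _ ≤ ∑ _u ∈ Icc (1 : ℤ) U, ∑ _v ∈ Icc (1 : ℤ) U, (2 * (U : ℝ) ^ 2) := by
          refine norm_sum_le_of_le _ fun u hu => norm_sum_le_of_le _ fun v hv => ?_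
          rw [mem_Icc] at hu hv
          have huv : 0 ≤ u * v := mul_nonneg (by omega) (by omega)
          have h3 := norm_sum_Icc_shift_sub_le (fun n => e (f n)) (fun n => (norm_e _).le) A B
            (u * v).toNat
          rw [Int.toNat_of_nonneg huv] at h3
          refine h3.trans ?_
          have h4 : (((u * v).toNat : ℕ) : ℝ) = (u : ℝ) * v := by
            have : (((u * v).toNat : ℤ) : ℝ) = ((u * v : ℤ) : ℝ) := by
              rw [Int.toNat_of_nonneg huv]
            push_cast at this
            exact_mod_cast this
          rw [h4]
          have h5 : (u : ℝ) ≤ U := by exact_mod_cast hu.2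
          have h6 : (v : ℝ) ≤ U := by exact_mod_cast hv.2
          have h7 : (0 : ℝ) ≤ v := by exact_mod_cast (by omega : 0 ≤ v)
          rw [sq]
          gcongr
      _ = _ := by simp only [sum_const, nsmul_eq_mul, hcard]
  have h3 : ‖∑ n ∈ Icc A B, ∑ u ∈ Icc (1 : ℤ) U, ∑ v ∈ Icc (1 : ℤ) U, e (f (n + u * v))‖ ≤
      #(Icc A B) * ((U : ℝ) ^ 2 * M) := by
    refine (norm_sum_le_of_le _ hM).trans_eq ?_
    rw [sum_const, nsmul_eq_mul]
  have h4 : (U : ℝ) ^ 2 * ‖S‖ ≤ (U : ℝ) ^ 2 * (#(Icc A B) * M + 2 * (U : ℝ) ^ 2) := by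
    calc (U : ℝ) ^ 2 * ‖S‖ = ‖(U : ℂ) ^ 2 * S‖ := by simp
      _ ≤ (U : ℝ) * (U * (2 * U ^ 2)) + #(Icc A B) * ((U : ℝ) ^ 2 * M) := by
        rw [h1]; exact (norm_add_le _ _).trans (add_le_add h2 h3)
      _ = _ := by ring
  exact le_of_mul_le_mul_left h4 (by positivity)

theorem exists_norm_sum_e_le_of_taylor : ∃ C : ℝ, 1 ≤ C ∧ ∀ (q : ℕ) (x Y lK : ℝ) (f : ℤ → ℝ)
    (a : ℤ → ℕ → ℝ) (A B : ℤ), 1 ≤ q → (q : ℝ) ^ 2 ≤ lK → 2 ^ 20 * lK ^ 2 ≤ x →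
    x ≤ Real.exp lK → x ^ (20 * q) ≤ Y * x ^ 2 → Y ≤ x ^ (20 * q + 18) →
    (#(Icc A B) : ℝ) ≤ x ^ 20 →
    (∀ b ∈ Icc A B, ∀ j, Y ≤ 4 * |a b j| * (2 * x ^ 20) ^ j) →
    (∀ b ∈ Icc A B, ∀ j, |a b j| * (x ^ 20) ^ j ≤ (j + 1) * Y) →
    (∀ b ∈ Icc A B, ∀ z : ℤ, 0 ≤ z → (z : ℝ) ≤ x ^ 16 →
      |f (b + z) - (a b 0 + ∑ j : Fin (10 * q + 2), a b ((j : ℕ) + 1) * (z : ℝ) ^ ((j : ℕ) + 1))|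
        ≤ 1 / x) →
    ‖∑ n ∈ Icc A B, e (f n)‖ ≤ C * x ^ 20 * x ^ (-(1 / (10 ^ 8 * (q : ℝ) ^ 2))) := by
  obtain ⟨C, hC, hbil⟩ := exists_bilinear_le
  refine ⟨C + 10, by linarith, ?_⟩
  intro q x Y lK f a A B hq hlK hx hxK hY1 hY2 hcard ha1 ha2 hf
  have hq' : (1 : ℝ) ≤ q := by exact_mod_cast hq
  have hlK1 : 1 ≤ lK := by nlinarith
  have hx2 : 2 ≤ x := by nlinarith
  have hx0 : 0 < x := by linarith
  have hx8 : x ≤ x ^ 8 := le_self_pow₀ (by linarith) (by norm_num)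
  set U := ⌊x ^ 8⌋₊ with hU
  have hU1 : (U : ℝ) ≤ x ^ 8 := Nat.floor_le (by positivity)
  have hU2 : x ^ 8 ≤ 2 * U := by
    have := Nat.lt_floor_add_one (x ^ 8)
    rw [← hU] at this
    linarith
  have hUpos : 1 ≤ U := by
    rw [hU, Nat.one_le_floor_iff]
    linarith
  set η : ℝ := x ^ (-(1 / (10 ^ 8 * (q : ℝ) ^ 2))) with hη
  have hη1 : 1 / x ≤ η := by
    rw [one_div, ← Real.rpow_neg_one, hη]
    refine Real.rpow_le_rpow_of_exponent_le (by linarith) ?_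
    rw [neg_le_neg_iff, div_le_one (by positivity)]
    nlinarith
  have hU16 : (U : ℝ) ^ 2 ≤ x ^ 16 := by
    calc (U : ℝ) ^ 2 ≤ (x ^ 8) ^ 2 := by gcongr
      _ = _ := by ring
  have hM : ∀ b ∈ Icc A B, ‖∑ u ∈ Icc (1 : ℤ) U, ∑ v ∈ Icc (1 : ℤ) U, e (f (b + u * v))‖ ≤
      (U : ℝ) ^ 2 * (C * η + 7 * (1 / x)) := by
    intro b hb
    set p : ℤ → ℝ := fun z => ∑ j : Fin (10 * q + 2), a b ((j : ℕ) + 1) * (z : ℝ) ^ ((j : ℕ) + 1)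
      with hp
    have h1 : ‖∑ u ∈ Icc (1 : ℤ) U, ∑ v ∈ Icc (1 : ℤ) U, e (a b 0 + p (u * v))‖ ≤
        C * (U : ℝ) ^ 2 * η := by
      simp_rw [e_add, ← mul_sum]
      rw [norm_mul, norm_e, one_mul]
      exact hbil q U x Y lK (a b) hq hlK hx hxK hU1 hU2 hY1 hY2 (ha1 b hb) (ha2 b hb)
    have h2 : ‖∑ u ∈ Icc (1 : ℤ) U, ∑ v ∈ Icc (1 : ℤ) U,
        (e (f (b + u * v)) - e (a b 0 + p (u * v)))‖ ≤ (U : ℝ) * (U * (7 * (1 / x))) := by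
      have hcardU : (#(Icc (1 : ℤ) U) : ℝ) = U := by simp
      calc _ ≤ ∑ _u ∈ Icc (1 : ℤ) U, ∑ _v ∈ Icc (1 : ℤ) U, (7 * (1 / x)) := by
            refine norm_sum_le_of_le _ fun u hu => norm_sum_le_of_le _ fun v hv => ?_
            rw [mem_Icc] at hu hv
            have h5 : (u : ℝ) ≤ U := by exact_mod_cast hu.2
            have h6 : (v : ℝ) ≤ U := by exact_mod_cast hv.2
            have h7 : (0 : ℝ) ≤ v := by exact_mod_cast (by omega : 0 ≤ v)
            have h8 : ((u * v : ℤ) : ℝ) ≤ x ^ 16 := by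
              push_cast
              calc (u : ℝ) * v ≤ U * U := by gcongr
                _ = (U : ℝ) ^ 2 := by ring
                _ ≤ _ := hU16
            have h9 := hf b hb (u * v) (mul_nonneg (by omega) (by omega)) h8
            refine (norm_e_sub_e_le _ _).trans ?_
            have h10 : 2 * Real.pi ≤ 7 := by linarith [Real.pi_lt_d2]
            exact mul_le_mul h10 h9 (abs_nonneg _) (by norm_num)
        _ = _ := by simp only [sum_const, nsmul_eq_mul, hcardU]
    have h3 : ∑ u ∈ Icc (1 : ℤ) U, ∑ v ∈ Icc (1 : ℤ) U, e (f (b + u * v)) =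
        ∑ u ∈ Icc (1 : ℤ) U, ∑ v ∈ Icc (1 : ℤ) U, e (a b 0 + p (u * v)) +
        ∑ u ∈ Icc (1 : ℤ) U, ∑ v ∈ Icc (1 : ℤ) U,
          (e (f (b + u * v)) - e (a b 0 + p (u * v))) := by
      simp_rw [sum_sub_distrib]
      ring
    rw [h3]
    refine (norm_add_le _ _).trans ((add_le_add h1 h2).trans_eq ?_)
    ring
  have hfin := norm_sum_le_of_shift f A B U hUpos _ hM
  have hx4 : x ^ 16 ≤ x ^ 20 * (1 / x) := by
    rw [mul_one_div, le_div_iff₀ hx0, ← pow_succ]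
    exact pow_le_pow_right₀ (by linarith) (by norm_num)
  have hη0 : 0 < η := by positivity
  have hx1 : 0 < 1 / x := by positivity
  calc _ ≤ _ := hfin
    _ ≤ x ^ 20 * (C * η + 7 * (1 / x)) + 2 * (x ^ 20 * (1 / x)) := by
      gcongr
      linarith
    _ ≤ x ^ 20 * (C * η + 7 * η) + 2 * (x ^ 20 * η) := by gcongr
    _ ≤ _ := by nlinarith [pow_pos hx0 20, mul_pos (pow_pos hx0 20) hη0]

theorem one_add_mul_sum_neg_pow (w : ℝ) (k : ℕ) :
    (1 + w) * ∑ j ∈ range (k + 1), (-w) ^ j = 1 - (-w) ^ (k + 1) := by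
  have := geom_sum_mul (-w) (k + 1)
  linear_combination -this

theorem one_add_sq_mul_sum_succ_mul_neg_pow (w : ℝ) (k : ℕ) :
    (1 + w) ^ 2 * ∑ j ∈ range (k + 1), ((j : ℝ) + 1) * (-w) ^ j =
      1 - (-w) ^ (k + 1) * ((k + 2) + (k + 1) * w) := by
  induction k with
  | zero => simp; ring
  | succ k ih =>
    rw [sum_range_succ, mul_add, ih]
    push_cast
    ring

theorem abs_inv_one_add_pow_sub_le {i : ℕ} (hi : i = 1 ∨ i = 2) {w : ℝ} (hw : 0 ≤ w) (k : ℕ) :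
    |1 / (1 + w) ^ i - ∑ j ∈ range (k + 1), ((j : ℝ) + 1) ^ (i - 1) * (-w) ^ j| ≤
      (k + 2) * w ^ (k + 1) := by
  have h1 : (0 : ℝ) < 1 + w := by linarith
  have hk : (0 : ℝ) ≤ k := Nat.cast_nonneg k
  rcases hi with rfl | rfl
  · have h := one_add_mul_sum_neg_pow w k
    have : 1 / (1 + w) ^ 1 - ∑ j ∈ range (k + 1), ((j : ℝ) + 1) ^ (1 - 1) * (-w) ^ j =
        (-w) ^ (k + 1) / (1 + w) := by
      simp only [Nat.sub_self, pow_zero, one_mul, pow_one]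
      rw [eq_div_iff h1.ne', sub_mul, mul_comm (∑ j ∈ range (k + 1), _), h]
      field_simp
      ring
    rw [this, abs_div, abs_pow, abs_neg, abs_of_nonneg hw, abs_of_pos h1, div_le_iff₀ h1]
    have := pow_nonneg hw (k + 1)
    nlinarith [mul_nonneg this hk, mul_nonneg (mul_nonneg this hk) hw, mul_nonneg this hw]
  · have h := one_add_sq_mul_sum_succ_mul_neg_pow w k
    have : 1 / (1 + w) ^ 2 - ∑ j ∈ range (k + 1), ((j : ℝ) + 1) ^ (2 - 1) * (-w) ^ j =
        (-w) ^ (k + 1) * ((k + 2) + (k + 1) * w) / (1 + w) ^ 2 := by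
      simp only [Nat.reduceSub, pow_one]
      rw [eq_div_iff (by positivity), sub_mul, mul_comm (∑ j ∈ range (k + 1), _), h]
      field_simp
      ring
    rw [this, abs_div, abs_mul, abs_pow, abs_neg, abs_of_nonneg hw,
      abs_of_pos (a := (1 + w) ^ 2) (by positivity), div_le_iff₀ (by positivity),
      abs_of_nonneg (a := (k : ℝ) + 2 + (k + 1) * w) (by positivity), mul_comm ((k : ℝ) + 2),
      mul_assoc]
    gcongr
    nlinarith [mul_nonneg hk hw, mul_nonneg (mul_nonneg hk hw) hw, mul_nonneg hw hw]

theorem exists_norm_sum_e_div_pow_le : ∃ C : ℝ, 1 ≤ C ∧ ∀ (q i : ℕ) (x y lK : ℝ) (A B : ℤ),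
    i = 1 ∨ i = 2 → 1 ≤ q → (q : ℝ) ^ 2 ≤ lK → 2 ^ 20 * lK ^ 2 ≤ x → x ≤ Real.exp lK →
    x ^ (20 * q) ≤ |y| / (x ^ 20) ^ i * x ^ 2 → |y| / (x ^ 20) ^ i ≤ x ^ (20 * q + 18) →
    (#(Icc A B) : ℝ) ≤ x ^ 20 → (∀ b ∈ Icc A B, x ^ 20 ≤ b ∧ (b : ℝ) ≤ 2 * x ^ 20) →
    ‖∑ n ∈ Icc A B, e (y / (n : ℝ) ^ i)‖ ≤ C * x ^ 20 * x ^ (-(1 / (10 ^ 8 * (q : ℝ) ^ 2))) := by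
  obtain ⟨C, hC, H⟩ := exists_norm_sum_e_le_of_taylor
  refine ⟨C, hC, fun q i x y lK A B hi hq hqK hKx hxK hY1 hY2 hcard hb => ?_⟩
  have hq' : (1 : ℝ) ≤ q := by exact_mod_cast hq
  have hlK : 1 ≤ lK := le_trans (one_le_pow₀ hq') hqK
  have hx : (2 : ℝ) ^ 20 ≤ x := by nlinarith
  have hx1 : (1 : ℝ) ≤ x := le_trans (by norm_num) hx
  have hx0 : (0 : ℝ) < x := by linarith
  have hqx : (10 * q + 4 : ℝ) ≤ x := by nlinarith
  have hi2 : i ≤ 2 := by omega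
  have hij : ∀ j : ℕ, ((j : ℝ) + 1) ^ (i - 1) ≤ j + 1 := by
    intro j
    rcases hi with rfl | rfl <;> simp
  have hij' : ∀ j : ℕ, 1 ≤ ((j : ℝ) + 1) ^ (i - 1) := fun j => one_le_pow₀ (by simp)
  set K : ℝ := x ^ 20 with hKdef
  have hK0 : 0 < K := by positivity
  refine H q x (|y| / K ^ i) lK _ (fun b j => y * ((-1) ^ j * ((j : ℝ) + 1) ^ (i - 1)) /
    (b : ℝ) ^ (j + i)) A B hq hqK hKx hxK hY1 hY2 hcard ?_ ?_ ?_
  · intro b hbI j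
    obtain ⟨hb1, hb2⟩ := hb b hbI
    have hb0 : (0 : ℝ) < b := by linarith
    simp only [abs_div, abs_mul, abs_pow, abs_neg, abs_one, one_pow, one_mul, abs_of_pos hb0]
    rw [abs_of_pos (a := (j : ℝ) + 1) (by positivity), div_le_iff₀ (by positivity)]
    have h4 : (b : ℝ) ^ i ≤ 4 * K ^ i := by
      calc (b : ℝ) ^ i ≤ (2 * K) ^ i := by gcongr
        _ = 2 ^ i * K ^ i := mul_pow ..
        _ ≤ 2 ^ 2 * K ^ i := by gcongr; norm_num
        _ = _ := by norm_num
    have h5 : (b : ℝ) ^ j ≤ (2 * K) ^ j := by gcongr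
    have : (b : ℝ) ^ (j + i) ≤ 4 * (2 * K) ^ j * K ^ i := by
      rw [pow_add]
      calc (b : ℝ) ^ j * b ^ i ≤ (2 * K) ^ j * (4 * K ^ i) := by gcongr
        _ = _ := by ring
    calc |y| = |y| * 1 / (b : ℝ) ^ (j + i) * b ^ (j + i) := by field_simp
      _ ≤ |y| * ((j : ℝ) + 1) ^ (i - 1) / (b : ℝ) ^ (j + i) * (4 * (2 * K) ^ j * K ^ i) := by
          gcongr
          exact hij' j
      _ = _ := by ring
  · intro b hbI j
    obtain ⟨hb1, hb2⟩ := hb b hbI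
    have hb0 : (0 : ℝ) < b := by linarith
    simp only [abs_div, abs_mul, abs_pow, abs_neg, abs_one, one_pow, one_mul, abs_of_pos hb0]
    rw [abs_of_pos (a := (j : ℝ) + 1) (by positivity)]
    calc |y| * ((j : ℝ) + 1) ^ (i - 1) / (b : ℝ) ^ (j + i) * K ^ j
        ≤ |y| * ((j : ℝ) + 1) / K ^ (j + i) * K ^ j := by
          gcongr
          exact hij j
      _ = _ := by rw [pow_add]; field_simp
  · intro b hbI z hz0 hzx
    obtain ⟨hb1, hb2⟩ := hb b hbI
    have hb0 : (0 : ℝ) < b := by linarith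
    have hz0' : (0 : ℝ) ≤ z := by exact_mod_cast hz0
    have hw0 : (0 : ℝ) ≤ z / b := by positivity
    have hsum : (∑ j ∈ range (10 * q + 2 + 1), ((j : ℝ) + 1) ^ (i - 1) * (-(z / b : ℝ)) ^ j) *
        (y / (b : ℝ) ^ i) = y * ((-1) ^ 0 * (((0 : ℕ) : ℝ) + 1) ^ (i - 1)) / (b : ℝ) ^ (0 + i) +
        ∑ j : Fin (10 * q + 2), y * ((-1) ^ ((j : ℕ) + 1) * ((((j : ℕ) + 1 : ℕ) : ℝ) + 1) ^ (i - 1)) /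
          (b : ℝ) ^ ((j : ℕ) + 1 + i) * (z : ℝ) ^ ((j : ℕ) + 1) := by
      rw [Fin.sum_univ_eq_sum_range (fun j => y * ((-1) ^ (j + 1) *
        (((j + 1 : ℕ) : ℝ) + 1) ^ (i - 1)) / (b : ℝ) ^ (j + 1 + i) * (z : ℝ) ^ (j + 1)),
        sum_range_succ', add_mul, add_comm, sum_mul]
      congr 1
      · simp
      · refine sum_congr rfl fun j _ => ?_
        rw [← neg_one_mul ((z : ℝ) / b), mul_pow, div_pow, pow_add (b : ℝ) (j + 1) i]
        field_simp
    have hmain : y / ((b + z : ℤ) : ℝ) ^ i = 1 / (1 + (z / b : ℝ)) ^ i * (y / (b : ℝ) ^ i) := by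
      have : (1 + (z / b : ℝ)) = ((b + z : ℤ) : ℝ) / b := by push_cast; field_simp
      rw [this, div_pow]
      have : ((b + z : ℤ) : ℝ) ≠ 0 := by push_cast; positivity
      field_simp
    rw [hmain, ← hsum, ← sub_mul, abs_mul]
    have hT := abs_inv_one_add_pow_sub_le hi hw0 (10 * q + 2)
    have hw : (z / b : ℝ) ≤ 1 / x ^ 4 := by
      rw [div_le_div_iff₀ hb0 (by positivity), one_mul]
      calc (z : ℝ) * x ^ 4 ≤ x ^ 16 * x ^ 4 := by gcongr
        _ = K := by rw [hKdef]; ring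
        _ ≤ b := hb1
    have hyb : |y / (b : ℝ) ^ i| ≤ |y| / K ^ i := by
      rw [abs_div, abs_of_pos (a := (b : ℝ) ^ i) (by positivity)]
      gcongr
    calc _ ≤ (((10 * q + 2 : ℕ) : ℝ) + 2) * (1 / x ^ 4) ^ (10 * q + 2 + 1) * x ^ (20 * q + 18) := by
          refine mul_le_mul (hT.trans ?_) (hyb.trans hY2) (abs_nonneg _) (by positivity)
          gcongr
      _ = (10 * q + 4) * x ^ (20 * q + 18) / (x ^ (20 * q + 18) * x ^ (20 * q - 6)) := by
          rw [← pow_add, one_div, inv_pow, ← pow_mul]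
          push_cast
          rw [show 20 * q + 18 + (20 * q - 6) = 4 * (10 * q + 2 + 1) by omega]
          ring
      _ = (10 * q + 4) / x ^ (20 * q - 6) := by field_simp
      _ ≤ x / x ^ 2 := by
          gcongr ?_ / ?_
          exact pow_le_pow_right₀ hx1 (by omega)
      _ = 1 / x := by field_simp

open Filter in
theorem eventually_mul_pow_le_exp_rpow (C : ℝ) (B : ℕ) {c a : ℝ} (hc : 0 < c) (ha : 0 < a) :
    ∀ᶠ L : ℝ in atTop, C * L ^ B ≤ Real.exp (c * L ^ a) := by
  have h1 := (isLittleO_rpow_exp_pos_mul_atTop ((B : ℝ) / a) hc).comp_tendsto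
    (tendsto_rpow_atTop ha)
  have h2 := h1.bound (c := 1 / (|C| + 1)) (by positivity)
  filter_upwards [h2, eventually_gt_atTop 0] with L hL hL0
  simp only [Function.comp_apply, Real.norm_eq_abs, Real.abs_exp] at hL
  rw [← Real.rpow_mul hL0.le, mul_div_cancel₀ _ ha.ne', Real.rpow_natCast, abs_of_pos (by positivity),
    one_div, inv_mul_eq_div, le_div_iff₀ (by positivity)] at hL
  calc C * L ^ B ≤ (|C| + 1) * L ^ B := by gcongr; linarith [le_abs_self C]
    _ ≤ _ := by linarith

open Filter in
theorem eventually_norm_sum_e_div_pow_le {ε : ℝ} (hε : 0 < ε) (R : ℕ) :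
    ∀ᶠ K : ℕ in atTop, ∀ (i : ℕ) (y : ℝ) (A B : ℤ), i = 1 ∨ i = 2 → (K : ℤ) < A → B ≤ 2 * K →
      (K : ℝ) ^ ((9 : ℝ) / 10) * (K : ℝ) ^ i ≤ |y| →
      Real.log |y| ≤ Real.log K ^ (3 / 2 - ε) →
      ‖∑ n ∈ Icc A B, e (y / (n : ℝ) ^ i)‖ ≤ K / Real.log K ^ R := by
  obtain ⟨C, hC, H⟩ := exists_norm_sum_e_div_pow_le
  have hlog : Tendsto (fun K : ℕ => Real.log K) atTop atTop :=
    Real.tendsto_log_atTop.comp tendsto_natCast_atTop_atTop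
  have e1 := hlog.eventually (eventually_mul_pow_le_exp_rpow (2 ^ 20) 2 (c := 1 / 20) (a := 1)
    (by norm_num) (by norm_num))
  have e2 := hlog.eventually (eventually_mul_pow_le_exp_rpow C R (c := 1 / (2 * 10 ^ 9))
    (a := 2 * ε) (by norm_num) (by positivity))
  have e3 := hlog.eventually (eventually_ge_atTop 1)
  filter_upwards [e1, e2, e3, eventually_ge_atTop 1] with K h1 h2 hL1 hK1 i y A B hi hA hB hy hly
  set L := Real.log K with hLdef
  have hK : (0 : ℝ) < K := by exact_mod_cast hK1
  have hL0 : 0 < L := by linarith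
  have hKL : (K : ℝ) = Real.exp L := (Real.exp_log hK).symm
  set x := Real.exp (L / 20) with hxdef
  have hx0 : 0 < x := Real.exp_pos _
  have hxp : ∀ n : ℕ, x ^ n = Real.exp (n * (L / 20)) := fun n => (Real.exp_nat_mul _ _).symm
  have hxK : x ^ 20 = K := by rw [hxp, hKL]; congr 1; push_cast; ring
  have hy0 : 0 < |y| := lt_of_lt_of_le (by positivity) hy
  set Y := |y| / (K : ℝ) ^ i with hY
  have hY0 : 0 < Y := by positivity
  have hlY : Real.log Y = Real.log |y| - i * L := by
    rw [hY, Real.log_div hy0.ne' (by positivity), Real.log_pow]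
  have hYl : (9 / 10) * L ≤ Real.log Y := by
    rw [hLdef, ← Real.log_rpow hK]
    exact Real.log_le_log (by positivity) ((le_div_iff₀ (by positivity)).2 hy)
  have hi1 : (1 : ℝ) ≤ i := by rcases hi with rfl | rfl <;> norm_num
  set q := ⌊(Real.log Y + L / 10) / L⌋₊ with hq
  have hq1 : 1 ≤ q := by
    rw [hq, Nat.one_le_floor_iff, le_div_iff₀ hL0]
    linarith
  have hqle : (q : ℝ) ≤ (Real.log Y + L / 10) / L :=
    Nat.floor_le (div_nonneg (by linarith) hL0.le)
  have hqlt : (Real.log Y + L / 10) / L < q + 1 := Nat.lt_floor_add_one _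
  rw [le_div_iff₀ hL0] at hqle
  rw [div_lt_iff₀ hL0] at hqlt
  have hq1' : (1 : ℝ) ≤ q := by exact_mod_cast hq1
  have hqL : (q : ℝ) ≤ L ^ (1 / 2 - ε) := by
    have : L ^ (3 / 2 - ε) = L ^ (1 / 2 - ε) * L := by
      rw [← Real.rpow_add_one hL0.ne']; congr 1; ring
    refine le_of_mul_le_mul_right ?_ hL0
    nlinarith
  have hq2 : (q : ℝ) ^ 2 ≤ L ^ (1 - 2 * ε) := by
    calc (q : ℝ) ^ 2 ≤ (L ^ (1 / 2 - ε)) ^ 2 := by gcongr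
      _ = _ := by rw [← Real.rpow_mul_natCast hL0.le]; congr 1; push_cast; ring
  have hq3 : (q : ℝ) ^ 2 ≤ L := hq2.trans (by
    calc L ^ (1 - 2 * ε) ≤ L ^ (1 : ℝ) := Real.rpow_le_rpow_of_exponent_le hL1 (by linarith)
      _ = L := Real.rpow_one L)
  have hYexp : Y = Real.exp (Real.log Y) := (Real.exp_log hY0).symm
  have hcardZ : #(Icc A B) ≤ K := by rw [Int.card_Icc]; omega
  have key := H q i x y L A B hi hq1 hq3 (h1.trans (by rw [hxdef, Real.rpow_one]; apply le_of_eq; congr 1; ring))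
    (Real.exp_le_exp.2 (by linarith)) ?_ ?_ (by rw [hxK]; exact_mod_cast hcardZ) ?_
  · refine key.trans ?_
    rw [hxK, le_div_iff₀ (by positivity)]
    have hsave : x ^ (-(1 / (10 ^ 8 * (q : ℝ) ^ 2))) ≤ Real.exp (-(1 / (2 * 10 ^ 9) * L ^ (2 * ε))) := by
      rw [hxdef, ← Real.exp_mul, Real.exp_le_exp]
      have : L ^ (2 * ε) * (q : ℝ) ^ 2 ≤ L := by
        calc L ^ (2 * ε) * (q : ℝ) ^ 2 ≤ L ^ (2 * ε) * L ^ (1 - 2 * ε) := by gcongr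
          _ = L := by rw [← Real.rpow_add hL0]; simp
      rw [mul_neg, neg_le_neg_iff]
      have hq0 : (0 : ℝ) < (q : ℝ) ^ 2 := by positivity
      rw [← le_div_iff₀ hq0] at this
      calc 1 / (2 * 10 ^ 9) * L ^ (2 * ε) ≤ 1 / (2 * 10 ^ 9) * (L / (q : ℝ) ^ 2) := by gcongr
        _ = _ := by field_simp; norm_num
    calc C * K * x ^ (-(1 / (10 ^ 8 * (q : ℝ) ^ 2))) * L ^ R
        ≤ C * K * Real.exp (-(1 / (2 * 10 ^ 9) * L ^ (2 * ε))) * L ^ R := by gcongr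
      _ = K * (C * L ^ R * Real.exp (-(1 / (2 * 10 ^ 9) * L ^ (2 * ε)))) := by ring
      _ ≤ K * 1 := by
          gcongr
          rw [Real.exp_neg, ← div_eq_mul_inv]
          exact div_le_one_of_le₀ h2 (Real.exp_pos _).le
      _ = K := mul_one _
  · rw [hxK, ← hY, hYexp, hxp, hxp, ← Real.exp_add, Real.exp_le_exp]
    push_cast
    linarith
  · rw [hxK, ← hY, hYexp, hxp, Real.exp_le_exp]
    push_cast
    linarith
  · intro b hb
    rw [mem_Icc] at hb
    rw [hxK]
    have hb1 : (K : ℤ) ≤ b := by omega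
    have hb2 : b ≤ 2 * (K : ℤ) := by omega
    exact ⟨by exact_mod_cast hb1, by exact_mod_cast hb2⟩

theorem norm_sum_mul_sub_le (c g : ℕ → ℂ) (V : ℕ → ℝ) (hg : ∀ i, ‖g i‖ ≤ 1) (h0 : ‖c 0‖ ≤ V 0)
    (N : ℕ) (hV : ∀ i, i < N → ‖c i - c (i + 1)‖ ≤ V (i + 1) - V i) :
    ‖∑ i ∈ range (N + 1), c i * (g (i + 1) - g i) - c N * g (N + 1)‖ ≤ V N := by
  induction N with
  | zero =>
    have : ∑ i ∈ range (0 + 1), c i * (g (i + 1) - g i) - c 0 * g (0 + 1) = -(c 0 * g 0) := by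
      simp; ring
    rw [this, norm_neg, norm_mul]
    exact (mul_le_of_le_one_right (norm_nonneg _) (hg 0)).trans h0
  | succ N ih =>
    have : ∑ i ∈ range (N + 1 + 1), c i * (g (i + 1) - g i) - c (N + 1) * g (N + 1 + 1) =
        (∑ i ∈ range (N + 1), c i * (g (i + 1) - g i) - c N * g (N + 1)) +
          (c N - c (N + 1)) * g (N + 1) := by
      rw [sum_range_succ]; ring
    rw [this]
    refine (norm_add_le _ _).trans ?_
    have h1 := ih fun i hi => hV i (by omega)
    have h2 : ‖(c N - c (N + 1)) * g (N + 1)‖ ≤ V (N + 1) - V N := by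
      rw [norm_mul]
      exact (mul_le_of_le_one_right (norm_nonneg _) (hg _)).trans (hV N (by omega))
    linarith

/-- A case of the Kusmin–Landau inequality. -/
theorem norm_sum_e_div_le_of_le_sq {K : ℕ} (hK : 1 ≤ K) {y : ℝ} (hy0 : y ≠ 0)
    (hy : |y| ≤ (K : ℝ) ^ 2 / 2) {A B : ℤ} (hA : (K : ℤ) < A) (hB : B ≤ 2 * K) :
    ‖∑ n ∈ Icc A B, e (y / (n : ℝ))‖ ≤ 8 * (K : ℝ) ^ 2 / |y| := by
  have hya : 0 < |y| := abs_pos.2 hy0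
  rcases lt_or_ge B A with hAB | hAB
  · rw [Icc_eq_empty (by simpa using hAB)]
    simp only [sum_empty, norm_zero]
    positivity
  have hKr : (1 : ℝ) ≤ K := by exact_mod_cast hK
  set a : ℝ := (A : ℝ) with ha
  have haK : (K : ℝ) + 1 ≤ a := by rw [ha]; exact_mod_cast hA
  rw [sum_int_Icc_eq]
  obtain ⟨N, hN⟩ : ∃ N : ℕ, (B + 1 - A).toNat = N + 1 := ⟨(B - A).toNat, by omega⟩
  have hNB : a + N = B := by
    have : A + N = B := by omega
    rw [ha]; exact_mod_cast this
  have hB' : (B : ℝ) ≤ 2 * K := by exact_mod_cast hB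
  rw [hN]
  set δ : ℕ → ℝ := fun i => -y / ((a + i) * (a + i + 1)) with hδ
  set g : ℕ → ℂ := fun i => e (y / (a + i)) with hg
  set c : ℕ → ℂ := fun i => 1 / (e (δ i) - 1) with hc
  have hai : ∀ i : ℕ, (K : ℝ) < a + i := fun i => by
    have : (0 : ℝ) ≤ i := Nat.cast_nonneg i
    linarith
  have hai0 : ∀ i : ℕ, 0 < a + i := fun i => by linarith [hai i]
  have hδabs : ∀ i, |δ i| = |y| / ((a + i) * (a + i + 1)) := fun i => by
    have := hai0 i
    rw [hδ]
    simp only [abs_div, abs_neg]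
    rw [abs_of_pos (a := (a + i) * (a + i + 1)) (by positivity)]
  have hδpos : ∀ i, 0 < |δ i| := fun i => by
    have := hai0 i
    rw [hδabs]; positivity
  have hδhalf : ∀ i, |δ i| ≤ 1 / 2 := fun i => by
    have := hai0 i
    have := hai i
    rw [hδabs, div_le_iff₀ (by positivity)]
    nlinarith
  have hlow : ∀ i, 4 * |δ i| ≤ ‖e (δ i) - 1‖ := fun i => four_mul_abs_le_norm_e_sub_one (hδhalf i)
  have hne : ∀ i, e (δ i) - 1 ≠ 0 := fun i => by
    have := hlow i
    have := hδpos i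
    rw [← norm_pos_iff]
    linarith
  have hgc : ∀ i, g i = c i * (g (i + 1) - g i) := fun i => by
    have : g (i + 1) = g i * e (δ i) := by
      rw [hg, hδ]
      simp only
      rw [← e_add]
      have h0 := hai0 i
      congr 1
      push_cast
      rw [← add_assoc]
      generalize a + (i : ℝ) = s at h0 ⊢
      field_simp
      ring
    rw [this, hc]
    have := hne i
    field_simp
  set V : ℕ → ℝ := fun i => Real.pi / 8 * ((a + i) * (a + i + 1)) / |y| with hV
  have hcV : ∀ i, ‖c i‖ ≤ V i := fun i => by
    have h0 := hδpos i
    have := hai0 i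
    rw [hc]
    simp only [norm_div, norm_one]
    calc 1 / ‖e (δ i) - 1‖ ≤ 1 / (4 * |δ i|) := by
          have := hlow i
          gcongr
      _ = 2 / 8 * ((a + i) * (a + i + 1)) / |y| := by rw [hδabs]; field_simp; norm_num
      _ ≤ V i := by
          rw [hV]
          simp only
          gcongr
          exact Real.two_le_pi
  have hcd : ∀ i, ‖c i - c (i + 1)‖ ≤ V (i + 1) - V i := fun i => by
    have h0 := hδpos i
    have h0' := hδpos (i + 1)
    have h1 := hai0 i
    have : c i - c (i + 1) = (e (δ (i + 1)) - e (δ i)) / ((e (δ i) - 1) * (e (δ (i + 1)) - 1)) := by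
      rw [hc]
      have := hne i
      have := hne (i + 1)
      field_simp
      ring
    rw [this, norm_div, norm_mul]
    have hdiff : |δ (i + 1) - δ i| = 2 * |y| / ((a + i) * (a + i + 1) * (a + i + 2)) := by
      have : δ (i + 1) - δ i = 2 * y / ((a + i) * (a + i + 1) * (a + i + 2)) := by
        rw [hδ]
        push_cast
        rw [← add_assoc]
        generalize a + (i : ℝ) = s at h1 ⊢
        field_simp
        ring
      rw [this, abs_div, abs_mul, abs_two, abs_of_pos (a := (a + i) * (a + i + 1) * (a + i + 2))
        (by positivity)]
    calc ‖e (δ (i + 1)) - e (δ i)‖ / (‖e (δ i) - 1‖ * ‖e (δ (i + 1)) - 1‖)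
        ≤ (2 * Real.pi * |δ (i + 1) - δ i|) / ((4 * |δ i|) * (4 * |δ (i + 1)|)) := by
          have := hlow i
          have := hlow (i + 1)
          have := norm_e_sub_e_le (δ (i + 1)) (δ i)
          gcongr
      _ = V (i + 1) - V i := by
          rw [hdiff, hδabs, hδabs, hV]
          push_cast
          rw [← add_assoc]
          generalize a + (i : ℝ) = s at h1 ⊢
          field_simp
          ring
  have key := norm_sum_mul_sub_le c g V (fun i => by rw [hg]; simp [norm_e]) (hcV 0) N
    (fun i _ => hcd i)
  have hsum : ∑ i ∈ range (N + 1), e (y / ((A + (i : ℤ) : ℤ) : ℝ)) =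
      ∑ i ∈ range (N + 1), c i * (g (i + 1) - g i) := by
    refine sum_congr rfl fun i _ => ?_
    rw [← hgc i, hg]
    simp [ha]
  rw [hsum]
  have htri : ‖∑ i ∈ range (N + 1), c i * (g (i + 1) - g i)‖ ≤ V N + V N := by
    have h1 : ‖c N * g (N + 1)‖ ≤ V N := by
      rw [norm_mul, hg]
      simp only [norm_e, mul_one]
      exact hcV N
    calc _ = ‖(∑ i ∈ range (N + 1), c i * (g (i + 1) - g i) - c N * g (N + 1)) +
          c N * g (N + 1)‖ := by rw [sub_add_cancel]
      _ ≤ _ := (norm_add_le _ _).trans (add_le_add key h1)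
  refine htri.trans ?_
  rw [hV]
  simp only [hNB]
  rw [← add_div]
  gcongr
  have hpi := Real.pi_le_four
  have hB0 : (0 : ℝ) ≤ B := by rw [← hNB]; exact (hai0 N).le
  have : (B : ℝ) * (B + 1) ≤ 2 * K * (2 * K + 1) := by gcongr
  have hBB : (0 : ℝ) ≤ B * (B + 1) := by positivity
  nlinarith

theorem norm_sum_Icc_le_add (f : ℤ → ℂ) (A B c : ℤ) :
    ‖∑ n ∈ Icc A B, f n‖ ≤ ‖∑ n ∈ Icc A (min B c), f n‖ + ‖∑ n ∈ Icc (max A (c + 1)) B, f n‖ := by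
  rw [← sum_filter_add_sum_filter_not (Icc A B) (fun n => n ≤ c)]
  have h1 : (Icc A B).filter (fun n => n ≤ c) = Icc A (min B c) := by
    ext n; simp only [mem_filter, mem_Icc, le_min_iff]; tauto
  have h2 : (Icc A B).filter (fun n => ¬ n ≤ c) = Icc (max A (c + 1)) B := by
    ext n; simp only [mem_filter, mem_Icc, max_le_iff]; omega
  rw [h1, h2]
  exact norm_add_le _ _

theorem norm_sum_Ioc_le_of_dyadic (f : ℕ → ℂ) (F : ℤ → ℂ) (hF : ∀ n : ℕ, F n = f n) (K : ℕ) (M : ℝ)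
    (h : ∀ j < 4, ∀ A B : ℤ, ((2 ^ j * K : ℕ) : ℤ) < A → B ≤ 2 * (2 ^ j * K : ℕ) →
      ‖∑ n ∈ Icc A B, F n‖ ≤ M) (A B : ℕ) (hA : K ≤ A) (hB : B ≤ 16 * K) :
    ‖∑ n ∈ Ioc A B, f n‖ ≤ 4 * M := by
  have hcast : ∑ n ∈ Ioc A B, f n = ∑ n ∈ Icc ((A : ℤ) + 1) B, F n := by
    refine sum_nbij' (fun n => (n : ℤ)) (fun n => n.toNat) ?_ ?_ ?_ ?_ ?_
    · intro n hn; simp only [mem_Ioc, mem_Icc] at hn ⊢; omega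
    · intro n hn; simp only [mem_Ioc, mem_Icc] at hn ⊢; omega
    · intro n hn; simp
    · intro n hn; simp only [mem_Icc] at hn; omega
    · intro n hn; rw [hF]
  rw [hcast]
  have h0 := h 0 (by norm_num) (A + 1) (min (min (min B (8 * K)) (4 * K)) (2 * K))
    (by push_cast; omega) (by push_cast; omega)
  have h1 := h 1 (by norm_num) (max (A + 1) (2 * K + 1)) (min (min B (8 * K)) (4 * K))
    (by push_cast; omega) (by push_cast; omega)
  have h2 := h 2 (by norm_num) (max (A + 1) (4 * K + 1)) (min B (8 * K))
    (by push_cast; omega) (by push_cast; omega)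
  have h3 := h 3 (by norm_num) (max (A + 1) (8 * K + 1)) B
    (by push_cast; omega) (by push_cast; omega)
  have a3 := norm_sum_Icc_le_add F (A + 1) B (8 * K)
  have a2 := norm_sum_Icc_le_add F (A + 1) (min B (8 * K)) (4 * K)
  have a1 := norm_sum_Icc_le_add F (A + 1) (min (min B (8 * K)) (4 * K)) (2 * K)
  linarith

open Filter

theorem eventually_norm_sum_Icc_e_div_le {ε : ℝ} (hε : 0 < ε) (R : ℕ) :
    ∀ᶠ K : ℕ in atTop, ∀ (y : ℝ) (A B : ℤ), (K : ℤ) < A → B ≤ 2 * K →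
      8 * (K * Real.log K ^ R) ≤ |y| → Real.log |y| ≤ Real.log K ^ (3 / 2 - ε) →
      ‖∑ n ∈ Icc A B, e (y / (n : ℝ))‖ ≤ K / Real.log K ^ R := by
  filter_upwards [eventually_norm_sum_e_div_pow_le hε R, eventually_ge_atTop (2 ^ 10)] with
    K h hK y A B hA hB hy hly
  have hKr : (2 : ℝ) ^ 10 ≤ K := by exact_mod_cast hK
  have hK0 : (0 : ℝ) < K := by linarith
  have hL : 0 < Real.log K := Real.log_pos (by linarith)
  have hy0 : 0 < |y| := lt_of_lt_of_le (by positivity) hy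
  rcases le_total |y| ((K : ℝ) ^ 2 / 2) with h2 | h2
  · refine (norm_sum_e_div_le_of_le_sq (by omega) (abs_pos.1 hy0) h2 hA hB).trans ?_
    rw [div_le_div_iff₀ hy0 (by positivity)]
    nlinarith
  · have := h 1 y A B (Or.inl rfl) hA hB ?_ hly
    · simpa using this
    · refine le_trans ?_ h2
      have h3 : (2 : ℝ) ≤ (K : ℝ) ^ ((1 : ℝ) / 10) := by
        calc (2 : ℝ) = ((2 : ℝ) ^ 10) ^ ((1 : ℝ) / 10) := by
              rw [← Real.rpow_natCast, ← Real.rpow_mul (by norm_num)]; norm_num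
          _ ≤ _ := by gcongr
      have h4 : (K : ℝ) ^ ((1 : ℝ) / 10) * (K : ℝ) ^ ((9 : ℝ) / 10) = K := by
        rw [← Real.rpow_add hK0]; norm_num
      have h5 : 0 < (K : ℝ) ^ ((9 : ℝ) / 10) := by positivity
      nlinarith [mul_le_mul_of_nonneg_right h3 h5.le]

theorem eventually_forall_dyadic {p : ℕ → Prop} (h : ∀ᶠ K in atTop, p K) :
    ∀ᶠ K : ℕ in atTop, ∀ j : ℕ, p (2 ^ j * K) := by
  obtain ⟨K₀, hK₀⟩ := eventually_atTop.1 h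
  filter_upwards [eventually_ge_atTop K₀] with K hK j
  exact hK₀ _ (hK.trans (Nat.le_mul_of_pos_left _ (by positivity)))

theorem log_two_pow_mul_le {K j : ℕ} (hK : 8 ≤ K) (hj : j < 4) :
    Real.log K ≤ Real.log (2 ^ j * K : ℕ) ∧ Real.log (2 ^ j * K : ℕ) ≤ 2 * Real.log K := by
  have hK' : (8 : ℝ) ≤ K := by exact_mod_cast hK
  have h1 : (1 : ℝ) ≤ 2 ^ j := one_le_pow₀ (by norm_num)
  have h2 : (2 : ℝ) ^ j ≤ 8 := by
    calc (2 : ℝ) ^ j ≤ 2 ^ 3 := pow_le_pow_right₀ (by norm_num) (by omega)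
      _ = 8 := by norm_num
  push_cast
  constructor
  · exact Real.log_le_log (by linarith) (by nlinarith)
  · rw [show 2 * Real.log K = Real.log ((K : ℝ) ^ 2) by rw [Real.log_pow]; norm_num]
    exact Real.log_le_log (by positivity) (by nlinarith)

theorem tendsto_log_natCast : Tendsto (fun K : ℕ => Real.log K) atTop atTop :=
  Real.tendsto_log_atTop.comp tendsto_natCast_atTop_atTop

theorem eventually_norm_sum_Ioc_e_div_le {ε : ℝ} (hε : 0 < ε) (hε1 : ε ≤ 1) (R : ℕ) :
    ∀ᶠ K : ℕ in atTop, ∀ (y : ℝ) (A B : ℕ), K ≤ A → B ≤ 16 * K →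
      K * Real.log K ^ (R + 2) ≤ |y| → Real.log |y| ≤ Real.log K ^ (3 / 2 - ε) →
      ‖∑ n ∈ Ioc A B, e (y / (n : ℝ))‖ ≤ K / Real.log K ^ R := by
  filter_upwards [eventually_forall_dyadic (eventually_norm_sum_Icc_e_div_le hε (R + 1)),
    eventually_ge_atTop 8, tendsto_log_natCast.eventually_ge_atTop (64 * 2 ^ (R + 1))] with
    K h hK hL y A B hA hB hy hly
  have hL64 : (64 : ℝ) ≤ Real.log K := le_trans (by norm_num; exact one_le_pow₀ (by norm_num)) hL
  have hL0 : 0 < Real.log K := by linarith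
  have hK0 : (0 : ℝ) < K := by exact_mod_cast (by omega : 0 < K)
  refine (norm_sum_Ioc_le_of_dyadic (fun n : ℕ => e (y / (n : ℝ))) (fun n : ℤ => e (y / (n : ℝ)))
    (fun n => by simp) K (8 * K / Real.log K ^ (R + 1)) ?_ A B hA hB).trans ?_
  · intro j hj A B hA hB
    obtain ⟨h1, h2⟩ := log_two_pow_mul_le hK hj
    have hj8 : ((2 ^ j * K : ℕ) : ℝ) ≤ 8 * K := by
      have : 2 ^ j * K ≤ 8 * K := Nat.mul_le_mul_right _ (by interval_cases j <;> norm_num)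
      exact_mod_cast this
    refine (h j y A B hA hB ?_ (hly.trans ?_)).trans ?_
    · refine le_trans ?_ hy
      calc 8 * (((2 ^ j * K : ℕ) : ℝ) * Real.log (2 ^ j * K : ℕ) ^ (R + 1))
          ≤ 8 * ((8 * K) * (2 * Real.log K) ^ (R + 1)) := by gcongr
        _ = K * (Real.log K ^ (R + 1) * (64 * 2 ^ (R + 1))) := by rw [mul_pow]; ring
        _ ≤ K * (Real.log K ^ (R + 1) * Real.log K) := by gcongr
        _ = _ := by ring
    · exact Real.rpow_le_rpow hL0.le h1 (by linarith)
    · gcongr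
  · rw [pow_succ, ← div_div, ← mul_div_assoc, div_le_iff₀ hL0, mul_div_assoc, ← mul_assoc,
      mul_comm]
    have : 0 ≤ (K : ℝ) / Real.log K ^ R := by positivity
    exact mul_le_mul_of_nonneg_left (by linarith) this

theorem eventually_norm_sum_Ioc_e_div_sq_le {ε : ℝ} (hε : 0 < ε) (hε1 : ε ≤ 1) (R : ℕ) :
    ∀ᶠ K : ℕ in atTop, ∀ (y : ℝ) (A B : ℕ), K ≤ A → B ≤ 16 * K →
      (K : ℝ) ^ ((59 : ℝ) / 20) ≤ |y| → Real.log |y| ≤ Real.log K ^ (3 / 2 - ε) →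
      ‖∑ n ∈ Ioc A B, e (y / (n : ℝ) ^ 2)‖ ≤ K / Real.log K ^ R := by
  filter_upwards [eventually_forall_dyadic (eventually_norm_sum_e_div_pow_le hε (R + 1)),
    eventually_ge_atTop 8, tendsto_log_natCast.eventually_ge_atTop 180] with
    K h hK hL y A B hA hB hy hly
  have hL0 : 0 < Real.log K := by linarith
  have hK0 : (0 : ℝ) < K := by exact_mod_cast (by omega : 0 < K)
  have hK512 : (512 : ℝ) ≤ (K : ℝ) ^ ((1 : ℝ) / 20) := by
    rw [Real.rpow_def_of_pos hK0]
    have : (9 : ℝ) ≤ Real.log K * (1 / 20) := by linarith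
    calc (512 : ℝ) = 2 ^ 9 := by norm_num
      _ ≤ Real.exp 1 ^ 9 := by gcongr; linarith [Real.add_one_le_exp 1]
      _ = Real.exp 9 := by rw [← Real.exp_nat_mul]; norm_num
      _ ≤ _ := Real.exp_le_exp.2 this
  refine (norm_sum_Ioc_le_of_dyadic (fun n : ℕ => e (y / (n : ℝ) ^ 2))
    (fun n : ℤ => e (y / (n : ℝ) ^ 2))
    (fun n => by simp) K (8 * K / Real.log K ^ (R + 1)) ?_ A B hA hB).trans ?_
  · intro j hj A B hA hB
    obtain ⟨h1, h2⟩ := log_two_pow_mul_le hK hj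
    have hj8 : ((2 ^ j * K : ℕ) : ℝ) ≤ 8 * K := by
      have : 2 ^ j * K ≤ 8 * K := Nat.mul_le_mul_right _ (by interval_cases j <;> norm_num)
      exact_mod_cast this
    refine (h j 2 y A B (Or.inr rfl) hA hB ?_ (hly.trans ?_)).trans ?_
    · refine le_trans ?_ hy
      calc ((2 ^ j * K : ℕ) : ℝ) ^ ((9 : ℝ) / 10) * ((2 ^ j * K : ℕ) : ℝ) ^ 2
          ≤ (8 * K) ^ ((9 : ℝ) / 10) * (8 * K) ^ 2 := by gcongr
        _ = 8 ^ ((9 : ℝ) / 10) * 8 ^ 2 * ((K : ℝ) ^ ((9 : ℝ) / 10) * (K : ℝ) ^ 2) := by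
            rw [Real.mul_rpow (by norm_num) hK0.le]; ring
        _ ≤ 8 ^ (1 : ℝ) * 8 ^ 2 * ((K : ℝ) ^ ((9 : ℝ) / 10) * (K : ℝ) ^ 2) := by
            gcongr <;> norm_num
        _ ≤ (K : ℝ) ^ ((1 : ℝ) / 20) * ((K : ℝ) ^ ((9 : ℝ) / 10) * (K : ℝ) ^ 2) := by
            gcongr; norm_num; exact hK512
        _ = (K : ℝ) ^ ((59 : ℝ) / 20) := by
            rw [← Real.rpow_natCast (K : ℝ) 2, ← Real.rpow_add hK0, ← Real.rpow_add hK0]; norm_num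
    · exact Real.rpow_le_rpow hL0.le h1 (by linarith)
    · gcongr
  · rw [pow_succ, ← div_div, ← mul_div_assoc, div_le_iff₀ hL0, mul_div_assoc, ← mul_assoc,
      mul_comm]
    have : 0 ≤ (K : ℝ) / Real.log K ^ R := by positivity
    exact mul_le_mul_of_nonneg_left (by linarith) this

end Vinogradov

/-! ### Vaughan's identity -/

section VaughanIdentity

open ArithmeticFunction

theorem sum_Ioc_mul_apply (a b : ArithmeticFunction ℝ) (F : ℕ → ℂ) (A B : ℕ) :
    ∑ n ∈ Ioc A B, (((a * b) n : ℝ) : ℂ) * F n =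
      ∑ d ∈ Ioc 0 B, ((a d : ℝ) : ℂ) * ∑ m ∈ Ioc (A / d) (B / d), ((b m : ℝ) : ℂ) * F (d * m) := by
  have h1 : ∀ n ∈ Ioc A B, (((a * b) n : ℝ) : ℂ) * F n = ∑ x ∈ n.divisorsAntidiagonal,
      ((a x.1 : ℝ) : ℂ) * (((b x.2 : ℝ) : ℂ) * F (x.1 * x.2)) := by
    intro n _
    rw [ArithmeticFunction.mul_apply, Complex.ofReal_sum, sum_mul]
    refine sum_congr rfl fun x hx => ?_
    rw [(Nat.mem_divisorsAntidiagonal.1 hx).1]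
    push_cast
    ring
  rw [sum_congr rfl h1]
  simp_rw [mul_sum]
  rw [sum_sigma', sum_sigma']
  refine sum_nbij' (fun x => ⟨x.2.1, x.2.2⟩) (fun x => ⟨x.1 * x.2, (x.1, x.2)⟩) ?_ ?_ ?_ ?_ ?_
  · rintro ⟨n, d, m⟩ h
    simp only [mem_sigma, mem_Ioc, Nat.mem_divisorsAntidiagonal] at h ⊢
    obtain ⟨⟨h1, h2⟩, rfl, h3⟩ := h
    have hd : 0 < d := Nat.pos_of_ne_zero (by rintro rfl; simp at h3)
    have hm : 0 < m := Nat.pos_of_ne_zero (by rintro rfl; simp at h3)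
    refine ⟨⟨hd, (Nat.le_mul_of_pos_right _ hm).trans h2⟩, ?_, ?_⟩
    · rw [Nat.div_lt_iff_lt_mul hd, mul_comm]; exact h1
    · rw [Nat.le_div_iff_mul_le hd, mul_comm]; exact h2
  · rintro ⟨d, m⟩ h
    simp only [mem_sigma, mem_Ioc, Nat.mem_divisorsAntidiagonal] at h ⊢
    obtain ⟨⟨hd, _⟩, h2, h3⟩ := h
    rw [Nat.div_lt_iff_lt_mul hd, mul_comm] at h2
    rw [Nat.le_div_iff_mul_le hd, mul_comm] at h3
    exact ⟨⟨h2, h3⟩, trivial, by omega⟩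
  · rintro ⟨n, d, m⟩ h
    simp only [mem_sigma, mem_Ioc, Nat.mem_divisorsAntidiagonal] at h
    obtain ⟨_, rfl, _⟩ := h
    rfl
  · rintro ⟨d, m⟩ h
    rfl
  · rintro ⟨n, d, m⟩ h
    rfl

/-- Restriction of an arithmetic function to `[1, U]`. -/
def low (U : ℕ) (a : ArithmeticFunction ℝ) : ArithmeticFunction ℝ :=
  ⟨fun n => if n ≤ U then a n else 0, by simp⟩

/-- Restriction of an arithmetic function to `(U, ∞)`. -/
def high (U : ℕ) (a : ArithmeticFunction ℝ) : ArithmeticFunction ℝ :=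
  ⟨fun n => if n ≤ U then 0 else a n, by simp⟩

theorem low_apply (U : ℕ) (a : ArithmeticFunction ℝ) (n : ℕ) :
    low U a n = if n ≤ U then a n else 0 := rfl

theorem high_apply (U : ℕ) (a : ArithmeticFunction ℝ) (n : ℕ) :
    high U a n = if n ≤ U then 0 else a n := rfl

theorem low_add_high (U : ℕ) (a : ArithmeticFunction ℝ) : low U a + high U a = a := by
  ext n
  rw [ArithmeticFunction.add_apply, low_apply, high_apply]
  split_ifs <;> simp

/-- The Möbius function as a real-valued arithmetic function. -/
def moebiusReal : ArithmeticFunction ℝ := ((moebius : ArithmeticFunction ℤ) : ArithmeticFunction ℝ)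

/-- The constant function one as a real-valued arithmetic function. -/
def zetaReal : ArithmeticFunction ℝ := ((zeta : ArithmeticFunction ℕ) : ArithmeticFunction ℝ)

theorem abs_moebiusReal_le (n : ℕ) : |moebiusReal n| ≤ 1 := by
  rw [moebiusReal, ArithmeticFunction.intCoe_apply]
  exact_mod_cast abs_moebius_le_one (n := n)

/-- Vaughan's identity. -/
theorem vonMangoldt_eq_vaughan (U V : ℕ) :
    vonMangoldt = low U vonMangoldt + low V moebiusReal * ArithmeticFunction.log -
      (low V moebiusReal * low U vonMangoldt) * zetaReal +
      high V moebiusReal * (high U vonMangoldt * zetaReal) := by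
  have h1 := low_add_high U vonMangoldt
  have h2 := low_add_high V moebiusReal
  have h3 : vonMangoldt * zetaReal = ArithmeticFunction.log := vonMangoldt_mul_zeta
  have h4 : moebiusReal * zetaReal = 1 := coe_moebius_mul_coe_zeta
  rw [← h3]
  linear_combination (low V moebiusReal * zetaReal - 1) * h1 -
    (high U vonMangoldt * zetaReal) * h2 - high U vonMangoldt * h4

theorem abs_low_mul_low_le (U V n : ℕ) :
    |(low V moebiusReal * low U vonMangoldt) n| ≤ Real.log n := by
  rw [ArithmeticFunction.mul_apply, ← vonMangoldt_sum, ← Nat.sum_divisorsAntidiagonal' (fun _ j => vonMangoldt j)]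
  refine (abs_sum_le_sum_abs _ _).trans (sum_le_sum fun x _ => ?_)
  rw [abs_mul, low_apply, low_apply]
  have h1 := abs_moebiusReal_le x.1
  have h2 : 0 ≤ vonMangoldt x.2 := vonMangoldt_nonneg
  split_ifs <;> simp [abs_of_nonneg h2, h2]
  nlinarith

theorem high_mul_zeta_nonneg (U n : ℕ) : 0 ≤ (high U vonMangoldt * zetaReal) n := by
  rw [zetaReal, coe_mul_zeta_apply]
  refine sum_nonneg fun i _ => ?_
  rw [high_apply]
  split_ifs
  exacts [le_rfl, vonMangoldt_nonneg]

theorem high_mul_zeta_le (U n : ℕ) : (high U vonMangoldt * zetaReal) n ≤ Real.log n := by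
  rw [zetaReal, coe_mul_zeta_apply, ← vonMangoldt_sum]
  refine sum_le_sum fun i _ => ?_
  rw [high_apply]
  split_ifs
  exacts [vonMangoldt_nonneg, le_rfl]

theorem high_mul_zeta_eq_zero {U n : ℕ} (h : n ≤ U) : (high U vonMangoldt * zetaReal) n = 0 := by
  rw [zetaReal, coe_mul_zeta_apply]
  refine sum_eq_zero fun i hi => ?_
  rw [high_apply, if_pos ((Nat.divisor_le hi).trans h)]

theorem low_mul_low_eq_zero {U V n : ℕ} (h : V * U < n) :
    (low V moebiusReal * low U vonMangoldt) n = 0 := by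
  rw [ArithmeticFunction.mul_apply]
  refine sum_eq_zero fun x hx => ?_
  rw [low_apply, low_apply]
  split_ifs with h1 h2
  · have := (Nat.mem_divisorsAntidiagonal.1 hx).1
    have := Nat.mul_le_mul h1 h2
    omega
  all_goals simp

theorem sum_vonMangoldt_eq (F : ℕ → ℂ) {U V A : ℕ} (B : ℕ) (hU : U ≤ A) :
    ∑ n ∈ Ioc A B, ((vonMangoldt n : ℝ) : ℂ) * F n =
      ∑ d ∈ Ioc 0 B, ((low V moebiusReal d : ℝ) : ℂ) *
        ∑ m ∈ Ioc (A / d) (B / d), ((Real.log m : ℝ) : ℂ) * F (d * m) -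
      ∑ d ∈ Ioc 0 B, (((low V moebiusReal * low U vonMangoldt) d : ℝ) : ℂ) *
        ∑ m ∈ Ioc (A / d) (B / d), F (d * m) +
      ∑ d ∈ Ioc 0 B, ((high V moebiusReal d : ℝ) : ℂ) *
        ∑ m ∈ Ioc (A / d) (B / d), (((high U vonMangoldt * zetaReal) m : ℝ) : ℂ) * F (d * m) := by
  rw [← sum_Ioc_mul_apply (high V moebiusReal)]
  have e1 := sum_Ioc_mul_apply (low V moebiusReal) ArithmeticFunction.log F A B
  have e2 := sum_Ioc_mul_apply (low V moebiusReal * low U vonMangoldt) zetaReal F A B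
  have e3 : ∀ d, ∑ m ∈ Ioc (A / d) (B / d), ((zetaReal m : ℝ) : ℂ) * F (d * m) =
      ∑ m ∈ Ioc (A / d) (B / d), F (d * m) := by
    intro d
    refine sum_congr rfl fun m hm => ?_
    have : m ≠ 0 := ((Nat.zero_le _).trans_lt (mem_Ioc.1 hm).1).ne'
    simp [zetaReal, this]
  simp_rw [e3] at e2
  simp only [log_apply] at e1
  rw [← e1, ← e2, ← sum_sub_distrib, ← sum_add_distrib]
  refine sum_congr rfl fun n hn => ?_
  have h0 : low U vonMangoldt n = 0 := by
    rw [low_apply, if_neg]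
    have := (mem_Ioc.1 hn).1
    omega
  rw [← sub_mul, ← add_mul, ← Complex.ofReal_sub, ← Complex.ofReal_add]
  congr 2
  have := DFunLike.congr_fun (vonMangoldt_eq_vaughan U V) n
  rw [this, ArithmeticFunction.add_apply, sub_eq_add_neg, ArithmeticFunction.add_apply,
    ArithmeticFunction.add_apply, h0, zero_add]
  rfl

end VaughanIdentity

/-! ### Type I and type II sums -/

section TypeSums

open ArithmeticFunction

theorem norm_sum_log_mul_le (z : ℕ → ℂ) (A B : ℕ) {M : ℝ} (hM : 0 ≤ M)
    (h : ∀ k ≤ B, ‖∑ m ∈ Ioc A k, z m‖ ≤ M) :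
    ‖∑ m ∈ Ioc A B, ((Real.log m : ℝ) : ℂ) * z m‖ ≤ 2 * Real.log B * M := by
  have hlog : ∀ n : ℕ, 0 ≤ Real.log n := fun n => Real.log_natCast_nonneg n
  rcases lt_or_ge B A with hAB | hAB
  · rw [Ioc_eq_empty (by omega)]
    simp only [sum_empty, norm_zero]
    have := hlog B
    positivity
  have key : ∀ k, A ≤ k → k ≤ B → ‖(Real.log k : ℝ) * ∑ m ∈ Ioc A k, z m -
      ∑ m ∈ Ioc A k, ((Real.log m : ℝ) : ℂ) * z m‖ ≤ M * (Real.log k - Real.log A) := by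
    intro k hk
    induction k, hk using Nat.le_induction with
    | base => intro _; simp
    | succ k hk ih =>
      intro hkB
      have hmono : Real.log k ≤ Real.log (k + 1 : ℕ) := by
        rcases Nat.eq_zero_or_pos k with rfl | hk0
        · simp
        · exact Real.log_le_log (by exact_mod_cast hk0) (by push_cast; linarith)
      have heq : (Real.log (k + 1 : ℕ) : ℝ) * ∑ m ∈ Ioc A (k + 1), z m -
          ∑ m ∈ Ioc A (k + 1), ((Real.log m : ℝ) : ℂ) * z m =
          ((Real.log k : ℝ) * ∑ m ∈ Ioc A k, z m - ∑ m ∈ Ioc A k, ((Real.log m : ℝ) : ℂ) * z m) +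
          ((Real.log (k + 1 : ℕ) - Real.log k : ℝ) : ℂ) * ∑ m ∈ Ioc A k, z m := by
        rw [sum_Ioc_succ_top hk, sum_Ioc_succ_top hk]
        push_cast
        ring
      rw [heq]
      refine (norm_add_le _ _).trans ?_
      rw [norm_mul, Complex.norm_real, Real.norm_eq_abs, abs_of_nonneg (by linarith)]
      have h1 := ih (by omega)
      have h2 := mul_le_mul_of_nonneg_left (h k (by omega))
        (by linarith : 0 ≤ Real.log (k + 1 : ℕ) - Real.log k)
      nlinarith
  have h1 := key B hAB le_rfl
  have h2 : ‖((Real.log B : ℝ) : ℂ) * ∑ m ∈ Ioc A B, z m‖ ≤ Real.log B * M := by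
    rw [norm_mul, Complex.norm_real, Real.norm_eq_abs, abs_of_nonneg (hlog B)]
    exact mul_le_mul_of_nonneg_left (h B le_rfl) (hlog B)
  have h3 := norm_sub_norm_le (∑ m ∈ Ioc A B, ((Real.log m : ℝ) : ℂ) * z m)
    (((Real.log B : ℝ) : ℂ) * ∑ m ∈ Ioc A B, z m)
  rw [norm_sub_rev] at h3
  have h4 := mul_nonneg hM (hlog A)
  linarith

theorem sum_Ioc_inv_le (D : ℕ) : ∑ d ∈ Ioc 0 D, (1 : ℝ) / d ≤ 1 + Real.log D := by
  have h1 := harmonic_le_one_add_log D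
  refine le_trans (le_of_eq ?_) h1
  rw [harmonic_eq_sum_Icc]
  push_cast
  refine sum_congr ?_ fun i _ => by rw [one_div]
  ext; simp [Nat.succ_le_iff]

theorem norm_sum_Ioc_mul_le (a : ℕ → ℝ) (I : ℕ → ℂ) (B D P : ℕ) {c η : ℝ} (hc : 0 ≤ c)
    (hη : 0 ≤ η) (ha : ∀ d, 1 ≤ d → d ≤ D → |a d| ≤ c) (ha0 : ∀ d, D < d → a d = 0)
    (hI : ∀ d, 1 ≤ d → d ≤ D → ‖I d‖ ≤ (P / d : ℝ) * η) :
    ‖∑ d ∈ Ioc 0 B, (a d : ℂ) * I d‖ ≤ c * η * P * (1 + Real.log D) := by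
  calc ‖∑ d ∈ Ioc 0 B, (a d : ℂ) * I d‖ ≤ ∑ d ∈ Ioc 0 B, ‖(a d : ℂ) * I d‖ := norm_sum_le _ _
    _ = ∑ d ∈ (Ioc 0 B).filter (· ≤ D), ‖(a d : ℂ) * I d‖ := by
        rw [sum_filter]
        refine sum_congr rfl fun d _ => ?_
        split_ifs with h
        · rfl
        · rw [ha0 d (by omega)]; simp
    _ ≤ ∑ d ∈ (Ioc 0 B).filter (· ≤ D), c * η * P * (1 / d) := by
        refine sum_le_sum fun d hd => ?_
        simp only [mem_filter, mem_Ioc] at hd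
        rw [norm_mul, Complex.norm_real, Real.norm_eq_abs]
        calc |a d| * ‖I d‖ ≤ c * ((P / d : ℝ) * η) :=
              mul_le_mul (ha d (by omega) hd.2) (hI d (by omega) hd.2) (norm_nonneg _) hc
          _ = _ := by ring
    _ ≤ ∑ d ∈ Ioc 0 D, c * η * P * (1 / d) := by
        refine sum_le_sum_of_subset_of_nonneg (fun d hd => ?_) (fun d _ _ => by positivity)
        simp only [mem_filter, mem_Ioc] at hd ⊢
        omega
    _ ≤ _ := by
        rw [← mul_sum]
        exact mul_le_mul_of_nonneg_left (sum_Ioc_inv_le D) (by positivity)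

theorem norm_type_one_le {P U : ℕ} {y η : ℝ} (hU : 1 ≤ U) (hη : 0 ≤ η) (hP : U * U ≤ P)
    (h : ∀ d, 1 ≤ d → d ≤ U * U → ∀ A B, P / d ≤ A → B ≤ 16 * (P / d) →
      ‖∑ m ∈ Ioc A B, e (y / d / (m : ℝ))‖ ≤ ((P / d : ℕ) : ℝ) * η) :
    ‖∑ d ∈ Ioc 0 (8 * P), ((low U moebiusReal d : ℝ) : ℂ) *
        ∑ m ∈ Ioc (P / d) (8 * P / d), ((Real.log m : ℝ) : ℂ) * e (y / ((d * m : ℕ) : ℝ)) -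
      ∑ d ∈ Ioc 0 (8 * P), (((low U moebiusReal * low U vonMangoldt) d : ℝ) : ℂ) *
        ∑ m ∈ Ioc (P / d) (8 * P / d), e (y / ((d * m : ℕ) : ℝ))‖ ≤
      3 * Real.log (8 * P : ℕ) * η * P * (1 + Real.log (8 * P : ℕ)) := by
  have hP1 : 1 ≤ P := le_trans (by nlinarith) hP
  set L := Real.log (8 * P : ℕ) with hL
  have hL0 : 0 ≤ L := Real.log_natCast_nonneg _
  have hrw : ∀ d m : ℕ, y / ((d * m : ℕ) : ℝ) = y / d / m := fun d m => by
    push_cast; rw [div_div]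
  simp_rw [hrw]
  have h8 : ∀ d, 1 ≤ d → d ≤ U * U → 8 * P / d ≤ 16 * (P / d) := by
    intro d hd hdU
    have h1 : 1 ≤ P / d := (Nat.one_le_div_iff hd).2 (hdU.trans hP)
    have h2 := Nat.lt_div_mul_add hd (a := P)
    rw [Nat.div_le_iff_le_mul_add_pred hd]
    nlinarith
  have hle : ∀ d : ℕ, ((P / d : ℕ) : ℝ) ≤ (P : ℝ) / d := fun d => Nat.cast_div_le
  have hlogle : ∀ n : ℕ, n ≤ 8 * P → Real.log n ≤ L := by
    intro n hn
    rcases Nat.eq_zero_or_pos n with rfl | hn0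
    · simpa using hL0
    · exact Real.log_le_log (by exact_mod_cast hn0) (by exact_mod_cast hn)
  have t1 := norm_sum_Ioc_mul_le (fun d => low U moebiusReal d)
    (fun d => ∑ m ∈ Ioc (P / d) (8 * P / d), ((Real.log m : ℝ) : ℂ) * e (y / d / m))
    (8 * P) U P (c := 1) (η := 2 * L * η) zero_le_one (by positivity) ?_ ?_ ?_
  · have t2 := norm_sum_Ioc_mul_le (fun d => (low U moebiusReal * low U vonMangoldt) d)
      (fun d => ∑ m ∈ Ioc (P / d) (8 * P / d), e (y / d / m))
      (8 * P) (U * U) P (c := L) (η := η) hL0 hη ?_ ?_ ?_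
    · refine (norm_sub_le _ _).trans ((add_le_add t1 t2).trans ?_)
      have l1 : Real.log U ≤ L := hlogle U (by nlinarith)
      have l2 : Real.log (U * U : ℕ) ≤ L := hlogle (U * U) (by omega)
      calc 1 * (2 * L * η) * P * (1 + Real.log U) + L * η * P * (1 + Real.log (U * U : ℕ))
          ≤ 1 * (2 * L * η) * P * (1 + L) + L * η * P * (1 + L) := by gcongr
        _ = _ := by ring
    · intro d hd1 hd
      exact (abs_low_mul_low_le U U d).trans (hlogle d (by omega))
    · intro d hd
      exact low_mul_low_eq_zero hd
    · intro d hd1 hd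
      refine (h d hd1 hd _ _ le_rfl (h8 d hd1 hd)).trans ?_
      gcongr
      exact hle d
  · intro d hd1 hd
    rw [low_apply]
    split_ifs
    exact abs_moebiusReal_le d
  · intro d hd
    rw [low_apply, if_neg (by omega)]
  · intro d hd1 hd
    have hdU : d ≤ U * U := by nlinarith
    refine (norm_sum_log_mul_le _ _ _ (M := (P / d : ℝ) * η) (by positivity) fun k hk => ?_).trans ?_
    · refine (h d hd1 hdU _ _ le_rfl (hk.trans (h8 d hd1 hdU))).trans ?_
      gcongr
      exact hle d
    · have : Real.log (8 * P / d : ℕ) ≤ L := hlogle _ (Nat.div_le_self _ _)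
      calc 2 * Real.log (8 * P / d : ℕ) * (P / d * η) ≤ 2 * L * (P / d * η) := by gcongr
        _ = _ := by ring

theorem norm_sum_mul_sq_le {ι : Type*} (s : Finset ι) (a : ι → ℝ) (z : ι → ℂ)
    (ha : ∀ i ∈ s, |a i| ≤ 1) : ‖∑ i ∈ s, (a i : ℂ) * z i‖ ^ 2 ≤ #s * ∑ i ∈ s, ‖z i‖ ^ 2 := by
  have h1 : ‖∑ i ∈ s, (a i : ℂ) * z i‖ ≤ ∑ i ∈ s, ‖z i‖ := by
    refine (norm_sum_le _ _).trans (sum_le_sum fun i hi => ?_)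
    rw [norm_mul, Complex.norm_real, Real.norm_eq_abs]
    exact mul_le_of_le_one_left (norm_nonneg _) (ha i hi)
  calc _ ≤ (∑ i ∈ s, ‖z i‖) ^ 2 := by gcongr
    _ ≤ _ := sq_sum_le_card_mul_sum_sq

theorem sum_norm_sq_le {ι κ : Type*} (s : Finset ι) (t : Finset κ) (g : κ → ℝ) (w : ι → κ → ℂ)
    {G : ℝ} (hg : ∀ l ∈ t, |g l| ≤ G) :
    ∑ b ∈ s, ‖∑ l ∈ t, (g l : ℂ) * w b l‖ ^ 2 ≤
      G ^ 2 * ∑ l ∈ t, ∑ l' ∈ t, ‖∑ b ∈ s, w b l * (starRingEnd ℂ) (w b l')‖ := by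
  have h1 : ((∑ b ∈ s, ‖∑ l ∈ t, (g l : ℂ) * w b l‖ ^ 2 : ℝ) : ℂ) =
      ∑ l ∈ t, ∑ l' ∈ t, (g l : ℂ) * g l' * ∑ b ∈ s, w b l * (starRingEnd ℂ) (w b l') := by
    push_cast
    simp_rw [← Complex.mul_conj', map_sum, map_mul, Complex.conj_ofReal, sum_mul_sum, mul_sum]
    rw [sum_comm]
    refine sum_congr rfl fun l _ => ?_
    rw [sum_comm]
    exact sum_congr rfl fun l' _ => sum_congr rfl fun b _ => by ring
  have h2 : (∑ b ∈ s, ‖∑ l ∈ t, (g l : ℂ) * w b l‖ ^ 2 : ℝ) =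
      ‖((∑ b ∈ s, ‖∑ l ∈ t, (g l : ℂ) * w b l‖ ^ 2 : ℝ) : ℂ)‖ := by
    rw [Complex.norm_real, Real.norm_eq_abs, abs_of_nonneg (by positivity)]
  rw [h2, h1, mul_sum]
  refine (norm_sum_le _ _).trans (sum_le_sum fun l hl => ?_)
  rw [mul_sum]
  refine (norm_sum_le _ _).trans (sum_le_sum fun l' hl' => ?_)
  rw [norm_mul, norm_mul, Complex.norm_real, Complex.norm_real, Real.norm_eq_abs, Real.norm_eq_abs,
    pow_two]
  have := hg l hl
  have := hg l' hl'
  have h0 : 0 ≤ G := (abs_nonneg _).trans this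
  gcongr

theorem norm_type_two_block_le {P U M Δ : ℕ} {y η G : ℝ} (a g : ℕ → ℝ) (ha : ∀ b, |a b| ≤ 1)
    (hg : ∀ l ≤ 8 * P, |g l| ≤ G) (hg0 : ∀ l ≤ U, g l = 0) (hη : 0 ≤ η) (hM : 1 ≤ M)
    (h : ∀ l l', U < l → U < l' → l ≤ 8 * P / M → l' ≤ 8 * P / M → (l + Δ ≤ l' ∨ l' + Δ ≤ l) →
      ∀ A B, M ≤ A → B ≤ 2 * M →
      ‖∑ b ∈ Ioc A B, e (y * (1 / l - 1 / l') / (b : ℝ))‖ ≤ M * η) :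
    ‖∑ b ∈ Ioc M (2 * M), ((a b : ℝ) : ℂ) *
        ∑ l ∈ Ioc (P / b) (8 * P / b), ((g l : ℝ) : ℂ) * e (y / ((b * l : ℕ) : ℝ))‖ ^ 2 ≤
      G ^ 2 * M ^ 2 * (((8 * P / M : ℕ) : ℝ) ^ 2 * η + ((8 * P / M : ℕ) : ℝ) * (2 * Δ)) := by
  set L := 8 * P / M with hL
  set w : ℕ → ℕ → ℂ := fun b l => if P < b * l ∧ b * l ≤ 8 * P then e (y / ((b * l : ℕ) : ℝ)) else 0
    with hw
  have hLP : L ≤ 8 * P := Nat.div_le_self _ _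
  have hinner : ∀ b ∈ Ioc M (2 * M), ∑ l ∈ Ioc (P / b) (8 * P / b),
      ((g l : ℝ) : ℂ) * e (y / ((b * l : ℕ) : ℝ)) = ∑ l ∈ Ioc U L, ((g l : ℝ) : ℂ) * w b l := by
    intro b hb
    rw [mem_Ioc] at hb
    have hb0 : 0 < b := by omega
    have hbL : 8 * P / b ≤ L := Nat.div_le_div_left (by omega) hM
    have e1 : ∑ l ∈ Ioc (P / b) (8 * P / b), ((g l : ℝ) : ℂ) * e (y / ((b * l : ℕ) : ℝ)) =
        ∑ l ∈ Ioc 0 L, ((g l : ℝ) : ℂ) * w b l := by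
      simp only [hw, mul_ite, mul_zero]
      rw [← sum_filter]
      refine sum_congr ?_ fun _ _ => rfl
      ext l
      simp only [mem_Ioc, mem_filter]
      rw [Nat.div_lt_iff_lt_mul hb0, Nat.le_div_iff_mul_le hb0, mul_comm l b]
      constructor
      · rintro ⟨h1, h2⟩
        refine ⟨⟨Nat.pos_of_ne_zero (by rintro rfl; simp at h1), ?_⟩, h1, h2⟩
        exact le_trans ((Nat.le_div_iff_mul_le hb0).2 (by rwa [mul_comm])) hbL
      · tauto
    rw [e1]
    symm
    refine sum_subset (fun l hl => ?_) fun l hl hl' => ?_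
    · simp only [mem_Ioc] at hl ⊢; omega
    · simp only [mem_Ioc] at hl hl'
      rw [hg0 l (by omega)]; simp
  rw [sum_congr rfl fun b hb => by rw [hinner b hb]]
  refine (norm_sum_mul_sq_le _ a _ fun b _ => ha b).trans ?_
  have hcard : #(Ioc M (2 * M)) = M := by rw [Nat.card_Ioc]; omega
  rw [hcard]
  have hGL : ∀ l ∈ Ioc U L, |g l| ≤ G := fun l hl => hg l ((mem_Ioc.1 hl).2.trans hLP)
  have hpair : ∀ l ∈ Ioc U L, ∀ l' ∈ Ioc U L,
      ‖∑ b ∈ Ioc M (2 * M), w b l * (starRingEnd ℂ) (w b l')‖ ≤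
        M * η + if l < l' + Δ ∧ l' < l + Δ then (M : ℝ) else 0 := by
    intro l hl l' hl'
    rw [mem_Ioc] at hl hl'
    have hw1 : ∀ b l, ‖w b l‖ ≤ 1 := by
      intro b l
      simp only [hw]
      split_ifs <;> simp [norm_e]
    by_cases hnear : l < l' + Δ ∧ l' < l + Δ
    · rw [if_pos hnear]
      refine (norm_sum_le _ _).trans ?_
      calc _ ≤ ∑ b ∈ Ioc M (2 * M), (1 : ℝ) := by
            refine sum_le_sum fun b _ => ?_
            rw [norm_mul, RCLike.norm_conj]
            exact mul_le_one₀ (hw1 b l) (norm_nonneg _) (hw1 b l')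
        _ = M := by rw [sum_const, hcard]; simp
        _ ≤ _ := by linarith [mul_nonneg (Nat.cast_nonneg (α := ℝ) M) hη]
    · rw [if_neg hnear, add_zero]
      have hl0 : 0 < l := by omega
      have hl0' : 0 < l' := by omega
      have heq : ∑ b ∈ Ioc M (2 * M), w b l * (starRingEnd ℂ) (w b l') =
          ∑ b ∈ Ioc (max M (max (P / l) (P / l'))) (min (2 * M) (min (8 * P / l) (8 * P / l'))),
            e (y * (1 / l - 1 / l') / (b : ℝ)) := by
        symm
        have hsub : Ioc (max M (max (P / l) (P / l')))
            (min (2 * M) (min (8 * P / l) (8 * P / l'))) ⊆ Ioc M (2 * M) := by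
          intro b; simp only [mem_Ioc, max_lt_iff, le_min_iff]; tauto
        rw [← sum_filter_of_ne (s := Ioc M (2 * M)) (p := fun b => b ∈
          Ioc (max M (max (P / l) (P / l'))) (min (2 * M) (min (8 * P / l) (8 * P / l'))))]
        · rw [filter_mem_eq_inter, inter_eq_right.2 hsub]
          refine sum_congr rfl fun b hb => ?_
          simp only [mem_Ioc, max_lt_iff, le_min_iff, Nat.div_lt_iff_lt_mul hl0,
            Nat.le_div_iff_mul_le hl0, Nat.div_lt_iff_lt_mul hl0', Nat.le_div_iff_mul_le hl0'] at hb
          simp only [hw]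
          rw [if_pos ⟨hb.1.2.1, hb.2.2.1⟩, if_pos ⟨hb.1.2.2, hb.2.2.2⟩, conj_e, ← e_add]
          have hb0 : (b : ℝ) ≠ 0 := by
            have : b ≠ 0 := by omega
            exact_mod_cast this
          have hl1 : (l : ℝ) ≠ 0 := by positivity
          have hl2 : (l' : ℝ) ≠ 0 := by positivity
          congr 1
          push_cast
          field_simp
          try ring
        · intro b hb hne
          simp only [mem_Ioc, max_lt_iff, le_min_iff, Nat.div_lt_iff_lt_mul hl0,
            Nat.le_div_iff_mul_le hl0, Nat.div_lt_iff_lt_mul hl0', Nat.le_div_iff_mul_le hl0'] at hb ⊢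
          simp only [hw] at hne
          by_cases c1 : P < b * l ∧ b * l ≤ 8 * P
          · by_cases c2 : P < b * l' ∧ b * l' ≤ 8 * P
            · exact ⟨⟨hb.1, c1.1, c2.1⟩, hb.2, c1.2, c2.2⟩
            · rw [if_neg c2] at hne; simp at hne
          · rw [if_neg c1] at hne; simp at hne
      rw [heq]
      exact h l l' hl.1 hl'.1 hl.2 hl'.2 (by omega) _ _ (le_max_left _ _) (min_le_left _ _)
  have hM0 : (0 : ℝ) ≤ M := Nat.cast_nonneg M
  have hcL : (#(Ioc U L) : ℝ) ≤ L := by rw [Nat.card_Ioc]; exact_mod_cast Nat.sub_le _ _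
  have hsum : ∑ l ∈ Ioc U L, ∑ l' ∈ Ioc U L,
      ‖∑ b ∈ Ioc M (2 * M), w b l * (starRingEnd ℂ) (w b l')‖ ≤
      L * (L * (M * η) + 2 * Δ * M) := by
    calc _ ≤ ∑ l ∈ Ioc U L, ((L : ℝ) * (M * η) + 2 * Δ * M) := by
          refine sum_le_sum fun l hl => ?_
          refine (sum_le_sum fun l' hl' => hpair l hl l' hl').trans ?_
          rw [sum_add_distrib, sum_const, nsmul_eq_mul, ← sum_filter, sum_const, nsmul_eq_mul]
          have hc2 : #((Ioc U L).filter fun l' => l < l' + Δ ∧ l' < l + Δ) ≤ 2 * Δ := by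
            calc _ ≤ #(Ico (l + 1 - Δ) (l + Δ)) := by
                  refine card_le_card fun l' hl' => ?_
                  simp only [mem_filter, mem_Ico] at hl' ⊢; omega
              _ ≤ _ := by rw [Nat.card_Ico]; omega
          have hc2' : (#((Ioc U L).filter fun l' => l < l' + Δ ∧ l' < l + Δ) : ℝ) ≤ 2 * Δ := by
            exact_mod_cast hc2
          gcongr
      _ = #(Ioc U L) * ((L : ℝ) * (M * η) + 2 * Δ * M) := by rw [sum_const, nsmul_eq_mul]
      _ ≤ _ := by gcongr
  calc (M : ℝ) * ∑ b ∈ Ioc M (2 * M), ‖∑ l ∈ Ioc U L, ((g l : ℝ) : ℂ) * w b l‖ ^ 2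
      ≤ M * (G ^ 2 * (L * (L * (M * η) + 2 * Δ * M))) := by
        gcongr
        exact (sum_norm_sq_le _ _ g w hGL).trans (by gcongr)
    _ = _ := by ring

end TypeSums

/-! ### Exponential sums over primes -/

section PrimeSums

open Filter ArithmeticFunction

theorem eventually_exists_cube_root (K₁ : ℕ) : ∀ᶠ P : ℕ in atTop, ∃ U : ℕ, K₁ ≤ U ∧ 1 ≤ U ∧
    U ^ 3 ≤ P ∧ Real.log P ≤ 4 * Real.log U ∧ Real.log P ^ 6 ≤ U := by
  have hU : Tendsto (fun P : ℕ => ⌊(P : ℝ) ^ ((1 : ℝ) / 3)⌋₊) atTop atTop :=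
    tendsto_nat_floor_atTop.comp
      ((tendsto_rpow_atTop (by norm_num)).comp tendsto_natCast_atTop_atTop)
  have h1 := hU.eventually (tendsto_log_natCast.eventually
    (eventually_mul_pow_le_exp_rpow (4 ^ 6) 6 (c := 1) (a := 1) one_pos one_pos))
  filter_upwards [h1, hU.eventually_ge_atTop (max K₁ 8), eventually_ge_atTop 1] with P h2 h3 hP
  set U := ⌊(P : ℝ) ^ ((1 : ℝ) / 3)⌋₊ with hUdef
  have hP0 : (0 : ℝ) < P := by exact_mod_cast hP
  have hU8 : 8 ≤ U := le_trans (le_max_right _ _) h3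
  have hU0 : (0 : ℝ) < U := by exact_mod_cast (by omega : 0 < U)
  have hcube : ((P : ℝ) ^ ((1 : ℝ) / 3)) ^ 3 = P := by
    rw [← Real.rpow_mul_natCast hP0.le]; norm_num
  have hle : (U : ℝ) ≤ (P : ℝ) ^ ((1 : ℝ) / 3) := Nat.floor_le (by positivity)
  have hlt : (P : ℝ) ^ ((1 : ℝ) / 3) < U + 1 := Nat.lt_floor_add_one _
  have hlog : Real.log P ≤ 4 * Real.log U := by
    have h8 : (8 : ℝ) ≤ U := by exact_mod_cast hU8
    rw [show 4 * Real.log U = Real.log ((U : ℝ) ^ 4) by rw [Real.log_pow]; norm_num]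
    refine Real.log_le_log hP0 ?_
    calc (P : ℝ) = ((P : ℝ) ^ ((1 : ℝ) / 3)) ^ 3 := hcube.symm
      _ ≤ (U + 1 : ℝ) ^ 3 := by gcongr
      _ ≤ (2 * U : ℝ) ^ 3 := by gcongr; linarith
      _ = 8 * (U : ℝ) ^ 3 := by ring
      _ ≤ U * (U : ℝ) ^ 3 := by gcongr
      _ = _ := by ring
  refine ⟨U, le_trans (le_max_left _ _) h3, by omega, ?_, hlog, ?_⟩
  · have : (U : ℝ) ^ 3 ≤ P := by rw [← hcube]; gcongr
    exact_mod_cast this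
  · calc Real.log P ^ 6 ≤ (4 * Real.log U) ^ 6 := by
          gcongr
      _ = 4 ^ 6 * Real.log U ^ 6 := by ring
      _ ≤ Real.exp (1 * Real.log U ^ (1 : ℝ)) := h2
      _ = U := by rw [Real.rpow_one, one_mul, Real.exp_log hU0]

theorem eventually_exists_uniform_bound {ε : ℝ} (hε : 0 < ε) (hε1 : ε ≤ 1) :
    ∀ᶠ P : ℕ in atTop, ∃ U : ℕ, 1 ≤ U ∧ U ^ 3 ≤ P ∧ Real.log P ^ 6 ≤ U ∧
      ∀ K : ℕ, U ≤ K → K ≤ 8 * P → ∀ z : ℝ, K * (2 * Real.log P) ^ 8 ≤ |z| →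
        Real.log |z| ≤ Real.log P ^ (3 / 2 - ε) → ∀ A B, K ≤ A → B ≤ 16 * K →
        ‖∑ n ∈ Ioc A B, e (z / (n : ℝ))‖ ≤ K * (4 / Real.log P) ^ 6 := by
  obtain ⟨K₁, hK₁⟩ := eventually_atTop.1
    (eventually_norm_sum_Ioc_e_div_le (ε := ε / 2) (by positivity) (by linarith) 6)
  filter_upwards [eventually_exists_cube_root K₁, tendsto_log_natCast.eventually_ge_atTop 8,
    (((tendsto_rpow_atTop (y := ε / 2) (by positivity)).comp tendsto_log_natCast)).eventually_ge_atTop 8]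
    with P ⟨U, hUK, hU1, hUP, hPU, hPU6⟩ hP8 hPε
  refine ⟨U, hU1, hUP, hPU6, fun K hUK' hKP z hz hlz A B hA hB => ?_⟩
  simp only [Function.comp_apply] at hPε
  set ℓ := Real.log P with hℓ
  have hℓ0 : 0 < ℓ := by linarith
  have hU0 : (0 : ℝ) < U := by exact_mod_cast hU1
  have hK0 : (0 : ℝ) < K := by exact_mod_cast (by omega : 0 < K)
  have hP0 : (0 : ℝ) < P := by
    have : 0 < P := by
      rcases Nat.eq_zero_or_pos P with rfl | h
      · simp at hℓ; linarith
      · exact h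
    exact_mod_cast this
  have hlogK : ℓ / 4 ≤ Real.log K := by
    have : Real.log U ≤ Real.log K := Real.log_le_log hU0 (by exact_mod_cast hUK')
    linarith
  have hlogK2 : Real.log K ≤ 2 * ℓ := by
    have h1 : Real.log K ≤ Real.log (8 * P) := Real.log_le_log hK0 (by exact_mod_cast hKP)
    have h2 : Real.log 8 ≤ 8 := (Real.log_le_sub_one_of_pos (by norm_num)).trans (by norm_num)
    rw [Real.log_mul (by norm_num) hP0.ne'] at h1
    linarith
  have hlogK0 : 0 < Real.log K := by linarith
  refine (hK₁ K (hUK.trans hUK') z A B hA hB (le_trans ?_ hz) (hlz.trans ?_)).trans ?_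
  · gcongr
  · calc ℓ ^ (3 / 2 - ε) = ℓ ^ (3 / 2 - ε / 2) / ℓ ^ (ε / 2) := by
          rw [← Real.rpow_sub hℓ0]; congr 1; ring
      _ ≤ ℓ ^ (3 / 2 - ε / 2) / 8 := by gcongr
      _ ≤ ℓ ^ (3 / 2 - ε / 2) / 4 ^ (3 / 2 - ε / 2) := by
          gcongr
          calc (4 : ℝ) ^ (3 / 2 - ε / 2) ≤ 4 ^ ((3 : ℝ) / 2) :=
                Real.rpow_le_rpow_of_exponent_le (by norm_num) (by linarith)
            _ = ((2 : ℝ) ^ (2 : ℝ)) ^ ((3 : ℝ) / 2) := by norm_num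
            _ = 8 := by rw [← Real.rpow_mul (by norm_num)]; norm_num
      _ = (ℓ / 4) ^ (3 / 2 - ε / 2) := (Real.div_rpow hℓ0.le (by norm_num) _).symm
      _ ≤ _ := Real.rpow_le_rpow (by positivity) hlogK (by linarith)
  · rw [div_eq_mul_inv, ← inv_pow]
    gcongr
    rw [inv_le_comm₀ hlogK0 (by positivity), inv_div]
    exact hlogK

theorem sum_Ioc_two_pow_mul (F : ℕ → ℂ) (U J : ℕ) :
    ∑ d ∈ Ioc U (2 ^ J * U), F d = ∑ i ∈ range J, ∑ d ∈ Ioc (2 ^ i * U) (2 * (2 ^ i * U)), F d := by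
  induction J with
  | zero => simp
  | succ J ih =>
    rw [sum_range_succ, ← ih, sum_Ioc_consecutive F (Nat.le_mul_of_pos_left _ (by positivity))
      (by omega)]
    congr 2
    ring

theorem abs_one_div_sub_one_div_ge {l l' Δ L : ℕ} {s : ℝ} (hl : 1 ≤ l) (hl' : 1 ≤ l')
    (hlL : l ≤ L) (hlL' : l' ≤ L) (hs : s ≤ Δ) (h : l + Δ ≤ l' ∨ l' + Δ ≤ l) :
    s / (L : ℝ) ^ 2 ≤ |(1 / l - 1 / l' : ℝ)| := by
  have h1 : (0 : ℝ) < l := by exact_mod_cast hl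
  have h2 : (0 : ℝ) < l' := by exact_mod_cast hl'
  have h3 : (l : ℝ) ≤ L := by exact_mod_cast hlL
  have h4 : (l' : ℝ) ≤ L := by exact_mod_cast hlL'
  have e1 : (1 / l - 1 / l' : ℝ) = (l' - l) / (l * l') := by field_simp
  have h5 : s ≤ |(l' - l : ℝ)| := by
    rcases h with h | h
    · have : (l : ℝ) + Δ ≤ l' := by exact_mod_cast h
      exact le_trans (by linarith) (le_abs_self _)
    · have : (l' : ℝ) + Δ ≤ l := by exact_mod_cast h
      exact le_trans (by linarith) (neg_le_abs _)
  rw [e1, abs_div, abs_of_pos (mul_pos h1 h2), sq]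
  gcongr

theorem abs_one_div_sub_one_div_le_one {l l' : ℕ} (hl : 1 ≤ l) (hl' : 1 ≤ l') :
    |(1 / l - 1 / l' : ℝ)| ≤ 1 := by
  have h1 : (1 : ℝ) ≤ l := by exact_mod_cast hl
  have h2 : (1 : ℝ) ≤ l' := by exact_mod_cast hl'
  have h3 : (1 / l : ℝ) ≤ 1 := by rw [div_le_one (by linarith)]; exact h1
  have h4 : (1 / l' : ℝ) ≤ 1 := by rw [div_le_one (by linarith)]; exact h2
  have h5 : (0 : ℝ) ≤ 1 / l := by positivity
  have h6 : (0 : ℝ) ≤ 1 / l' := by positivity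
  rw [abs_le]; constructor <;> linarith

/-- One dyadic block of the type II sum in Vaughan's identity. -/
theorem norm_type_two_block_le_div_log_sq {P U M : ℕ} {y ℓ R : ℝ} (hU : 1 ≤ U) (hℓ : 2 ^ 11 ≤ ℓ)
    (hℓU : ℓ ^ 6 ≤ U) (hUM : U ≤ M) (hlog : Real.log (8 * P : ℕ) ≤ 2 * ℓ)
    (hy : P * ℓ ^ 15 ≤ |y|) (hyR : Real.log |y| ≤ R)
    (hb : ∀ K : ℕ, U ≤ K → K ≤ 8 * P → ∀ z : ℝ, K * (2 * ℓ) ^ 8 ≤ |z| →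
        Real.log |z| ≤ R → ∀ A B, K ≤ A → B ≤ 16 * K →
        ‖∑ n ∈ Ioc A B, e (z / (n : ℝ))‖ ≤ K * (4 / ℓ) ^ 6) :
    ‖∑ b ∈ Ioc M (2 * M), ((high U moebiusReal b : ℝ) : ℂ) *
        ∑ l ∈ Ioc (P / b) (8 * P / b), (((high U vonMangoldt * zetaReal) l : ℝ) : ℂ) *
          e (y / ((b * l : ℕ) : ℝ))‖ ≤ 1040 * P / ℓ ^ 2 := by
  have hℓ0 : 0 < ℓ := by linarith
  have hM1 : 1 ≤ M := hU.trans hUM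
  have hM0 : (0 : ℝ) < M := by exact_mod_cast hM1
  have ha : ∀ b, |high U moebiusReal b| ≤ 1 := fun b => by
    rw [high_apply]; split_ifs
    · simp
    · exact abs_moebiusReal_le b
  have hg : ∀ l ≤ 8 * P, |(high U vonMangoldt * zetaReal) l| ≤ 2 * ℓ := fun l hl => by
    rw [abs_of_nonneg (high_mul_zeta_nonneg U l)]
    rcases Nat.eq_zero_or_pos l with rfl | h0
    · simp; linarith
    · exact (high_mul_zeta_le U l).trans ((Real.log_le_log (by exact_mod_cast h0)
        (by exact_mod_cast hl)).trans hlog)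
  have hg0 : ∀ l ≤ U, (high U vonMangoldt * zetaReal) l = 0 := fun l hl =>
    high_mul_zeta_eq_zero hl
  have hη : (0 : ℝ) ≤ (4 / ℓ) ^ 6 := by positivity
  have hML : ((8 * P / M : ℕ) : ℝ) * M ≤ 8 * P := by exact_mod_cast Nat.div_mul_le_self _ _
  set L := 8 * P / M with hL
  have key : ∃ Δ : ℕ, (Δ : ℝ) ≤ 2 * L / ℓ ^ 6 ∧
      (∀ l l', U < l → U < l' → l ≤ L → l' ≤ L → (l + Δ ≤ l' ∨ l' + Δ ≤ l) →
      ∀ A B, M ≤ A → B ≤ 2 * M →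
      ‖∑ b ∈ Ioc A B, e (y * (1 / l - 1 / l') / (b : ℝ))‖ ≤ M * (4 / ℓ) ^ 6) := by
    rcases le_or_gt L U with hLU | hLU
    · exact ⟨0, by simp; positivity, fun l l' h1 h2 h3 => by omega⟩
    · have hL0 : (0 : ℝ) < L := by exact_mod_cast (by omega : 0 < L)
      have hLℓ : ℓ ^ 6 ≤ L := hℓU.trans (by exact_mod_cast hLU.le)
      have h1L : 1 ≤ L / ℓ ^ 6 := by rwa [one_le_div (by positivity)]
      have hM8 : M ≤ 8 * P := by
        by_contra! hc
        have := Nat.div_eq_of_lt hc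
        omega
      have hy0 : y ≠ 0 := by
        rintro rfl
        have : (0 : ℝ) < P := by exact_mod_cast (by omega : 0 < P)
        have : 0 < P * ℓ ^ 15 := by positivity
        simp at hy; linarith
      refine ⟨⌈(L : ℝ) / ℓ ^ 6⌉₊, ?_, ?_⟩
      · have := Nat.ceil_lt_add_one (a := (L : ℝ) / ℓ ^ 6) (by positivity)
        rw [mul_div_assoc]; linarith
      · intro l l' h1 h2 h3 h4 h5 A B hA hB
        have hlow := abs_one_div_sub_one_div_ge (hU.trans h1.le) (hU.trans h2.le) h3 h4
          (Nat.le_ceil _) h5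
        have hup := abs_one_div_sub_one_div_le_one (hU.trans h1.le) (hU.trans h2.le)
        refine hb M hUM hM8 _ ?_ ?_ A B hA (hB.trans (by omega))
        · rw [abs_mul]
          calc (M : ℝ) * (2 * ℓ) ^ 8 = M * (ℓ ^ 8 * 2 ^ 8) := by ring
            _ ≤ M * (ℓ ^ 8 * (ℓ / 8)) := by gcongr; linarith
            _ = (L * M) * ℓ ^ 9 / (8 * L) := by field_simp
            _ ≤ (8 * P) * ℓ ^ 9 / (8 * L) := by gcongr
            _ = (P * ℓ ^ 15) * ((L / ℓ ^ 6) / L ^ 2) := by field_simp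
            _ ≤ _ := by gcongr
        · refine le_trans (Real.log_le_log ?_ ?_) hyR
          · refine abs_pos.2 (mul_ne_zero hy0 (abs_pos.1 (lt_of_lt_of_le ?_ hlow)))
            positivity
          · rw [abs_mul]
            exact mul_le_of_le_one_right (abs_nonneg _) hup
  obtain ⟨Δ, hΔ, hsum⟩ := key
  have h := norm_type_two_block_le (y := y) _ _ ha hg hg0 hη hM1 hsum
  rw [← hL] at h
  refine abs_le_of_sq_le_sq' (h.trans ?_) (by positivity) |>.2
  calc (2 * ℓ) ^ 2 * (M : ℝ) ^ 2 * ((L : ℝ) ^ 2 * (4 / ℓ) ^ 6 + L * (2 * Δ))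
      ≤ (2 * ℓ) ^ 2 * (M : ℝ) ^ 2 * ((L : ℝ) ^ 2 * (4 / ℓ) ^ 6 + L * (2 * (2 * L / ℓ ^ 6))) := by
        gcongr
    _ = (L * M) ^ 2 * (16400 / ℓ ^ 4) := by field_simp; ring
    _ ≤ (8 * P) ^ 2 * (16400 / ℓ ^ 4) := by gcongr
    _ = 1049600 * P ^ 2 / ℓ ^ 4 := by ring
    _ ≤ 1081600 * P ^ 2 / ℓ ^ 4 := by gcongr; norm_num
    _ = (1040 * P / ℓ ^ 2) ^ 2 := by ring

theorem eventually_norm_sum_vonMangoldt_le {ε c : ℝ} (hε : 0 < ε) (hε1 : ε ≤ 1) (hc : 0 < c) :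
    ∀ᶠ P : ℕ in atTop, ∀ y : ℝ, P * Real.log P ^ 15 ≤ |y| →
      Real.log |y| ≤ Real.log P ^ (3 / 2 - ε) →
      ‖∑ n ∈ Ioc P (8 * P), ((vonMangoldt n : ℝ) : ℂ) * e (y / (n : ℝ))‖ ≤ c * P := by
  filter_upwards [eventually_exists_uniform_bound hε hε1,
    tendsto_log_natCast.eventually_ge_atTop (2 ^ 11), tendsto_log_natCast.eventually_ge_atTop (90000 / c),
    eventually_ge_atTop 1] with P ⟨U, hU1, hUP, hPU6, hb⟩ hℓ hℓc hP1 y hy hyR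
  set ℓ := Real.log P with hℓdef
  have hℓ0 : 0 < ℓ := by linarith
  have hP0 : (0 : ℝ) < P := by exact_mod_cast hP1
  have hlog : Real.log (8 * P : ℕ) ≤ 2 * ℓ := by
    have h2 : Real.log 8 ≤ 8 := (Real.log_le_sub_one_of_pos (by norm_num)).trans (by norm_num)
    push_cast
    rw [Real.log_mul (by norm_num) hP0.ne']
    linarith
  have hUU : U * U * U ≤ P := by rw [← pow_three']; exact hUP
  have hUUP : U * U ≤ P := (Nat.le_mul_of_pos_right _ hU1).trans hUU
  have hUleP : U ≤ P := (Nat.le_mul_of_pos_right _ hU1).trans hUUP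
  have hone := norm_type_one_le (y := y) (η := (4 / ℓ) ^ 6) hU1 (by positivity) hUUP (by
    intro d hd hdU A B hA hB
    have hd0 : (0 : ℝ) < d := by exact_mod_cast hd
    have hdP : ((P / d : ℕ) : ℝ) * d ≤ P := by exact_mod_cast Nat.div_mul_le_self _ _
    refine hb (P / d) ?_ ((Nat.div_le_self _ _).trans (by omega)) (y / d) ?_ ?_ A B hA hB
    · rw [Nat.le_div_iff_mul_le hd]
      exact (Nat.mul_le_mul_left U hdU).trans (by rw [← mul_assoc]; exact hUU)
    · rw [abs_div, abs_of_pos hd0, le_div_iff₀ hd0]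
      calc ((P / d : ℕ) : ℝ) * (2 * ℓ) ^ 8 * d = ((P / d : ℕ) : ℝ) * d * (2 * ℓ) ^ 8 := by ring
        _ ≤ P * (2 * ℓ) ^ 8 := by gcongr
        _ = P * (ℓ ^ 8 * 2 ^ 8) := by ring
        _ ≤ P * (ℓ ^ 8 * ℓ ^ 7) := by
            gcongr
            calc (2 : ℝ) ^ 8 ≤ (2 ^ 11) ^ 7 := by norm_num
              _ ≤ ℓ ^ 7 := by gcongr
        _ = P * ℓ ^ 15 := by ring
        _ ≤ _ := hy
    · refine le_trans (Real.log_le_log ?_ ?_) hyR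
      · have : 0 < P * ℓ ^ 15 := by positivity
        rw [abs_div, abs_of_pos hd0]
        exact div_pos (by linarith) hd0
      · rw [abs_div, abs_of_pos hd0]
        exact div_le_self (abs_nonneg _) (by exact_mod_cast hd))
  have hone' : 3 * Real.log (8 * P : ℕ) * (4 / ℓ) ^ 6 * P * (1 + Real.log (8 * P : ℕ)) ≤
      73728 * P / ℓ := by
    calc _ ≤ 3 * (2 * ℓ) * (4 / ℓ) ^ 6 * P * (ℓ + 2 * ℓ) := by
          have := Real.log_natCast_nonneg (8 * P)
          gcongr; linarith
      _ = 73728 * P / ℓ * (1 / ℓ ^ 3) := by field_simp; ring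
      _ ≤ 73728 * P / ℓ * 1 := by
          gcongr
          rw [div_le_one (by positivity)]
          exact one_le_pow₀ (by linarith)
      _ = _ := mul_one _
  have htwo : ‖∑ d ∈ Ioc 0 (8 * P), ((high U moebiusReal d : ℝ) : ℂ) *
        ∑ m ∈ Ioc (P / d) (8 * P / d), (((high U vonMangoldt * zetaReal) m : ℝ) : ℂ) *
          e (y / ((d * m : ℕ) : ℝ))‖ ≤ 5200 * P / ℓ := by
    set F : ℕ → ℂ := fun d => ((high U moebiusReal d : ℝ) : ℂ) *
        ∑ m ∈ Ioc (P / d) (8 * P / d), (((high U vonMangoldt * zetaReal) m : ℝ) : ℂ) *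
          e (y / ((d * m : ℕ) : ℝ)) with hF
    set J := Nat.log 2 (8 * P) + 1 with hJ
    have hJP : 8 * P ≤ 2 ^ J * U := by
      have := Nat.lt_pow_succ_log_self (b := 2) (by norm_num) (8 * P)
      calc 8 * P ≤ 2 ^ J := this.le
        _ ≤ 2 ^ J * U := Nat.le_mul_of_pos_right _ hU1
    have hJℓ : (J : ℝ) ≤ 5 * ℓ := by
      have h1 : 2 ^ (Nat.log 2 (8 * P)) ≤ 8 * P := Nat.pow_log_le_self 2 (by omega)
      have h2 : (Nat.log 2 (8 * P) : ℝ) * Real.log 2 ≤ 2 * ℓ := by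
        rw [← Real.log_pow]
        refine le_trans (Real.log_le_log (by positivity) ?_) hlog
        exact_mod_cast h1
      have h3 := Real.log_two_gt_d9
      have h4 : (Nat.log 2 (8 * P) : ℝ) * (1 / 2) ≤ 2 * ℓ :=
        le_trans (by gcongr; linarith) h2
      rw [hJ]; push_cast; linarith
    have e1 : ∑ d ∈ Ioc 0 (8 * P), F d = ∑ d ∈ Ioc U (2 ^ J * U), F d := by
      rw [← sum_Ioc_consecutive F (Nat.zero_le _) (hUleP.trans (by omega : P ≤ 8 * P)),
        ← sum_Ioc_consecutive F (hUleP.trans (by omega : P ≤ 8 * P)) hJP]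
      have z1 : ∑ d ∈ Ioc 0 U, F d = 0 := sum_eq_zero fun d hd => by
        have : ¬ U < d := by have := (mem_Ioc.1 hd).2; omega
        simp [hF, high_apply, this]
      have z2 : ∑ d ∈ Ioc (8 * P) (2 ^ J * U), F d = 0 := sum_eq_zero fun d hd => by
        have h1 := (mem_Ioc.1 hd).1
        have : 8 * P / d = 0 := Nat.div_eq_of_lt h1
        simp [hF, this]
      rw [z1, z2, zero_add, add_zero]
    rw [e1, sum_Ioc_two_pow_mul]
    calc _ ≤ ∑ i ∈ range J, ‖∑ d ∈ Ioc (2 ^ i * U) (2 * (2 ^ i * U)), F d‖ := norm_sum_le _ _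
      _ ≤ ∑ i ∈ range J, 1040 * P / ℓ ^ 2 := by
          refine sum_le_sum fun i _ => ?_
          exact norm_type_two_block_le_div_log_sq hU1 hℓ hPU6
            (Nat.le_mul_of_pos_left _ (by positivity)) hlog hy hyR hb
      _ = J * (1040 * P / ℓ ^ 2) := by simp
      _ ≤ 5 * ℓ * (1040 * P / ℓ ^ 2) := by gcongr
      _ = _ := by field_simp; ring
  rw [sum_vonMangoldt_eq (fun n => e (y / (n : ℝ))) (8 * P) hUleP (V := U)]
  refine (norm_add_le _ _).trans ?_
  calc _ ≤ 73728 * P / ℓ + 5200 * P / ℓ := add_le_add (hone.trans hone') htwo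
    _ = (78928 / ℓ) * P := by ring
    _ ≤ c * P := by
        gcongr
        rw [div_le_iff₀ hℓ0]
        rw [div_le_iff₀ hc] at hℓc
        linarith

/-- The primes in `(P, 8P]`. -/
def primesIn (P : ℕ) : Finset ℕ := (Ioc P (8 * P)).filter Nat.Prime

/-- The exponential sum `∑ log p e(y/p)` over the primes in `(P, 8P]`. -/
noncomputable def primeSum (P : ℕ) (y : ℝ) : ℂ :=
  ∑ p ∈ primesIn P, ((Real.log p : ℝ) : ℂ) * e (y / (p : ℝ))

theorem sum_vonMangoldt_not_prime_le {P : ℕ} (hP : 1 ≤ P) :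
    ∑ n ∈ (Ioc P (8 * P)).filter (fun n => ¬ n.Prime), vonMangoldt n ≤
      2 * √((8 * P : ℕ) : ℝ) * Real.log (8 * P : ℕ) := by
  refine le_trans ?_ (Chebyshev.psi_sub_theta_le (x := ((8 * P : ℕ) : ℝ))
    (by exact_mod_cast (by omega : 1 ≤ 8 * P)))
  rw [Chebyshev.psi_sub_theta_eq_sum_not_prime, Nat.floor_natCast]
  refine sum_le_sum_of_subset_of_nonneg ?_ fun _ _ _ => vonMangoldt_nonneg
  intro n hn
  simp only [mem_filter, mem_Ioc] at hn ⊢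
  exact ⟨⟨by omega, hn.1.2⟩, hn.2⟩

theorem eventually_norm_primeSum_le {ε c : ℝ} (hε : 0 < ε) (hε1 : ε ≤ 1) (hc : 0 < c) :
    ∀ᶠ P : ℕ in atTop, ∀ y : ℝ, P * Real.log P ^ 15 ≤ |y| →
      Real.log |y| ≤ Real.log P ^ (3 / 2 - ε) → ‖primeSum P y‖ ≤ c * P := by
  filter_upwards [eventually_norm_sum_vonMangoldt_le hε hε1 (half_pos hc), eventually_ge_atTop 8,
    tendsto_log_natCast.eventually (eventually_mul_pow_le_exp_rpow (24 / c) 1 (c := 1 / 2) (a := 1)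
      (by norm_num) one_pos)] with P h hP hexp y hy hyR
  have hP0 : (0 : ℝ) < P := by exact_mod_cast (by omega : 0 < P)
  have hsplit : primeSum P y = ∑ n ∈ Ioc P (8 * P), ((vonMangoldt n : ℝ) : ℂ) * e (y / (n : ℝ)) -
      ∑ n ∈ (Ioc P (8 * P)).filter (fun n => ¬ n.Prime), ((vonMangoldt n : ℝ) : ℂ) *
        e (y / (n : ℝ)) := by
    rw [← sum_filter_add_sum_filter_not (Ioc P (8 * P)) Nat.Prime, add_sub_cancel_right]
    refine sum_congr rfl fun p hp => ?_
    rw [vonMangoldt_apply_prime (mem_filter.1 hp).2]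
  have h2 : ‖∑ n ∈ (Ioc P (8 * P)).filter (fun n => ¬ n.Prime), ((vonMangoldt n : ℝ) : ℂ) *
        e (y / (n : ℝ))‖ ≤ 2 * √((8 * P : ℕ) : ℝ) * Real.log (8 * P : ℕ) := by
    refine (norm_sum_le _ _).trans (le_trans (le_of_eq ?_) (sum_vonMangoldt_not_prime_le (by omega)))
    refine sum_congr rfl fun n _ => ?_
    rw [norm_mul, norm_e, mul_one, Complex.norm_real, Real.norm_of_nonneg vonMangoldt_nonneg]
  have h3 : 2 * √((8 * P : ℕ) : ℝ) * Real.log (8 * P : ℕ) ≤ c / 2 * P := by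
    have e1 : Real.exp (1 / 2 * Real.log P ^ (1 : ℝ)) = √P := by
      rw [Real.rpow_one, Real.sqrt_eq_rpow, Real.rpow_def_of_pos hP0, mul_comm]
    rw [e1, pow_one] at hexp
    have hlog : Real.log (8 * P : ℕ) ≤ 2 * Real.log P := by
      rw [← Nat.cast_two, ← Real.log_pow]
      refine Real.log_le_log (by exact_mod_cast (by omega : 0 < 8 * P)) ?_
      rw [sq]; push_cast; gcongr; exact_mod_cast hP
    have hs : √((8 * P : ℕ) : ℝ) ≤ 3 * √P := by
      rw [Real.sqrt_le_left (by positivity), mul_pow, Real.sq_sqrt hP0.le]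
      push_cast; linarith
    calc 2 * √((8 * P : ℕ) : ℝ) * Real.log (8 * P : ℕ) ≤ 2 * (3 * √P) * (2 * Real.log P) := by
          have := Real.log_natCast_nonneg (8 * P)
          gcongr
      _ = c / 2 * √P * (24 / c * Real.log P) := by field_simp; ring
      _ ≤ c / 2 * √P * √P := by gcongr
      _ = c / 2 * P := by rw [mul_assoc, Real.mul_self_sqrt hP0.le]
  rw [hsplit]
  calc _ ≤ c / 2 * P + c / 2 * P := (norm_sub_le _ _).trans (add_le_add (h y hy hyR) (h2.trans h3))
    _ = c * P := by ring

theorem primeSum_zero (P : ℕ) : primeSum P 0 = ((∑ p ∈ primesIn P, Real.log p : ℝ) : ℂ) := by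
  simp [primeSum, e_zero]

theorem sum_log_primesIn (P : ℕ) : ∑ p ∈ primesIn P, Real.log p =
    Chebyshev.theta ((8 * P : ℕ) : ℝ) - Chebyshev.theta P := by
  rw [Chebyshev.theta_eq_sum_Icc, Chebyshev.theta_eq_sum_Icc, Nat.floor_natCast, Nat.floor_natCast,
    eq_sub_iff_add_eq, add_comm, primesIn, ← sum_union]
  · refine sum_congr ?_ fun _ _ => rfl
    ext n
    simp only [mem_union, mem_filter, mem_Icc, mem_Ioc]
    constructor
    · rintro (⟨h, h'⟩ | ⟨h, h'⟩) <;> exact ⟨by omega, h'⟩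
    · rintro ⟨h, h'⟩
      rcases le_or_gt n P with h1 | h1
      · exact Or.inl ⟨by omega, h'⟩
      · exact Or.inr ⟨by omega, h'⟩
  · rw [disjoint_left]
    intro n hn hn'
    simp only [mem_filter, mem_Icc, mem_Ioc] at hn hn'
    omega

theorem eventually_le_sum_log_primesIn :
    ∀ᶠ P : ℕ in atTop, (P : ℝ) ≤ ∑ p ∈ primesIn P, Real.log p := by
  obtain ⟨P₁, -, h⟩ := exists_forall_le_theta_sub
  filter_upwards [eventually_ge_atTop P₁] with P hP
  rw [sum_log_primesIn]
  exact h P hP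

theorem sum_log_primesIn_le (P : ℕ) : ∑ p ∈ primesIn P, Real.log p ≤ 12 * P := by
  have h1 := Chebyshev.theta_le_log4_mul_x (x := ((8 * P : ℕ) : ℝ)) (by positivity)
  have h2 := Chebyshev.theta_nonneg (P : ℝ)
  have h3 : Real.log 4 ≤ 1.4 := by
    rw [show (4 : ℝ) = 2 ^ 2 by norm_num, Real.log_pow]
    have := Real.log_two_lt_d9
    push_cast; linarith
  rw [sum_log_primesIn]
  have h4 : Real.log 4 * ((8 * P : ℕ) : ℝ) ≤ 1.4 * ((8 * P : ℕ) : ℝ) := by gcongr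
  push_cast at *
  linarith [(Nat.cast_nonneg P : (0 : ℝ) ≤ P)]

end PrimeSums

/-! ### Square divisors of integers in short intervals -/

section SquareHits

open Filter

/-- The `d ∈ (P, 8P]` for which `d²` has a positive multiple in `(a, b]`. -/
def squareHits (P a b : ℕ) : Finset ℕ :=
  (Ioc P (8 * P)).filter fun d => ∃ k ∈ Icc 1 b, a < k * d ^ 2 ∧ k * d ^ 2 ≤ b

theorem sum_norm_sq_range_le {ι : Type*} (s : Finset ι) (f : ι → ℝ) (H : ℕ) {N B : ℝ} (hN : (#s : ℝ) ≤ N)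
    (hB0 : 0 ≤ B)
    (hB : ∀ z : ℤ, z ≠ 0 → |z| < H → ‖∑ d ∈ s, e (z * f d)‖ ≤ B) :
    ∑ d ∈ s, ‖∑ h ∈ range H, e (h * f d)‖ ^ 2 ≤ H * N + H ^ 2 * B := by
  have key : ((∑ d ∈ s, ‖∑ h ∈ range H, e (h * f d)‖ ^ 2 : ℝ) : ℂ) =
      ∑ h ∈ range H, ∑ h' ∈ range H, ∑ d ∈ s, e (((h : ℤ) - (h' : ℤ) : ℤ) * f d) := by
    push_cast
    simp_rw [← Complex.mul_conj', map_sum, conj_e, sum_mul_sum, ← e_add]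
    rw [sum_comm]
    refine sum_congr rfl fun h _ => ?_
    rw [sum_comm]
    refine sum_congr rfl fun h' _ => sum_congr rfl fun d _ => ?_
    congr 1; ring
  have hnn : 0 ≤ ∑ d ∈ s, ‖∑ h ∈ range H, e (h * f d)‖ ^ 2 := by positivity
  have hN0 : 0 ≤ N := le_trans (by positivity) hN
  rw [← Real.norm_of_nonneg hnn, ← Complex.norm_real, key]
  calc _ ≤ ∑ h ∈ range H, ∑ h' ∈ range H, ((if h = h' then N else 0) + B) := by
        refine (norm_sum_le _ _).trans (sum_le_sum fun h hh => (norm_sum_le _ _).trans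
          (sum_le_sum fun h' hh' => ?_))
        rw [mem_range] at hh hh'
        split_ifs with heq
        · subst heq
          simp only [sub_self, Int.cast_zero, zero_mul, e_zero, sum_const, nsmul_eq_mul, mul_one,
            Complex.norm_natCast]
          linarith
        · rw [zero_add]
          refine hB _ (by omega) ?_
          rw [abs_lt]; constructor <;> omega
    _ = _ := by
        simp only [sum_add_distrib, sum_ite_eq, sum_const, card_range, nsmul_eq_mul]
        rw [sum_congr rfl (g := fun _ => N) fun i hi => if_pos hi]
        simp; ring

theorem card_squareHits_le_of_sum_le {P a b H : ℕ} {B : ℝ} (hP : 1 ≤ P)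
    (hH : 1 ≤ H) (hab : 4 * Real.pi * H * ((b : ℝ) - a) ≤ (P : ℝ) ^ 2) (hB0 : 0 ≤ B)
    (hB : ∀ z : ℤ, z ≠ 0 → |z| < H →
      ‖∑ d ∈ Ioc P (8 * P), e ((z * b : ℝ) / (d : ℝ) ^ 2)‖ ≤ B) :
    (#(squareHits P a b) : ℝ) ≤ 28 * P / H + 4 * B := by
  have hP0 : (0 : ℝ) < P := by exact_mod_cast hP
  have hH0 : (0 : ℝ) < H := by exact_mod_cast hH
  have hlow : ∀ d ∈ squareHits P a b,
      (H / 2 : ℝ) ^ 2 ≤ ‖∑ h ∈ range H, e (h * ((b : ℝ) / (d : ℝ) ^ 2))‖ ^ 2 := by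
    intro d hd
    obtain ⟨hd, k, -, hk1, hk2⟩ := mem_filter.1 hd
    have hPd : (P : ℝ) ≤ d := by exact_mod_cast (mem_Ioc.1 hd).1.le
    have hd0 : (0 : ℝ) < d := by linarith
    have hk1' : (a : ℝ) ≤ k * (d : ℝ) ^ 2 := by exact_mod_cast hk1.le
    have hk2' : k * (d : ℝ) ^ 2 ≤ b := by exact_mod_cast hk2
    have hre : ∀ h ∈ range H, (1 / 2 : ℝ) ≤ (e (h * ((b : ℝ) / (d : ℝ) ^ 2))).re := by
      intro h hh
      have hhH : (h : ℝ) ≤ H := by exact_mod_cast (mem_range.1 hh).le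
      have e1 : e (h * ((b : ℝ) / (d : ℝ) ^ 2)) = e (h * ((b - k * (d : ℝ) ^ 2) / (d : ℝ) ^ 2)) := by
        have : (h * ((b : ℝ) / (d : ℝ) ^ 2)) = h * ((b - k * (d : ℝ) ^ 2) / (d : ℝ) ^ 2) +
            ((h * k : ℕ) : ℝ) * 1 := by
          push_cast; field_simp; ring
        have h1 : e 1 = 1 := by
          simp [e, Complex.exp_two_pi_mul_I]
        rw [this, e_add, e_natCast_mul (h * k), h1, one_pow, mul_one]
      have h2 := norm_e_sub_one_le (h * ((b - k * (d : ℝ) ^ 2) / (d : ℝ) ^ 2))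
      have h3 : 2 * Real.pi * |h * ((b - k * (d : ℝ) ^ 2) / (d : ℝ) ^ 2)| ≤ 1 / 2 := by
        have : 0 ≤ (b : ℝ) - k * (d : ℝ) ^ 2 := by linarith
        rw [abs_of_nonneg (by positivity)]
        calc 2 * Real.pi * (h * ((b - k * (d : ℝ) ^ 2) / (d : ℝ) ^ 2))
            ≤ 2 * Real.pi * (H * ((b - a) / (P : ℝ) ^ 2)) := by gcongr; linarith
          _ = (4 * Real.pi * H * ((b : ℝ) - a)) / (2 * (P : ℝ) ^ 2) := by field_simp; ring
          _ ≤ (P : ℝ) ^ 2 / (2 * (P : ℝ) ^ 2) := by gcongr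
          _ = _ := by field_simp
      have h4 := (Complex.abs_re_le_norm _).trans (h2.trans h3)
      rw [e1]
      rw [Complex.sub_re, Complex.one_re, abs_le] at h4
      linarith [h4.1]
    gcongr
    refine le_trans ?_ (Complex.re_le_norm _)
    rw [Complex.re_sum]
    refine le_trans (le_of_eq ?_) (sum_le_sum hre)
    simp; ring
  have hup := sum_norm_sq_range_le (Ioc P (8 * P)) (fun d : ℕ => (b : ℝ) / (d : ℝ) ^ 2) H (N := 7 * P)
    (B := B) (by rw [Nat.card_Ioc, Nat.cast_sub (by omega)]; push_cast; linarith) hB0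
    (fun z hz hzH => by simpa only [mul_div_assoc] using hB z hz hzH)
  have h5 : (#(squareHits P a b) : ℝ) * (H / 2 : ℝ) ^ 2 ≤ H * (7 * P) + H ^ 2 * B := by
    refine le_trans ?_ hup
    rw [← nsmul_eq_mul]
    refine (card_nsmul_le_sum _ _ _ hlow).trans ?_
    exact sum_le_sum_of_subset_of_nonneg (filter_subset _ _) fun _ _ _ => by positivity
  have h6 : (28 * P / H + 4 * B) * (H / 2 : ℝ) ^ 2 = H * (7 * P) + H ^ 2 * B := by
    field_simp; ring
  rw [← h6] at h5
  exact le_of_mul_le_mul_right h5 (by positivity)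

theorem card_le_of_sq_close {P c : ℕ} (hP : 1 ≤ P) (s : Finset ℕ)
    (hs : ∀ d ∈ s, P < d) (hc : ∀ d ∈ s, ∀ d' ∈ s, d' ^ 2 ≤ d ^ 2 + c * P) : #s ≤ c + 1 := by
  rcases s.eq_empty_or_nonempty with rfl | hne
  · simp
  have hsub : s ⊆ Icc (s.min' hne) (s.min' hne + c) := by
    intro d hd
    have h1 := s.min'_le d hd
    rw [mem_Icc]
    refine ⟨h1, ?_⟩
    by_contra! h
    have h2 := hc _ (s.min'_mem hne) d hd
    have h3 := hs _ (s.min'_mem hne)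
    obtain ⟨t, rfl⟩ := Nat.exists_eq_add_of_lt h
    nlinarith
  refine (card_le_card hsub).trans ?_
  simp only [Nat.card_Icc]; omega

theorem card_squareHits_le {P a b c K : ℕ} (hP : 1 ≤ P) (hab : b ≤ a + c * P)
    (hb : b ≤ K * P ^ 2) : #(squareHits P a b) ≤ K * (c + 1) := by
  have hsub : squareHits P a b ⊆ (Icc 1 K).biUnion fun k =>
      (Ioc P (8 * P)).filter fun d => a < k * d ^ 2 ∧ k * d ^ 2 ≤ b := by
    intro d hd
    obtain ⟨hd, k, hk, hk1, hk2⟩ := mem_filter.1 hd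
    have hPd := (mem_Ioc.1 hd).1
    simp only [mem_biUnion, mem_filter, mem_Icc]
    refine ⟨k, ⟨(mem_Icc.1 hk).1, ?_⟩, hd, hk1, hk2⟩
    have h1 : k * P ^ 2 ≤ K * P ^ 2 :=
      le_trans (Nat.mul_le_mul_left k (Nat.pow_le_pow_left hPd.le 2)) (hk2.trans hb)
    exact Nat.le_of_mul_le_mul_right h1 (by positivity)
  refine (card_le_card hsub).trans (card_biUnion_le.trans ?_)
  calc _ ≤ ∑ _k ∈ Icc 1 K, (c + 1) := by
        refine sum_le_sum fun k hk => ?_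
        have hk1 := (mem_Icc.1 hk).1
        refine card_le_of_sq_close hP _ (fun d hd => (mem_Ioc.1 (mem_filter.1 hd).1).1) ?_
        intro d hd d' hd'
        have h1 := (mem_filter.1 hd).2.1
        have h2 := (mem_filter.1 hd').2.2
        have h3 : c * P ≤ k * (c * P) := Nat.le_mul_of_pos_left _ hk1
        refine Nat.le_of_mul_le_mul_left (?_ : k * _ ≤ k * _) hk1
        rw [mul_add]; omega
    _ = _ := by simp

theorem eventually_card_squareHits_le {ε : ℝ} (hε : 0 < ε) (hε1 : ε ≤ 1) (A : ℕ) :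
    ∀ᶠ P : ℕ in atTop, ∀ a b : ℕ, (b : ℝ) ≤ a + P * Real.log P ^ A →
      Real.log b ≤ Real.log P ^ (3 / 2 - ε) →
      (#(squareHits P a b) : ℝ) ≤ 32 * P / Real.log P ^ 2 := by
  have hε2 : 0 < ε / 2 := by positivity
  filter_upwards [eventually_norm_sum_Ioc_e_div_sq_le hε2 (by linarith) 2,
    eventually_ge_atTop 1, tendsto_log_natCast.eventually_ge_atTop 2,
    tendsto_log_natCast.eventually (eventually_mul_pow_le_exp_rpow 8 (A + 2)
      (c := 1 / 20) (a := 1) (by norm_num) one_pos),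
    tendsto_log_natCast.eventually (eventually_mul_pow_le_exp_rpow 32 (A + 2)
      (c := 1) (a := 1) (by norm_num) one_pos),
    (((tendsto_rpow_atTop (y := ε / 2) hε2).comp tendsto_log_natCast)).eventually_ge_atTop 4]
    with P h hP hL hexp hexp' hPε a b hab hb
  simp only [Function.comp_apply] at hPε
  set ℓ := Real.log P with hℓ
  have hℓ0 : 0 < ℓ := by linarith
  have hP0 : (0 : ℝ) < P := by exact_mod_cast hP
  rw [Real.rpow_one, one_mul, Real.exp_log hP0] at hexp'
  have hpow1 : (1 : ℝ) ≤ ℓ ^ A := one_le_pow₀ (by linarith)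
  rcases le_or_gt (b : ℝ) ((P : ℝ) ^ ((59 : ℝ) / 20)) with hsmall | hlarge
  · have hx : Real.exp (1 / 20 * ℓ ^ (1 : ℝ)) = (P : ℝ) ^ ((1 : ℝ) / 20) := by
      rw [Real.rpow_one, Real.rpow_def_of_pos hP0, mul_comm]
    rw [hx] at hexp
    have hcount := card_squareHits_le (P := P) (a := a) (b := b) (c := ⌈ℓ ^ A⌉₊)
      (K := ⌈(P : ℝ) ^ ((19 : ℝ) / 20)⌉₊) hP (by
        have : (b : ℝ) ≤ ((a + ⌈ℓ ^ A⌉₊ * P : ℕ) : ℝ) := by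
          refine hab.trans ?_
          push_cast
          rw [mul_comm]
          gcongr
          exact Nat.le_ceil _
        exact_mod_cast this) (by
        have : (b : ℝ) ≤ ((⌈(P : ℝ) ^ ((19 : ℝ) / 20)⌉₊ * P ^ 2 : ℕ) : ℝ) := by
          refine hsmall.trans ?_
          push_cast
          calc (P : ℝ) ^ ((59 : ℝ) / 20) = (P : ℝ) ^ ((19 : ℝ) / 20) * (P : ℝ) ^ 2 := by
                rw [← Real.rpow_natCast, ← Real.rpow_add hP0]; norm_num
            _ ≤ _ := by gcongr; exact Nat.le_ceil _
        exact_mod_cast this)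
    have hK1 : (1 : ℝ) ≤ (P : ℝ) ^ ((19 : ℝ) / 20) :=
      Real.one_le_rpow (by exact_mod_cast hP) (by norm_num)
    have h1 := Nat.ceil_lt_add_one (a := ℓ ^ A) (by positivity)
    have h2 := Nat.ceil_lt_add_one (a := (P : ℝ) ^ ((19 : ℝ) / 20)) (by positivity)
    calc (#(squareHits P a b) : ℝ) ≤ (⌈(P : ℝ) ^ ((19 : ℝ) / 20)⌉₊ : ℝ) * (⌈ℓ ^ A⌉₊ + 1) := by
          exact_mod_cast hcount
      _ ≤ (2 * (P : ℝ) ^ ((19 : ℝ) / 20)) * (3 * ℓ ^ A) := by gcongr <;> linarith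
      _ ≤ (P : ℝ) ^ ((19 : ℝ) / 20) * (8 * ℓ ^ (A + 2)) / ℓ ^ 2 := by
          rw [pow_add]
          have : 0 ≤ (P : ℝ) ^ ((19 : ℝ) / 20) * ℓ ^ A := by positivity
          rw [le_div_iff₀ (by positivity)]
          calc (2 * (P : ℝ) ^ ((19 : ℝ) / 20)) * (3 * ℓ ^ A) * ℓ ^ 2 =
                6 * ((P : ℝ) ^ ((19 : ℝ) / 20) * ℓ ^ A) * ℓ ^ 2 := by ring
            _ ≤ 8 * ((P : ℝ) ^ ((19 : ℝ) / 20) * ℓ ^ A) * ℓ ^ 2 := by gcongr; norm_num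
            _ = _ := by ring
      _ ≤ (P : ℝ) ^ ((19 : ℝ) / 20) * (P : ℝ) ^ ((1 : ℝ) / 20) / ℓ ^ 2 := by gcongr
      _ = P / ℓ ^ 2 := by rw [← Real.rpow_add hP0]; norm_num
      _ ≤ 32 * P / ℓ ^ 2 := by gcongr; linarith
  · have hb0 : (0 : ℝ) < b := lt_of_le_of_lt (by positivity) hlarge
    have hH := Nat.ceil_lt_add_one (a := ℓ ^ 2) (by positivity)
    have hH' := Nat.le_ceil (ℓ ^ 2)
    set H := ⌈ℓ ^ 2⌉₊ with hHdef
    have hℓ2 : (1 : ℝ) ≤ ℓ ^ 2 := one_le_pow₀ (by linarith)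
    have hH0 : (0 : ℝ) < H := by linarith
    have hcount := card_squareHits_le_of_sum_le (P := P) (a := a) (b := b) (H := H)
      (B := P / ℓ ^ 2) hP (by exact_mod_cast hH0) (by
        calc 4 * Real.pi * H * ((b : ℝ) - a) ≤ 4 * Real.pi * H * (P * ℓ ^ A) :=
              mul_le_mul_of_nonneg_left (by linarith) (by positivity)
          _ ≤ 4 * 4 * (2 * ℓ ^ 2) * (P * ℓ ^ A) := by
              gcongr
              · exact Real.pi_le_four
              · linarith
          _ = 32 * ℓ ^ (A + 2) * P := by ring
          _ ≤ P * P := by gcongr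
          _ = _ := by ring) (by positivity) (fun z hz hzH => by
        have hz1 : (1 : ℝ) ≤ |(z : ℝ)| := by exact_mod_cast Int.one_le_abs hz
        have hz2 : |(z : ℝ)| ≤ H := by exact_mod_cast hzH.le
        refine h _ P (8 * P) le_rfl (by omega) ?_ ?_
        · rw [abs_mul, abs_of_pos hb0]
          nlinarith
        · rw [abs_mul, abs_of_pos hb0, Real.log_mul (by linarith) hb0.ne']
          have h1 : Real.log |(z : ℝ)| ≤ ℓ := by
            refine Real.log_le_log (by linarith) (hz2.trans ?_)
            calc (H : ℝ) ≤ 32 * (1 * ℓ ^ 2) := by linarith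
              _ ≤ 32 * (ℓ ^ A * ℓ ^ 2) := by gcongr
              _ = 32 * ℓ ^ (A + 2) := by ring
              _ ≤ P := hexp'
          have h3 : ℓ ≤ Real.log b := by
            have := Real.log_le_log (by positivity) hlarge.le
            rw [Real.log_rpow hP0] at this
            linarith
          have h2 : ℓ ^ (3 / 2 - ε / 2) = ℓ ^ (3 / 2 - ε) * ℓ ^ (ε / 2) := by
            rw [← Real.rpow_add hℓ0]; congr 1; ring
          rw [h2]
          have h4 : ℓ ^ (3 / 2 - ε) * 4 ≤ ℓ ^ (3 / 2 - ε) * ℓ ^ (ε / 2) := by gcongr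
          linarith)
    refine hcount.trans ?_
    calc 28 * P / H + 4 * (P / ℓ ^ 2) ≤ 28 * P / ℓ ^ 2 + 4 * (P / ℓ ^ 2) := by gcongr
      _ = _ := by ring

end SquareHits

/-! ### Trigonometric approximation of the sawtooth function -/

section Sawtooth

open Filter

/-- The periodic second Bernoulli function. -/
noncomputable def bernTwo (x : ℝ) : ℝ := Int.fract x ^ 2 - Int.fract x + 1 / 6

theorem bernTwo_le (y : ℝ) : bernTwo y ≤ y ^ 2 - y + 1 / 6 := by
  have h0 := Int.fract_nonneg y
  have h1 := Int.fract_lt_one y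
  have h2 : y = ⌊y⌋ + Int.fract y := (Int.floor_add_fract y).symm
  set f := Int.fract y with hf
  have key : (0 : ℝ) ≤ ⌊y⌋ * (⌊y⌋ + 2 * f - 1) := by
    rcases le_or_gt 1 ⌊y⌋ with h | h
    · have : (1 : ℝ) ≤ ⌊y⌋ := by exact_mod_cast h
      exact mul_nonneg (by linarith) (by linarith)
    rcases le_or_gt ⌊y⌋ (-1) with h' | h'
    · have : (⌊y⌋ : ℝ) ≤ -1 := by exact_mod_cast h'
      exact mul_nonneg_of_nonpos_of_nonpos (by linarith) (by linarith)
    · have : ⌊y⌋ = 0 := by omega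
      simp [this]
  rw [bernTwo, ← hf]
  have h3 : y ^ 2 - y = (⌊y⌋ + f) ^ 2 - (⌊y⌋ + f) := by rw [← h2]
  nlinarith

theorem bernTwo_add_sub_le (x t : ℝ) :
    bernTwo (x + t) - bernTwo x ≤ 2 * t * (Int.fract x - 1 / 2) + t ^ 2 := by
  have h1 : bernTwo (x + t) = bernTwo (Int.fract x + t) := by
    have : x + t = Int.fract x + t + ⌊x⌋ := by
      have := Int.floor_add_fract x; linarith
    rw [bernTwo, bernTwo, this, Int.fract_add_intCast]
  rw [h1]
  have h2 := bernTwo_le (Int.fract x + t)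
  have h3 : bernTwo x = Int.fract x ^ 2 - Int.fract x + 1 / 6 := rfl
  rw [h3]
  nlinarith

theorem eval_bernoulli_two (x : ℝ) :
    (Polynomial.map (algebraMap ℚ ℝ) (Polynomial.bernoulli 2)).eval x = x ^ 2 - x + 1 / 6 := by
  simp [Polynomial.bernoulli, sum_range_succ, bernoulli_two, bernoulli_one, bernoulli_zero,
    Polynomial.eval_add]
  ring

theorem hasSum_cos_bernTwo (x : ℝ) :
    HasSum (fun n : ℕ => 1 / (n : ℝ) ^ 2 * Real.cos (2 * Real.pi * n * x))
      (Real.pi ^ 2 * bernTwo x) := by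
  have h := hasSum_one_div_nat_pow_mul_cos (k := 1) one_ne_zero (x := Int.fract x)
    ⟨Int.fract_nonneg x, (Int.fract_lt_one x).le⟩
  rw [mul_one, eval_bernoulli_two] at h
  convert! h using 1
  · ext n
    congr 1
    rw [Int.fract, mul_sub, show 2 * Real.pi * n * (⌊x⌋ : ℝ) = ((n * ⌊x⌋ : ℤ) : ℝ) * (2 * Real.pi) by
      push_cast; ring, Real.cos_sub_int_mul_two_pi]
  · rw [bernTwo]
    simp only [Nat.factorial]
    push_cast
    ring

theorem abs_bernTwo_sub_sum_le (x : ℝ) (H : ℕ) :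
    |Real.pi ^ 2 * bernTwo x -
      ∑ n ∈ Icc 1 H, 1 / (n : ℝ) ^ 2 * Real.cos (2 * Real.pi * n * x)| ≤ (2 : ℝ) / (H + 1) := by
  set f : ℕ → ℝ := fun n => 1 / (n : ℝ) ^ 2 * Real.cos (2 * Real.pi * n * x) with hf
  have h1 := (hasSum_cos_bernTwo x).tendsto_sum_nat
  have h0 : f 0 = 0 := by simp [hf]
  have hIcc : ∑ n ∈ Icc 1 H, f n = ∑ n ∈ range (H + 1), f n := by
    rw [range_eq_Ico, sum_eq_sum_Ico_succ_bot (by omega), h0, zero_add]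
    rfl
  rw [hIcc]
  have h2 := (h1.sub_const (∑ n ∈ range (H + 1), f n)).abs
  refine le_of_tendsto h2 (eventually_atTop.2 ⟨H + 1, fun N hN => ?_⟩)
  rw [← sum_Ico_eq_sub _ hN]
  calc |∑ n ∈ Ico (H + 1) N, f n| ≤ ∑ n ∈ Ico (H + 1) N, |f n| := abs_sum_le_sum_abs _ _
    _ ≤ ∑ n ∈ Ioo H N, ((n : ℝ) ^ 2)⁻¹ := by
        rw [show Ico (H + 1) N = Ioo H N from rfl]
        refine sum_le_sum fun n _ => ?_
        rw [hf, abs_mul, abs_of_nonneg (by positivity), ← one_div]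
        exact mul_le_of_le_one_right (by positivity) (Real.abs_cos_le_one _)
    _ ≤ _ := sum_Ioo_inv_sq_le H N

/-- Fourier coefficients of the mean of the sawtooth function over an interval of length `η`. -/
noncomputable def sawCoeff (η : ℝ) (n : ℕ) : ℂ :=
  (e (n * η) - 1) / ((4 * Real.pi ^ 2 * η * (n : ℝ) ^ 2 : ℝ) : ℂ)

theorem norm_sawCoeff_le {η : ℝ} (hη : η ≠ 0) {n : ℕ} (hn : 1 ≤ n) :
    ‖sawCoeff η n‖ ≤ 1 / (2 * Real.pi * n) := by
  have hn0 : (0 : ℝ) < n := by exact_mod_cast hn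
  have hη0 : 0 < |η| := abs_pos.2 hη
  rw [sawCoeff, norm_div, Complex.norm_real, Real.norm_eq_abs]
  have h1 : |4 * Real.pi ^ 2 * η * (n : ℝ) ^ 2| = 4 * Real.pi ^ 2 * |η| * (n : ℝ) ^ 2 := by
    rw [abs_mul, abs_mul, abs_of_pos (by positivity : (0 : ℝ) < 4 * Real.pi ^ 2),
      abs_of_pos (by positivity : (0 : ℝ) < (n : ℝ) ^ 2)]
  have h2 := norm_e_sub_one_le (n * η)
  rw [abs_mul, abs_of_pos hn0] at h2
  rw [h1, div_le_div_iff₀ (by positivity) (by positivity), one_mul]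
  calc _ ≤ 2 * Real.pi * (n * |η|) * (2 * Real.pi * n) := by gcongr
    _ = _ := by ring

theorem norm_sawCoeff_one_sub_le {η : ℝ} (hη : 0 < η) (hη1 : 7 * η ≤ 1) :
    ‖sawCoeff η 1 - Complex.I / (2 * Real.pi)‖ ≤ η := by
  have hpi := Real.pi_pos
  have hpi2 := Real.pi_lt_d2
  have h1 : sawCoeff η 1 - Complex.I / (2 * Real.pi) =
      (Complex.exp (2 * Real.pi * η * Complex.I) - 1 - 2 * Real.pi * η * Complex.I) /
        ((4 * Real.pi ^ 2 * η : ℝ) : ℂ) := by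
    have : (Real.pi : ℂ) ≠ 0 := by exact_mod_cast hpi.ne'
    have : (η : ℂ) ≠ 0 := by exact_mod_cast hη.ne'
    rw [sawCoeff, e]
    push_cast
    field_simp
    ring
  have hn : ‖(2 * Real.pi * η * Complex.I : ℂ)‖ = 2 * Real.pi * η := by
    simp [abs_of_pos hpi, abs_of_pos hη]
  have h2 := Complex.norm_exp_sub_one_sub_id_le (x := 2 * Real.pi * η * Complex.I)
    (by rw [hn]; nlinarith)
  rw [hn] at h2
  rw [h1, norm_div, Complex.norm_real, Real.norm_of_nonneg (by positivity),
    div_le_iff₀ (by positivity)]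
  calc _ ≤ (2 * Real.pi * η) ^ 2 := h2
    _ = _ := by ring

theorem two_mul_re_sawCoeff_mul {η x : ℝ} (n : ℕ) :
    2 * (sawCoeff η n * e (n * x)).re = (1 / (n : ℝ) ^ 2 * Real.cos (2 * Real.pi * n * (x + η)) -
      1 / (n : ℝ) ^ 2 * Real.cos (2 * Real.pi * n * x)) / (2 * Real.pi ^ 2 * η) := by
  have hre : ∀ t : ℝ, (e (n * t)).re = Real.cos (2 * Real.pi * n * t) := fun t => by
    rw [e, show (2 * Real.pi * ((n * t : ℝ) : ℂ) * Complex.I : ℂ) =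
      ((2 * Real.pi * n * t : ℝ) : ℂ) * Complex.I by push_cast; ring, Complex.exp_ofReal_mul_I_re]
  rw [sawCoeff, div_mul_eq_mul_div, Complex.div_ofReal_re, sub_mul, ← e_add, one_mul,
    Complex.sub_re, ← mul_add, hre, hre, add_comm η x]
  rcases eq_or_ne η 0 with rfl | hη
  · simp
  rcases Nat.eq_zero_or_pos n with rfl | hn
  · simp
  have : (0 : ℝ) < n := by exact_mod_cast hn
  field_simp
  ring

theorem abs_sub_sum_sawCoeff_le {η : ℝ} (hη : η ≠ 0) (x : ℝ) (H : ℕ) :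
    |(bernTwo (x + η) - bernTwo x) / (2 * η) - 2 * (∑ n ∈ Icc 1 H, sawCoeff η n * e (n * x)).re| ≤
      1 / (|η| * (H + 1)) := by
  have hη0 : 0 < |η| := abs_pos.2 hη
  have h1 := abs_bernTwo_sub_sum_le (x + η) H
  have h2 := abs_bernTwo_sub_sum_le x H
  rw [Complex.re_sum, mul_sum, sum_congr rfl fun n _ => two_mul_re_sawCoeff_mul n, ← sum_div,
    sum_sub_distrib]
  set A := ∑ n ∈ Icc 1 H, 1 / (n : ℝ) ^ 2 * Real.cos (2 * Real.pi * n * (x + η))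
  set B := ∑ n ∈ Icc 1 H, 1 / (n : ℝ) ^ 2 * Real.cos (2 * Real.pi * n * x)
  have h3 : (bernTwo (x + η) - bernTwo x) / (2 * η) - (A - B) / (2 * Real.pi ^ 2 * η) =
      ((Real.pi ^ 2 * bernTwo (x + η) - A) - (Real.pi ^ 2 * bernTwo x - B)) /
        (2 * Real.pi ^ 2 * η) := by
    have := Real.pi_pos
    field_simp
    ring
  have hpi : 2 ≤ Real.pi ^ 2 := by nlinarith [Real.two_le_pi]
  rw [h3, abs_div, abs_mul, abs_of_pos (by positivity : 0 < 2 * Real.pi ^ 2),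
    div_le_div_iff₀ (by positivity) (by positivity), one_mul]
  have h4 : |(Real.pi ^ 2 * bernTwo (x + η) - A) - (Real.pi ^ 2 * bernTwo x - B)| ≤
      4 / (H + 1) := (abs_sub _ _).trans (by
        calc _ ≤ (2 : ℝ) / (H + 1) + 2 / (H + 1) := add_le_add h1 h2
          _ = _ := by ring)
  calc _ ≤ 4 / ((H : ℝ) + 1) * (|η| * (H + 1)) := by gcongr
    _ = 2 * 2 * |η| := by field_simp; norm_num
    _ ≤ _ := by gcongr

/-- The sawtooth function. -/
noncomputable def saw (x : ℝ) : ℝ := Int.fract x - 1 / 2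

/-- Trigonometric polynomials of degree at most `H` with coefficients `c` and `c'` (and their
conjugates) that bound the sawtooth function from below and above up to `δ`. -/
structure SawtoothSandwich (δ : ℝ) (H : ℕ) (c c' : ℕ → ℂ) : Prop where
  one_le : 1 ≤ H
  norm_le : ∀ n, 1 ≤ n → ‖c n‖ ≤ 1 / (2 * Real.pi * n)
  norm_le' : ∀ n, 1 ≤ n → ‖c' n‖ ≤ 1 / (2 * Real.pi * n)
  norm_one_sub_le : ‖c 1 - Complex.I / (2 * Real.pi)‖ ≤ δ
  le_saw : ∀ x : ℝ, 2 * (∑ n ∈ Icc 1 H, c n * e (n * x)).re - δ ≤ saw x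
  saw_le : ∀ x : ℝ, saw x ≤ 2 * (∑ n ∈ Icc 1 H, c' n * e (n * x)).re + δ

theorem exists_sawtoothSandwich {δ : ℝ} (hδ : 0 < δ) :
    ∃ (H : ℕ) (c c' : ℕ → ℂ), SawtoothSandwich δ H c c' := by
  set η := min δ (1 / 7) with hη
  have hη0 : 0 < η := lt_min hδ (by norm_num)
  have hηδ : η ≤ δ := min_le_left _ _
  have hη7 : η ≤ 1 / 7 := min_le_right _ _
  obtain ⟨H, hH⟩ := exists_nat_ge (2 / (η * δ))
  have herr : 1 / (η * ((H + 1 : ℕ) + 1)) ≤ δ / 2 := by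
    rw [div_le_iff₀ (by positivity)] at hH ⊢
    push_cast
    nlinarith
  refine ⟨H + 1, sawCoeff η, sawCoeff (-η), by omega, fun n hn => norm_sawCoeff_le hη0.ne' hn,
    fun n hn => norm_sawCoeff_le (neg_ne_zero.2 hη0.ne') hn,
    (norm_sawCoeff_one_sub_le hη0 (by linarith)).trans hηδ, fun x => ?_, fun x => ?_⟩
  · rw [saw]
    have h1 := abs_le.1 (abs_sub_sum_sawCoeff_le hη0.ne' x (H + 1)) |>.1
    rw [abs_of_pos hη0] at h1
    have h2 : (bernTwo (x + η) - bernTwo x) / (2 * η) ≤ Int.fract x - 1 / 2 + η / 2 := by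
      rw [div_le_iff₀ (by positivity)]
      linarith [bernTwo_add_sub_le x η]
    linarith
  · rw [saw]
    have h1 := abs_le.1 (abs_sub_sum_sawCoeff_le (neg_ne_zero.2 hη0.ne') x (H + 1)) |>.2
    rw [abs_neg, abs_of_pos hη0] at h1
    have h2 : Int.fract x - 1 / 2 - η / 2 ≤ (bernTwo (x + -η) - bernTwo x) / (2 * -η) := by
      rw [mul_neg, div_neg, ← neg_div, le_div_iff₀ (by positivity)]
      linarith [bernTwo_add_sub_le x (-η)]
    linarith

end Sawtooth

/-! ### Sawtooth sums over primes -/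

section SawtoothSums

open Filter ComplexConjugate

/-- The sum `∑ log p s(u/p) e(-a/p)` over the primes in `(P, 8P]`, with `s` the sawtooth
function. -/
noncomputable def sawSum (P : ℕ) (u a : ℝ) : ℂ :=
  ∑ p ∈ primesIn P, ((Real.log p : ℝ) : ℂ) * ((saw (u / p) : ℝ) : ℂ) * e (-a / (p : ℝ))

theorem sum_mul_trig_mul (P H : ℕ) (c : ℕ → ℂ) (u a : ℝ) :
    ∑ p ∈ primesIn P, ((Real.log p : ℝ) : ℂ) * (∑ n ∈ Icc 1 H, c n * e (n * (u / p))) *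
      e (-a / (p : ℝ)) = ∑ n ∈ Icc 1 H, c n * primeSum P (n * u - a) := by
  simp_rw [primeSum, mul_sum, sum_mul]
  rw [sum_comm]
  refine sum_congr rfl fun n _ => sum_congr rfl fun p _ => ?_
  rw [show (n * u - a) / (p : ℝ) = n * (u / p) + -a / p by ring, e_add]
  ring

theorem SawtoothSandwich.sum_abs_sub_le {δ : ℝ} {H : ℕ} {c c' : ℕ → ℂ}
    (h : SawtoothSandwich δ H c c') {P : ℕ} {u δ₁ : ℝ} (hδ : 0 ≤ δ) (hHδ : H * δ₁ ≤ δ)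
    (hu : ∀ n ∈ Icc 1 H, ‖primeSum P (n * u)‖ ≤ δ₁ * P) :
    ∑ p ∈ primesIn P, Real.log p *
      |saw (u / p) - 2 * (∑ n ∈ Icc 1 H, c n * e (n * (u / p))).re| ≤ 37 * δ * P := by
  have hpi := Real.pi_gt_three
  have hS : ∀ b : ℕ → ℂ, ∑ p ∈ primesIn P, Real.log p *
      (∑ n ∈ Icc 1 H, b n * e (n * (u / p))).re =
      (∑ n ∈ Icc 1 H, b n * primeSum P (n * u)).re := by
    intro b
    have := sum_mul_trig_mul P H b u 0
    simp only [neg_zero, zero_div, e_zero, mul_one, sub_zero] at this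
    rw [← this, Complex.re_sum]
    exact sum_congr rfl fun p _ => (Complex.re_ofReal_mul _ _).symm
  have hb : ∀ b : ℕ → ℂ, (∀ n, 1 ≤ n → ‖b n‖ ≤ 1 / (2 * Real.pi * n)) →
      |(∑ n ∈ Icc 1 H, b n * primeSum P (n * u)).re| ≤ δ * P / 6 := by
    intro b hb
    refine (Complex.abs_re_le_norm _).trans ((norm_sum_le _ _).trans ?_)
    calc _ ≤ ∑ n ∈ Icc 1 H, 1 / 6 * (δ₁ * P) := by
          refine sum_le_sum fun n hn => ?_
          have hn1 := (mem_Icc.1 hn).1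
          have hn0 : (1 : ℝ) ≤ n := by exact_mod_cast hn1
          rw [norm_mul]
          refine mul_le_mul ((hb n hn1).trans ?_) (hu n hn) (norm_nonneg _) (by norm_num)
          refine one_div_le_one_div_of_le (by norm_num) ?_
          nlinarith
      _ = H * δ₁ * P / 6 := by simp; ring
      _ ≤ _ := by gcongr
  have h1 := abs_le.1 (hb c h.norm_le)
  have h2 := abs_le.1 (hb c' h.norm_le')
  calc _ ≤ ∑ p ∈ primesIn P, (2 * (Real.log p * (∑ n ∈ Icc 1 H, c' n * e (n * (u / p))).re) -
          2 * (Real.log p * (∑ n ∈ Icc 1 H, c n * e (n * (u / p))).re) +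
          3 * δ * Real.log p) := by
        refine sum_le_sum fun p _ => ?_
        have hl := Real.log_natCast_nonneg p
        have h3 := h.le_saw (u / p)
        have h4 := h.saw_le (u / p)
        calc _ ≤ Real.log p * (2 * (∑ n ∈ Icc 1 H, c' n * e (n * (u / p))).re -
              2 * (∑ n ∈ Icc 1 H, c n * e (n * (u / p))).re + 3 * δ) := by
              gcongr
              rw [abs_le]; constructor <;> linarith
          _ = _ := by ring
    _ = 2 * (∑ n ∈ Icc 1 H, c' n * primeSum P (n * u)).re -
          2 * (∑ n ∈ Icc 1 H, c n * primeSum P (n * u)).re +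
          3 * δ * ∑ p ∈ primesIn P, Real.log p := by
        rw [sum_add_distrib, sum_sub_distrib, ← mul_sum, ← mul_sum, ← mul_sum, hS, hS]
    _ ≤ 2 * (δ * P / 6) + 2 * (δ * P / 6) + 3 * δ * (12 * P) := by
        have := sum_log_primesIn_le P
        have : 3 * δ * ∑ p ∈ primesIn P, Real.log p ≤ 3 * δ * (12 * P) := by gcongr
        linarith
    _ ≤ 37 * δ * P := by nlinarith [mul_nonneg hδ (Nat.cast_nonneg P : (0 : ℝ) ≤ P)]

theorem SawtoothSandwich.norm_sawSum_sub_le {δ : ℝ} {H : ℕ} {c c' : ℕ → ℂ}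
    (h : SawtoothSandwich δ H c c') {P : ℕ} {u a δ₁ T X : ℝ} (hδ : 0 ≤ δ) (hHδ : H * δ₁ ≤ δ)
    (hδ₁ : 0 ≤ δ₁) (hS : ∀ y : ℝ, T ≤ |y| → |y| ≤ X → ‖primeSum P y‖ ≤ δ₁ * P)
    (hT : 0 ≤ T) (hu : T ≤ u) (ha : 0 ≤ a) (hX : H * u + a ≤ X) (n₀ : ℕ)
    (hn : ∀ n : ℕ, 1 ≤ n → n ≤ H → n ≠ n₀ → T ≤ |n * u - a|) :
    ‖sawSum P u a - if n₀ ∈ Icc 1 H then c n₀ * primeSum P (n₀ * u - a) else 0‖ ≤ 39 * δ * P := by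
  have hpi := Real.pi_gt_three
  have hu0 : 0 ≤ u := hT.trans hu
  have hP0 : (0 : ℝ) ≤ P := Nat.cast_nonneg P
  have hmulX : ∀ n ∈ Icc 1 H, (n : ℝ) * u + a ≤ X ∧ u ≤ n * u := by
    intro n hn
    have h1 : (n : ℝ) ≤ H := by exact_mod_cast (mem_Icc.1 hn).2
    have h2 : (1 : ℝ) ≤ n := by exact_mod_cast (mem_Icc.1 hn).1
    have h3 : (n : ℝ) * u ≤ H * u := by gcongr
    exact ⟨by linarith, le_mul_of_one_le_left hu0 h2⟩
  have hcoef : ∀ n ∈ Icc 1 H, ‖c n‖ ≤ 1 := fun n hn => by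
    have h2 : (1 : ℝ) ≤ n := by exact_mod_cast (mem_Icc.1 hn).1
    refine (h.norm_le n (mem_Icc.1 hn).1).trans ?_
    rw [div_le_one (by positivity)]
    nlinarith
  have hmain := h.sum_abs_sub_le (P := P) (u := u) hδ hHδ fun n hn => by
    obtain ⟨h1, h2⟩ := hmulX n hn
    refine hS _ ?_ ?_ <;> rw [abs_of_nonneg (by positivity)] <;> linarith
  have hneg : ‖∑ n ∈ Icc 1 H, conj (c n) * primeSum P (n * -u - a)‖ ≤ δ * P := by
    refine (norm_sum_le _ _).trans ?_
    calc _ ≤ ∑ n ∈ Icc 1 H, 1 * (δ₁ * P) := by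
          refine sum_le_sum fun n hn => ?_
          obtain ⟨h1, h2⟩ := hmulX n hn
          rw [norm_mul, Complex.norm_conj]
          refine mul_le_mul (hcoef n hn) (hS _ ?_ ?_) (norm_nonneg _) zero_le_one <;>
          rw [show (n : ℝ) * -u - a = -(n * u + a) by ring, abs_neg, abs_of_nonneg (by positivity)]
            <;> linarith
      _ = H * δ₁ * P := by simp; ring
      _ ≤ _ := by gcongr
  have hpos : ‖∑ n ∈ Icc 1 H, c n * primeSum P (n * u - a) -
      if n₀ ∈ Icc 1 H then c n₀ * primeSum P (n₀ * u - a) else 0‖ ≤ δ * P := by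
    rw [← sum_ite_eq' (Icc 1 H) n₀ fun n => c n * primeSum P (n * u - a), ← sum_sub_distrib]
    refine (norm_sum_le _ _).trans ?_
    calc _ ≤ ∑ n ∈ Icc 1 H, 1 * (δ₁ * P) := by
          refine sum_le_sum fun n hn' => ?_
          split_ifs with heq
          · rw [sub_self, norm_zero]; positivity
          · obtain ⟨h1, h2⟩ := hmulX n hn'
            rw [sub_zero, norm_mul]
            refine mul_le_mul (hcoef n hn') (hS _ (hn n (mem_Icc.1 hn').1 (mem_Icc.1 hn').2 heq) ?_)
              (norm_nonneg _) zero_le_one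
            rw [abs_le]; constructor <;> linarith [mul_nonneg (Nat.cast_nonneg n : (0 : ℝ) ≤ n) hu0]
      _ = H * δ₁ * P := by simp; ring
      _ ≤ _ := by gcongr
  have hdiff : ‖sawSum P u a - (∑ n ∈ Icc 1 H, c n * primeSum P (n * u - a) +
      ∑ n ∈ Icc 1 H, conj (c n) * primeSum P (n * -u - a))‖ ≤ 37 * δ * P := by
    refine le_trans ?_ hmain
    rw [← sum_mul_trig_mul, ← sum_mul_trig_mul, sawSum, ← sum_add_distrib, ← sum_sub_distrib]
    refine (norm_sum_le _ _).trans (sum_le_sum fun p _ => ?_)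
    have h1 : ∑ n ∈ Icc 1 H, conj (c n) * e (n * (-u / p)) =
        conj (∑ n ∈ Icc 1 H, c n * e (n * (u / p))) := by
      rw [map_sum]
      refine sum_congr rfl fun n _ => ?_
      rw [map_mul, conj_e]
      congr 2; ring
    rw [h1, ← add_mul, ← mul_add, Complex.add_conj, ← sub_mul, ← mul_sub, norm_mul, norm_mul, norm_e,
      mul_one, ← Complex.ofReal_sub, Complex.norm_real, Complex.norm_real,
      Real.norm_of_nonneg (Real.log_natCast_nonneg p), Real.norm_eq_abs]
  set A := ∑ n ∈ Icc 1 H, c n * primeSum P (n * u - a)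
  set B := ∑ n ∈ Icc 1 H, conj (c n) * primeSum P (n * -u - a)
  set E := if n₀ ∈ Icc 1 H then c n₀ * primeSum P (n₀ * u - a) else 0
  have : sawSum P u a - E = (sawSum P u a - (A + B)) + (A - E) + B := by ring
  rw [this]
  refine (norm_add₃_le).trans ?_
  linarith

end SawtoothSums

/-! ### Lower and upper bounds for the combined sawtooth sum -/

section SawtoothTotal

open Filter

/-- The combination of sawtooth sums that measures the difference between the parts of the
`p`-adic valuations of `C(n, m)` and `C(n', m')` coming from the first power of `p`. -/
noncomputable def sawTotal (P : ℕ) (n m n' m' a : ℝ) : ℂ :=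
  sawSum P m a + sawSum P (n - m) a + sawSum P n' a - sawSum P m' a - sawSum P (n' - m') a -
    sawSum P n a

theorem re_primeSum_nonneg {P : ℕ} {g : ℝ} (hg : |g| ≤ P / 4) : 0 ≤ (primeSum P g).re := by
  rw [primeSum, Complex.re_sum]
  refine sum_nonneg fun p hp => ?_
  rw [Complex.re_ofReal_mul]
  refine mul_nonneg (Real.log_natCast_nonneg p) ?_
  have hPp : P < p := (mem_Ioc.1 (mem_filter.1 hp).1).1
  have hp0 : (0 : ℝ) < p := by exact_mod_cast (Nat.zero_le _).trans_lt hPp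
  have hPp' : (P : ℝ) ≤ p := by exact_mod_cast hPp.le
  have h1 : |g / p| ≤ 1 / 4 := by
    rw [abs_div, abs_of_pos hp0, div_le_iff₀ hp0]; linarith
  rw [abs_le] at h1
  rw [e, show (2 * Real.pi * ((g / p : ℝ) : ℂ) * Complex.I : ℂ) =
    ((2 * Real.pi * (g / p) : ℝ) : ℂ) * Complex.I by push_cast; ring, Complex.exp_ofReal_mul_I_re]
  have hpi := Real.pi_pos
  refine Real.cos_nonneg_of_neg_pi_div_two_le_of_le ?_ ?_ <;> nlinarith

theorem le_norm_primeSum_zero_add {P : ℕ} {g κ : ℝ} (hκ : 0 ≤ κ)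
    (hg : ‖primeSum P g‖ ≤ κ ∨ |g| ≤ P / 4) :
    ∑ p ∈ primesIn P, Real.log p - κ ≤ ‖primeSum P 0 + primeSum P g‖ := by
  refine le_trans ?_ (Complex.re_le_norm _)
  rw [Complex.add_re, primeSum_zero, Complex.ofReal_re]
  rcases hg with hg | hg
  · have := abs_le.1 ((Complex.abs_re_le_norm _).trans hg)
    linarith
  · linarith [re_primeSum_nonneg hg]

theorem SawtoothSandwich.le_norm_one {δ : ℝ} {H : ℕ} {c c' : ℕ → ℂ}
    (h : SawtoothSandwich δ H c c') : 1 / (2 * Real.pi) - δ ≤ ‖c 1‖ := by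
  have h1 : ‖(Complex.I / (2 * Real.pi) : ℂ)‖ = 1 / (2 * Real.pi) := by
    simp [abs_of_pos Real.pi_pos]
  have h2 := norm_sub_norm_le (Complex.I / (2 * Real.pi) : ℂ) (c 1)
  have h3 := h.norm_one_sub_le
  rw [norm_sub_rev] at h3
  linarith

theorem norm_sum_six_sub_le (x₁ x₂ x₃ x₄ x₅ x₆ y₁ y₂ y₃ y₄ y₅ y₆ : ℂ) {κ : ℝ}
    (h₁ : ‖x₁ - y₁‖ ≤ κ) (h₂ : ‖x₂ - y₂‖ ≤ κ) (h₃ : ‖x₃ - y₃‖ ≤ κ) (h₄ : ‖x₄ - y₄‖ ≤ κ)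
    (h₅ : ‖x₅ - y₅‖ ≤ κ) (h₆ : ‖x₆ - y₆‖ ≤ κ) :
    ‖y₁ + y₂ + y₃ - y₄ - y₅ - y₆‖ ≤ ‖x₁ + x₂ + x₃ - x₄ - x₅ - x₆‖ + 6 * κ := by
  have e1 : y₁ + y₂ + y₃ - y₄ - y₅ - y₆ = (x₁ + x₂ + x₃ - x₄ - x₅ - x₆) -
      (((x₁ - y₁) + (x₂ - y₂) + (x₃ - y₃)) - ((x₄ - y₄) + (x₅ - y₅) + (x₆ - y₆))) := by ring
  rw [e1]
  refine (norm_sub_le _ _).trans ?_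
  have h7 := norm_sub_le ((x₁ - y₁) + (x₂ - y₂) + (x₃ - y₃)) ((x₄ - y₄) + (x₅ - y₅) + (x₆ - y₆))
  have h8 := norm_add₃_le (a := x₁ - y₁) (b := x₂ - y₂) (c := x₃ - y₃)
  have h9 := norm_add₃_le (a := x₄ - y₄) (b := x₅ - y₅) (c := x₆ - y₆)
  linarith

section LowerBound

variable {δ δ₁ T X : ℝ} {P H : ℕ} {c c' : ℕ → ℂ}

theorem SawtoothSandwich.le_norm_sawTotal_of_mul_le (h : SawtoothSandwich δ H c c') (hδ : 0 ≤ δ)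
    (hδ' : δ ≤ 1 / 10000) (hHδ : H * δ₁ ≤ δ) (hδ₁ : 0 ≤ δ₁)
    (hS : ∀ y : ℝ, T ≤ |y| → |y| ≤ X → ‖primeSum P y‖ ≤ δ₁ * P) (hT : 0 ≤ T)
    (hθ : (P : ℝ) ≤ ∑ p ∈ primesIn P, Real.log p) {n m n' m' : ℝ} (hm' : T ≤ m') (hmm : m' ≤ m)
    (hn : 4 * H * m ≤ n) (hD : T ≤ n' - n) (hX : (H + 1) * n' ≤ X)
    (hg : T ≤ |n' - m' - n| ∨ |n' - m' - n| ≤ P / 4) :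
    P / 20 ≤ ‖sawTotal P n m n' m' n‖ := by
  have hH1 : (1 : ℝ) ≤ H := by exact_mod_cast h.one_le
  have hm0 : 0 ≤ m := by linarith
  have hHm : m ≤ H * m := le_mul_of_one_le_left hm0 hH1
  have hn0 : 0 ≤ n := by nlinarith
  have hn'0 : 0 ≤ n' := by linarith
  have hX' : ∀ u, u ≤ n' → H * u + n ≤ X := fun u hu => by
    have : H * u ≤ H * n' := by gcongr
    linarith
  have hcast : ∀ k : ℕ, 1 ≤ k → k ≠ 1 → (2 : ℝ) ≤ k := fun k h1 h2 => by
    exact_mod_cast (by omega : 2 ≤ k)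
  have key := fun u hu hX n₀ => h.norm_sawSum_sub_le (P := P) (u := u) (a := n) hδ hHδ hδ₁ hS hT hu
    hn0 hX n₀
  have k1 := key m (by linarith) (hX' _ (by linarith)) 0 fun k h1 h2 _ => by
    have h3 : (k : ℝ) * m ≤ H * m := by gcongr
    exact le_trans (by linarith) (neg_le_abs _)
  have k2 := key (n - m) (by linarith) (hX' _ (by linarith)) 0 fun k h1 h2 _ => by
    rcases eq_or_ne k 1 with rfl | hk
    · refine le_trans ?_ (neg_le_abs _)
      push_cast; linarith
    · have h4 : 2 * (n - m) ≤ k * (n - m) := by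
        gcongr
        · linarith
        · exact hcast k h1 hk
      exact le_trans (by linarith) (le_abs_self _)
  have k3 := key n' (by linarith) (hX' _ le_rfl) 0 fun k h1 h2 _ => by
    have h3 : (1 : ℝ) ≤ k := by exact_mod_cast h1
    have h4 : n' ≤ k * n' := le_mul_of_one_le_left hn'0 h3
    exact le_trans (by linarith) (le_abs_self _)
  have k4 := key m' hm' (hX' _ (by linarith)) 0 fun k h1 h2 _ => by
    have h3 : (k : ℝ) * m' ≤ H * m := by gcongr; linarith
    exact le_trans (by linarith) (neg_le_abs _)
  have k5 := key (n' - m') (by linarith) (hX' _ (by linarith)) 1 fun k h1 h2 hk => by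
    have h4 : 2 * (n' - m') ≤ k * (n' - m') := by
      gcongr
      · linarith
      · exact hcast k h1 hk
    exact le_trans (by linarith) (le_abs_self _)
  have k6 := key n (by linarith) (hX' _ (by linarith)) 1 fun k h1 h2 hk => by
    have h4 : 2 * n ≤ k * n := by
      gcongr
      exact hcast k h1 hk
    exact le_trans (by linarith) (le_abs_self _)
  simp only [mem_Icc, h.one_le, le_refl, true_and, if_true, Nat.cast_one, one_mul,
    nonpos_iff_eq_zero, one_ne_zero, false_and, if_false, sub_self] at k1 k2 k3 k4 k5 k6
  have hsix := norm_sum_six_sub_le _ _ _ _ _ _ _ _ _ _ _ _ k1 k2 k3 k4 k5 k6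
  have hδ₁δ : δ₁ ≤ δ := by nlinarith
  have hgX : |n' - m' - n| ≤ X := by
    have : n' ≤ H * n' := le_mul_of_one_le_left hn'0 hH1
    rw [abs_le]; constructor <;> linarith
  have hge := le_norm_primeSum_zero_add (P := P) (g := n' - m' - n) (κ := δ₁ * P) (by positivity)
    (hg.imp (fun h => hS _ h hgX) id)
  have hc1 := h.le_norm_one
  have hpi : (0.159 : ℝ) ≤ 1 / (2 * Real.pi) := by
    rw [le_div_iff₀ (by positivity)]
    linarith [Real.pi_lt_d4]
  have e1 : (0 : ℂ) + 0 + 0 - 0 - c 1 * primeSum P (n' - m' - n) - c 1 * primeSum P 0 =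
      -(c 1 * (primeSum P 0 + primeSum P (n' - m' - n))) := by ring
  rw [e1, norm_neg, norm_mul] at hsix
  rw [sawTotal]
  have hP0 : (0 : ℝ) ≤ P := Nat.cast_nonneg P
  have h1 : δ₁ * P ≤ 1 / 10000 * P := by gcongr; linarith
  have h2 : 6 * (39 * δ * P) ≤ 6 * (39 * (1 / 10000) * P) := by gcongr
  have h3 : (0.15 : ℝ) * (0.9 * P) ≤ ‖c 1‖ * ‖primeSum P 0 + primeSum P (n' - m' - n)‖ := by
    gcongr
    · linarith
    · linarith
  linarith

theorem SawtoothSandwich.le_norm_sawTotal_of_le_sub (h : SawtoothSandwich δ H c c') (hδ : 0 ≤ δ)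
    (hδ' : δ ≤ 1 / 10000) (hHδ : H * δ₁ ≤ δ) (hδ₁ : 0 ≤ δ₁)
    (hS : ∀ y : ℝ, T ≤ |y| → |y| ≤ X → ‖primeSum P y‖ ≤ δ₁ * P) (hT : 0 ≤ T)
    (hθ : (P : ℝ) ≤ ∑ p ∈ primesIn P, Real.log p) {n m n' m' : ℝ} (hm' : 2 * T ≤ m')
    (hd : T ≤ m - m') (hmn : 2 * m ≤ n) (hnn : n ≤ n') (hX : (H + 1) * n' ≤ X)
    (hg : T ≤ n - 2 * m ∨ n - 2 * m ≤ P / 4) :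
    P / 20 ≤ ‖sawTotal P n m n' m' m‖ := by
  have hH1 : (1 : ℝ) ≤ H := by exact_mod_cast h.one_le
  have hm0 : 0 ≤ m := by linarith
  have hn'0 : 0 ≤ n' := by linarith
  have hX' : ∀ u, u ≤ n' → H * u + m ≤ X := fun u hu => by
    have : H * u ≤ H * n' := by gcongr
    linarith
  have hcast : ∀ k : ℕ, 1 ≤ k → k ≠ 1 → (2 : ℝ) ≤ k := fun k h1 h2 => by
    exact_mod_cast (by omega : 2 ≤ k)
  have key := fun u hu hX n₀ => h.norm_sawSum_sub_le (P := P) (u := u) (a := m) hδ hHδ hδ₁ hS hT hu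
    hm0 hX n₀
  have hmul : ∀ k : ℕ, 1 ≤ k → ∀ u : ℝ, 0 ≤ u → u ≤ k * u := fun k hk u hu =>
    le_mul_of_one_le_left hu (by exact_mod_cast hk)
  have k1 := key m (by linarith) (hX' _ (by linarith)) 1 fun k h1 h2 hk => by
    have h4 : 2 * m ≤ k * m := by
      gcongr
      exact hcast k h1 hk
    exact le_trans (by linarith) (le_abs_self _)
  have k2 := key (n - m) (by linarith) (hX' _ (by linarith)) 1 fun k h1 h2 hk => by
    have h4 : 2 * (n - m) ≤ k * (n - m) := by
      gcongr
      · linarith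
      · exact hcast k h1 hk
    exact le_trans (by linarith) (le_abs_self _)
  have k3 := key n' (by linarith) (hX' _ le_rfl) 0 fun k h1 h2 _ =>
    le_trans (by linarith [hmul k h1 n' hn'0]) (le_abs_self _)
  have k5 := key (n' - m') (by linarith) (hX' _ (by linarith)) 0 fun k h1 h2 hk =>
    le_trans (by linarith [hmul k h1 (n' - m') (by linarith)]) (le_abs_self _)
  have k6 := key n (by linarith) (hX' _ (by linarith)) 0 fun k h1 h2 hk =>
    le_trans (by linarith [hmul k h1 n (by linarith)]) (le_abs_self _)
  obtain ⟨n₀, hn₀1, hn₀⟩ : ∃ n₀ : ℕ, n₀ ≠ 1 ∧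
      ∀ k : ℕ, 1 ≤ k → k ≤ H → k ≠ n₀ → T ≤ |k * m' - m| := by
    by_cases hex : ∃ k : ℕ, 1 ≤ k ∧ |k * m' - m| < T
    · obtain ⟨k₀, hk₀, hk₀T⟩ := hex
      rw [abs_lt] at hk₀T
      refine ⟨k₀, ?_, fun k hk _ hne => ?_⟩
      · rintro rfl
        push_cast at hk₀T
        linarith
      · rcases Nat.lt_or_gt_of_ne hne with hlt | hlt
        · have h3 : (k : ℝ) + 1 ≤ k₀ := by exact_mod_cast hlt
          have h4 : ((k : ℝ) + 1) * m' ≤ k₀ * m' := by gcongr; linarith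
          exact le_trans (by linarith) (neg_le_abs _)
        · have h3 : (k₀ : ℝ) + 1 ≤ k := by exact_mod_cast hlt
          have h4 : ((k₀ : ℝ) + 1) * m' ≤ k * m' := by gcongr; linarith
          exact le_trans (by linarith) (le_abs_self _)
    · push Not at hex
      exact ⟨0, by norm_num, fun k hk _ _ => hex k hk⟩
  have k4 := key m' (by linarith) (hX' _ (by linarith)) n₀ hn₀
  set z : ℂ := if n₀ ∈ Icc 1 H then c n₀ * primeSum P (n₀ * m' - m) else 0 with hz
  simp only [mem_Icc, h.one_le, le_refl, true_and, if_true, Nat.cast_one, one_mul,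
    nonpos_iff_eq_zero, one_ne_zero, false_and, if_false, sub_self] at k1 k2 k3 k5 k6
  have hsix := norm_sum_six_sub_le _ _ _ _ _ _ _ _ _ _ _ _ k1 k2 k3 k4 k5 k6
  have hδ₁δ : δ₁ ≤ δ := by nlinarith
  have hP0 : (0 : ℝ) ≤ P := Nat.cast_nonneg P
  set θ := ∑ p ∈ primesIn P, Real.log p with hθdef
  have hz4 : ‖z‖ ≤ 1 / (2 * Real.pi) / 2 * θ := by
    rw [hz]
    split_ifs with hmem
    · have hn1 := (mem_Icc.1 hmem).1
      have hn2 := hcast n₀ hn1 hn₀1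
      rw [norm_mul]
      gcongr
      · refine (h.norm_le n₀ hn1).trans ?_
        rw [div_div]
        gcongr
      · refine (norm_sum_le _ _).trans (le_of_eq ?_)
        refine sum_congr rfl fun p _ => ?_
        rw [norm_mul, norm_e, mul_one, Complex.norm_real,
          Real.norm_of_nonneg (Real.log_natCast_nonneg p)]
    · rw [norm_zero]
      have : 0 ≤ θ := by linarith
      positivity
  have e2 : n - m - m = n - 2 * m := by ring
  rw [e2] at hsix
  have hgX : |n - 2 * m| ≤ X := by
    have : n' ≤ H * n' := le_mul_of_one_le_left hn'0 hH1
    rw [abs_le]; constructor <;> linarith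
  have habs : |n - 2 * m| = n - 2 * m := abs_of_nonneg (by linarith)
  have hge := le_norm_primeSum_zero_add (P := P) (g := n - 2 * m) (κ := δ₁ * P) (by positivity)
    (hg.imp (fun h => hS _ (by rwa [habs]) hgX) (fun h => by rwa [habs]))
  have hc1 := h.le_norm_one
  have hpi : (0.159 : ℝ) ≤ 1 / (2 * Real.pi) := by
    rw [le_div_iff₀ (by positivity)]
    linarith [Real.pi_lt_d4]
  have hpi2 : 1 / (2 * Real.pi) ≤ (0.16 : ℝ) := by
    rw [div_le_iff₀ (by positivity)]
    linarith [Real.pi_gt_d4]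
  have e1 : c 1 * primeSum P 0 + c 1 * primeSum P (n - 2 * m) + 0 - z - 0 - 0 =
      c 1 * (primeSum P 0 + primeSum P (n - 2 * m)) - z := by ring
  rw [e1] at hsix
  have hsub := norm_sub_norm_le (c 1 * (primeSum P 0 + primeSum P (n - 2 * m))) z
  rw [norm_mul] at hsub
  rw [sawTotal]
  have h1 : δ₁ * P ≤ 1 / 10000 * P := by gcongr; linarith
  have h2 : 6 * (39 * δ * P) ≤ 6 * (39 * (1 / 10000) * P) := by gcongr
  have h3 : (0.158 : ℝ) * (θ - 1 / 10000 * P) ≤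
      ‖c 1‖ * ‖primeSum P 0 + primeSum P (n - 2 * m)‖ := by
    have : 0 ≤ θ - 1 / 10000 * P := by linarith
    gcongr
    · linarith
    · linarith
  have h4 : 1 / (2 * Real.pi) / 2 * θ ≤ 0.08 * θ := by
    have : 0 ≤ θ := by linarith
    gcongr
    linarith
  linarith

end LowerBound

theorem div_pow_eq_of_notMem_squareHits {P a b d : ℕ} (hab : a ≤ b) (hd : d ∈ Ioc P (8 * P))
    (h : d ∉ squareHits P a b) {i : ℕ} (hi : 2 ≤ i) : a / d ^ i = b / d ^ i := by
  have hd0 : 0 < d := (Nat.zero_le _).trans_lt (mem_Ioc.1 hd).1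
  refine le_antisymm (Nat.div_le_div_right hab) ?_
  by_contra! hlt
  refine h (mem_filter.2 ⟨hd, b / d ^ i * d ^ (i - 2), ?_, ?_⟩)
  · have h1 : 1 ≤ b / d ^ i := (Nat.zero_le _).trans_lt hlt
    refine mem_Icc.2 ⟨Nat.mul_pos h1 (by positivity), ?_⟩
    calc b / d ^ i * d ^ (i - 2) ≤ b / d ^ i * d ^ i := by
          gcongr
          exact Nat.sub_le _ _
      _ ≤ b := Nat.div_mul_le_self _ _
  · rw [mul_assoc, ← pow_add, Nat.sub_add_cancel hi]
    exact ⟨(Nat.div_lt_iff_lt_mul (by positivity)).1 hlt, Nat.div_mul_le_self _ _⟩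

theorem factorial_mul_eq_of_choose_eq {n m n' m' : ℕ} (hmn : m ≤ n) (hmn' : m' ≤ n')
    (h : n.choose m = n'.choose m') :
    n.factorial * (m'.factorial * (n' - m').factorial) =
      n'.factorial * (m.factorial * (n - m).factorial) := by
  rw [← Nat.choose_mul_factorial_mul_factorial hmn,
    ← Nat.choose_mul_factorial_mul_factorial hmn', h]
  ring

theorem div_add_div_eq_of_choose_eq {n m n' m' p : ℕ} (hp : p.Prime) (hmn : m ≤ n)
    (hmn' : m' ≤ n') (h : n.choose m = n'.choose m')
    (hi : ∀ i, 2 ≤ i → n / p ^ i + (m' / p ^ i + (n' - m') / p ^ i) =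
      n' / p ^ i + (m / p ^ i + (n - m) / p ^ i)) :
    n / p + (m' / p + (n' - m') / p) = n' / p + (m / p + (n - m) / p) := by
  have : Fact p.Prime := ⟨hp⟩
  have h1 := congrArg (padicValNat p) (factorial_mul_eq_of_choose_eq hmn hmn' h)
  have hlog : ∀ x, x ≤ n + n' → Nat.log p x < Nat.log p (n + n') + 2 := fun x hx =>
    (Nat.log_mono_right hx).trans_lt (by omega)
  have hne : ∀ x : ℕ, x.factorial ≠ 0 := Nat.factorial_ne_zero
  rw [padicValNat.mul (hne _) (mul_ne_zero (hne _) (hne _)), padicValNat.mul (hne _) (hne _),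
    padicValNat.mul (hne _) (mul_ne_zero (hne _) (hne _)), padicValNat.mul (hne _) (hne _),
    padicValNat_factorial (hlog n (by omega)), padicValNat_factorial (hlog m' (by omega)),
    padicValNat_factorial (hlog (n' - m') (by omega)), padicValNat_factorial (hlog n' (by omega)),
    padicValNat_factorial (hlog m (by omega)), padicValNat_factorial (hlog (n - m) (by omega)),
    ← sum_add_distrib, ← sum_add_distrib, ← sum_add_distrib, ← sum_add_distrib,
    sum_eq_sum_Ico_succ_bot (show 1 < Nat.log p (n + n') + 2 by omega),
    sum_eq_sum_Ico_succ_bot (show 1 < Nat.log p (n + n') + 2 by omega),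
    sum_congr rfl fun i hi' => hi i (mem_Ico.1 hi').1] at h1
  simpa using h1

theorem natCast_div_eq_sub_saw (x p : ℕ) :
    ((x / p : ℕ) : ℝ) = (x : ℝ) / p - 1 / 2 - saw ((x : ℝ) / p) := by
  rw [saw, Int.fract, ← natCast_floor_eq_intCast_floor (by positivity), Nat.floor_div_eq_div]
  ring

theorem saw_add_eq_zero_of_choose_eq {n m n' m' p : ℕ} (hp : p.Prime) (hmn : m ≤ n)
    (hmn' : m' ≤ n') (h : n.choose m = n'.choose m')
    (hi : ∀ i, 2 ≤ i → n / p ^ i + (m' / p ^ i + (n' - m') / p ^ i) =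
      n' / p ^ i + (m / p ^ i + (n - m) / p ^ i)) :
    saw (m / p) + saw ((n - m) / p) + saw (n' / p) - saw (m' / p) - saw ((n' - m') / p) -
      saw (n / p) = 0 := by
  have h1 := div_add_div_eq_of_choose_eq hp hmn hmn' h hi
  have h2 : ((n / p : ℕ) : ℝ) + ((m' / p : ℕ) + ((n' - m') / p : ℕ)) =
      (n' / p : ℕ) + ((m / p : ℕ) + ((n - m) / p : ℕ)) := by exact_mod_cast h1
  rw [natCast_div_eq_sub_saw, natCast_div_eq_sub_saw, natCast_div_eq_sub_saw,
    natCast_div_eq_sub_saw, natCast_div_eq_sub_saw, natCast_div_eq_sub_saw, Nat.cast_sub hmn,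
    Nat.cast_sub hmn'] at h2
  rw [sub_div, sub_div] at h2 ⊢
  linarith

theorem abs_saw_le (x : ℝ) : |saw x| ≤ 1 / 2 := by
  rw [saw, abs_le]
  constructor <;> linarith [Int.fract_nonneg x, Int.fract_lt_one x]

/-- If the higher powers of every prime in `primesIn P` outside `S` contribute equally to both
binomial coefficients, then `sawTotal` is bounded in terms of the size of `S`. -/
theorem norm_sawTotal_le_of_choose_eq {P n m n' m' : ℕ} (a : ℝ) (S : Finset ℕ) (hmn : m ≤ n)
    (hmn' : m' ≤ n') (h : n.choose m = n'.choose m')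
    (hS : ∀ p ∈ primesIn P, p ∉ S → ∀ i, 2 ≤ i →
      n / p ^ i + (m' / p ^ i + (n' - m') / p ^ i) =
        n' / p ^ i + (m / p ^ i + (n - m) / p ^ i)) :
    ‖sawTotal P n m n' m' a‖ ≤ #S * (3 * Real.log (8 * P)) := by
  have e1 : sawTotal P n m n' m' a = ∑ p ∈ primesIn P, ((Real.log p *
      (saw (m / p) + saw ((n - m) / p) + saw (n' / p) - saw (m' / p) - saw ((n' - m') / p) -
        saw (n / p)) : ℝ) : ℂ) * e (-a / p) := by
    simp only [sawTotal, sawSum, ← sum_add_distrib, ← sum_sub_distrib]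
    refine sum_congr rfl fun p _ => ?_
    push_cast
    ring
  have e2 : ∀ p ∈ primesIn P, ‖((Real.log p *
      (saw (m / p) + saw ((n - m) / p) + saw (n' / p) - saw (m' / p) - saw ((n' - m') / p) -
        saw (n / p)) : ℝ) : ℂ) * e (-a / p)‖ ≤ if p ∈ S then 3 * Real.log (8 * P) else 0 := by
    intro p hp
    obtain ⟨hpP, hpp⟩ := mem_filter.1 hp
    obtain ⟨hPp, hp8⟩ := mem_Ioc.1 hpP
    rw [norm_mul, norm_e, mul_one, Complex.norm_real, norm_mul]
    split_ifs with hpS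
    · rw [mul_comm]
      have h1 := fun x => abs_le.1 (abs_saw_le x)
      have h2 : (1 : ℝ) ≤ p := by exact_mod_cast hpp.one_le
      have h3 : (p : ℝ) ≤ 8 * P := by exact_mod_cast hp8
      gcongr
      · rw [Real.norm_eq_abs, abs_le]
        constructor <;>
        linarith [h1 (m / p), h1 ((n - m) / p), h1 (n' / p), h1 (m' / p), h1 ((n' - m') / p),
          h1 (n / p)]
      · rw [Real.norm_of_nonneg (Real.log_nonneg h2)]
        gcongr
    · rw [saw_add_eq_zero_of_choose_eq hpp hmn hmn' h (hS p hp hpS), norm_zero, mul_zero]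
  rw [e1]
  refine (norm_sum_le_of_le _ e2).trans ?_
  rw [← sum_filter, sum_const, nsmul_eq_mul]
  rcases P.eq_zero_or_pos with rfl | hP
  · simp [primesIn]
  have h8 : (1 : ℝ) ≤ 8 * P := by
    have : (1 : ℝ) ≤ P := by exact_mod_cast hP
    linarith
  have := Real.log_nonneg h8
  gcongr
  exact fun p hp => (mem_filter.1 hp).2

theorem eventually_norm_sawTotal_lt {ε : ℝ} (hε : 0 < ε) (hε1 : ε ≤ 1) (A : ℕ) :
    ∀ᶠ P : ℕ in atTop, ∀ (n m n' m' : ℕ) (a : ℝ), m ≤ n → m' ≤ m → n ≤ n' →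
      n.choose m = n'.choose m' → Real.log n' ≤ Real.log P ^ (3 / 2 - ε) →
      ((n' : ℝ) - n + (m - m') ≤ P * Real.log P ^ A ∨ (m : ℝ) ≤ P * Real.log P ^ A) →
      ‖sawTotal P n m n' m' a‖ < P / 20 := by
  have hsq : ∀ᶠ P : ℕ in atTop, (P : ℝ) * Real.log P ^ A ≤ P ^ 2 := by
    filter_upwards [tendsto_log_natCast.eventually
      (eventually_mul_pow_le_exp_rpow 1 A one_pos one_pos), eventually_gt_atTop 0] with P hP hP0
    have hP0' : (0 : ℝ) < P := by exact_mod_cast hP0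
    rw [Real.rpow_one, one_mul, one_mul, Real.exp_log hP0'] at hP
    rw [sq]
    gcongr
  filter_upwards [eventually_card_squareHits_le hε hε1 A, hsq, eventually_gt_atTop 0,
    tendsto_log_natCast.eventually_ge_atTop 20000] with P hcard hsq hP0 hlog
  intro n m n' m' a hmn hmm hnn hchoose hn' hdisj
  have hP0' : (0 : ℝ) < P := by exact_mod_cast hP0
  have hb : ∀ b : ℕ, b ≤ n' → Real.log b ≤ Real.log P ^ (3 / 2 - ε) := fun b hb => by
    rcases b.eq_zero_or_pos with rfl | hb0
    · simp only [Nat.cast_zero, Real.log_zero]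
      exact Real.rpow_nonneg (by linarith) _
    · refine le_trans (Real.log_le_log (by exact_mod_cast hb0) (by exact_mod_cast hb)) hn'
  suffices h : ∃ S : Finset ℕ, (#S : ℝ) ≤ 3 * (32 * P / Real.log P ^ 2) ∧
      ∀ p ∈ primesIn P, p ∉ S → ∀ i, 2 ≤ i →
        n / p ^ i + (m' / p ^ i + (n' - m') / p ^ i) =
          n' / p ^ i + (m / p ^ i + (n - m) / p ^ i) by
    obtain ⟨S, hS, hSp⟩ := h
    refine (norm_sawTotal_le_of_choose_eq a S hmn (hmm.trans (hmn.trans hnn)) hchoose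
      hSp).trans_lt ?_
    have h8 : Real.log (8 * P) ≤ 2 * Real.log P := by
      rw [Real.log_mul (by norm_num) hP0'.ne']
      have := Real.log_le_sub_one_of_pos (show (0 : ℝ) < 8 by norm_num)
      linarith
    calc (#S : ℝ) * (3 * Real.log (8 * P))
        ≤ 3 * (32 * P / Real.log P ^ 2) * (3 * (2 * Real.log P)) := by
          have : 0 ≤ Real.log (8 * P) := by
            rw [Real.log_mul (by norm_num) hP0'.ne']
            have := Real.log_nonneg (show (1 : ℝ) ≤ 8 by norm_num)
            linarith
          gcongr
      _ = P * (576 / Real.log P) := by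
        have : Real.log P ≠ 0 := by linarith
        field_simp
        norm_num
      _ < P * (1 / 20) := by
        refine mul_lt_mul_of_pos_left ?_ hP0'
        rw [div_lt_div_iff₀ (by linarith) (by norm_num)]
        linarith
      _ = P / 20 := by ring
  rcases hdisj with hA | hB
  · have hmmR : (m' : ℝ) ≤ m := by exact_mod_cast hmm
    have hnnR : (n : ℝ) ≤ n' := by exact_mod_cast hnn
    refine ⟨squareHits P n n' ∪ squareHits P m' m ∪ squareHits P (n - m) (n' - m'), ?_,
      fun p hp hpS i hi => ?_⟩
    · have h0 : (#(squareHits P n n' ∪ squareHits P m' m ∪ squareHits P (n - m) (n' - m')) : ℝ) ≤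
          #(squareHits P n n') + #(squareHits P m' m) + #(squareHits P (n - m) (n' - m')) := by
        exact_mod_cast (card_union_le _ _).trans (Nat.add_le_add_right (card_union_le _ _) _)
      have h1 := hcard n n' (by linarith) (hb _ le_rfl)
      have h2 := hcard m' m (by linarith) (hb _ (hmn.trans hnn))
      have h3 := hcard (n - m) (n' - m') (by
        rw [Nat.cast_sub hmn, Nat.cast_sub (hmm.trans (hmn.trans hnn))]
        linarith) (hb _ (Nat.sub_le _ _))
      linarith
    · simp only [mem_union, not_or] at hpS
      have hpP := (mem_filter.1 hp).1
      rw [div_pow_eq_of_notMem_squareHits hnn hpP hpS.1.1 hi,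
        div_pow_eq_of_notMem_squareHits hmm hpP hpS.1.2 hi,
        div_pow_eq_of_notMem_squareHits (by omega) hpP hpS.2 hi]
  · have hmmR : (m' : ℝ) ≤ m := by exact_mod_cast hmm
    refine ⟨squareHits P (n - m) n ∪ squareHits P (n' - m') n', ?_, fun p hp hpS i hi => ?_⟩
    · have h0 : (#(squareHits P (n - m) n ∪ squareHits P (n' - m') n') : ℝ) ≤
          #(squareHits P (n - m) n) + #(squareHits P (n' - m') n') := by
        exact_mod_cast card_union_le _ _
      have h1 := hcard (n - m) n (by rw [Nat.cast_sub hmn]; linarith) (hb _ hnn)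
      have h2 := hcard (n' - m') n' (by
        rw [Nat.cast_sub (hmm.trans (hmn.trans hnn))]
        linarith) (hb _ le_rfl)
      have h3 : 0 ≤ 32 * P / Real.log P ^ 2 := by positivity
      linarith
    · simp only [mem_union, not_or] at hpS
      have hpP := (mem_filter.1 hp).1
      have hPp := (mem_Ioc.1 hpP).1
      have hm2 : m < p ^ i := by
        have h1 : m ≤ P ^ 2 := by exact_mod_cast hB.trans hsq
        calc m ≤ P ^ 2 := h1
          _ < p ^ 2 := Nat.pow_lt_pow_left hPp (by norm_num)
          _ ≤ p ^ i := Nat.pow_le_pow_right (by omega) hi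
      rw [← div_pow_eq_of_notMem_squareHits (Nat.sub_le _ _) hpP hpS.1 hi,
        ← div_pow_eq_of_notMem_squareHits (Nat.sub_le _ _) hpP hpS.2 hi,
        Nat.div_eq_of_lt hm2, Nat.div_eq_of_lt (hmm.trans_lt hm2)]
      ring

/-- Two equal binomial coefficients cannot satisfy the listed inequalities relating their
arguments to an auxiliary large parameter `P`. -/
theorem exists_forall_choose_ne {ε : ℝ} (hε : 0 < ε) (hε1 : ε ≤ 1) :
    ∃ H : ℕ, 1 ≤ H ∧ ∀ A : ℕ, ∀ᶠ P : ℕ in atTop, ∀ n m n' m' : ℕ, m' ≤ m → 2 * m ≤ n → n < n' →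
      Real.log ((H + 1) * n') ≤ Real.log P ^ (3 / 2 - ε) →
      ((n' : ℝ) - n + (m - m') ≤ P * Real.log P ^ A ∨ (m : ℝ) ≤ P * Real.log P ^ A) →
      2 * (P * Real.log P ^ 15) ≤ (m' : ℝ) →
      ((4 * H * (m : ℝ) ≤ n ∧ P * Real.log P ^ 15 ≤ (n' : ℝ) - n ∧
          (P * Real.log P ^ 15 ≤ |(n' : ℝ) - m' - n| ∨ |(n' : ℝ) - m' - n| ≤ P / 4)) ∨
        (P * Real.log P ^ 15 ≤ (m : ℝ) - m' ∧
          (P * Real.log P ^ 15 ≤ (n : ℝ) - 2 * m ∨ (n : ℝ) - 2 * m ≤ P / 4))) →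
      n.choose m ≠ n'.choose m' := by
  obtain ⟨H, c, c', h⟩ := exists_sawtoothSandwich (show (0 : ℝ) < 1 / 10000 by norm_num)
  have hH := h.one_le
  have hH' : (1 : ℝ) ≤ H := by exact_mod_cast hH
  refine ⟨H, hH, fun A => ?_⟩
  have hδ₁ : (0 : ℝ) < 1 / 10000 / H := by positivity
  filter_upwards [eventually_norm_sawTotal_lt hε hε1 A, eventually_norm_primeSum_le hε hε1 hδ₁,
    eventually_le_sum_log_primesIn, eventually_gt_atTop 0] with P hlt hS hθ hP0
  intro n m n' m' hmm hmn hnn hlogX hdisj hm' hcase hchoose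
  have hlogP : 0 ≤ Real.log P := Real.log_natCast_nonneg P
  have hn'1 : (1 : ℝ) ≤ n' := by exact_mod_cast (by omega : 1 ≤ n')
  have hX1 : (1 : ℝ) ≤ (H + 1) * n' := by nlinarith
  have hn'X : (n' : ℝ) ≤ (H + 1) * n' := by nlinarith
  have hub := fun a => hlt n m n' m' a (by omega) hmm hnn.le hchoose
    ((Real.log_le_log (by linarith) hn'X).trans hlogX) hdisj
  have hT : 0 ≤ (P : ℝ) * Real.log P ^ 15 := by positivity
  have hP1 : (1 : ℝ) ≤ P := by exact_mod_cast hP0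
  have hSX : ∀ y : ℝ, P * Real.log P ^ 15 ≤ |y| → |y| ≤ (H + 1) * n' →
      ‖primeSum P y‖ ≤ 1 / 10000 / H * P := fun y h1 h2 => by
    refine hS y h1 (le_trans ?_ hlogX)
    rcases eq_or_ne y 0 with rfl | hy
    · rw [abs_zero, Real.log_zero]
      exact Real.log_nonneg hX1
    · exact Real.log_le_log (abs_pos.2 hy) h2
  have hHδ : (H : ℝ) * (1 / 10000 / H) ≤ 1 / 10000 := by
    rw [mul_div_cancel₀ _ (by positivity)]
  have hmmR : (m' : ℝ) ≤ m := by exact_mod_cast hmm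
  have hmnR : 2 * (m : ℝ) ≤ n := by exact_mod_cast hmn
  have hnnR : (n : ℝ) ≤ n' := by exact_mod_cast hnn.le
  rcases hcase with ⟨h1, h2, h3⟩ | ⟨h1, h2⟩
  · exact absurd (h.le_norm_sawTotal_of_mul_le (by norm_num) le_rfl hHδ hδ₁.le hSX hT hθ
      (by linarith) hmmR h1 h2 le_rfl h3) (not_le.2 (hub n))
  · exact absurd (h.le_norm_sawTotal_of_le_sub (by norm_num) le_rfl hHδ hδ₁.le hSX hT hθ
      hm' h1 hmnR hnnR le_rfl h2) (not_le.2 (hub m))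

end SawtoothTotal

/-! ### Sizes of equal binomial coefficients -/

section Distance

open Filter

theorem two_pow_le_centralBinom (m : ℕ) : 2 ^ m ≤ m.centralBinom := by
  induction m with
  | zero => simp
  | succ m ih =>
    have h := Nat.succ_mul_centralBinom_succ m
    rw [pow_succ]
    nlinarith

theorem two_pow_le_choose {n m : ℕ} (h : 2 * m ≤ n) : 2 ^ m ≤ n.choose m :=
  (two_pow_le_centralBinom m).trans (Nat.choose_le_choose m h)

theorem choose_lt_choose_add_one {n m : ℕ} (h : 2 * (m + 1) ≤ n) :
    n.choose m < n.choose (m + 1) := by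
  have h0 := Nat.choose_succ_right_eq n m
  have hpos := Nat.choose_pos (show m ≤ n by omega)
  have h1 : m + 1 < n - m := by omega
  by_contra! hle
  have h2 : n.choose (m + 1) * (m + 1) ≤ n.choose m * (m + 1) := by gcongr
  have h3 : n.choose m * (m + 1) < n.choose m * (n - m) := Nat.mul_lt_mul_of_pos_left h1 hpos
  omega

theorem choose_lt_choose_right {n k m : ℕ} (hkm : k < m) (hmn : 2 * m ≤ n) :
    n.choose k < n.choose m := by
  induction m, hkm using Nat.le_induction with
  | base => exact choose_lt_choose_add_one hmn
  | succ m hm ih => exact (ih (by omega)).trans (choose_lt_choose_add_one hmn)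

theorem choose_add_one_le {n m : ℕ} (hmn : 3 * (m + 1) ≤ n) :
    (n + 1).choose m ≤ n.choose (m + 1) := by
  have h1 := Nat.choose_succ_right_eq n m
  have h2 := Nat.choose_mul_succ_eq n m
  obtain ⟨q, rfl⟩ := Nat.exists_eq_add_of_le hmn
  rw [show 3 * (m + 1) + q - m = 2 * m + 3 + q by omega] at h1
  rw [show 3 * (m + 1) + q + 1 - m = 2 * m + 4 + q by omega] at h2
  set a := (3 * (m + 1) + q).choose m
  set b := (3 * (m + 1) + q + 1).choose m
  have h3 : (3 * (m + 1) + q + 1) * (m + 1) ≤ (2 * m + 4 + q) * (2 * m + 3 + q) := by nlinarith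
  have h4 : b * ((2 * m + 4 + q) * (2 * m + 3 + q)) ≤
      (3 * (m + 1) + q).choose (m + 1) * ((2 * m + 4 + q) * (2 * m + 3 + q)) := by
    calc b * ((2 * m + 4 + q) * (2 * m + 3 + q))
        = (b * (2 * m + 4 + q)) * (2 * m + 3 + q) := by ring
      _ = (a * (2 * m + 3 + q)) * (3 * (m + 1) + q + 1) := by rw [← h2]; ring
      _ = (3 * (m + 1) + q).choose (m + 1) * ((3 * (m + 1) + q + 1) * (m + 1)) := by
        rw [← h1]; ring
      _ ≤ _ := by gcongr
  exact Nat.le_of_mul_le_mul_right h4 (by positivity)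

theorem choose_add_sub_le {n m j : ℕ} (hmn : 3 * m ≤ n) (hj : j ≤ m) :
    (n + j).choose (m - j) ≤ n.choose m := by
  induction j with
  | zero => simp
  | succ j ih =>
    refine le_trans ?_ (ih (by omega))
    have h := choose_add_one_le (n := n + j) (m := m - (j + 1)) (by omega)
    rwa [show m - (j + 1) + 1 = m - j by omega] at h

theorem lt_of_choose_eq {n m n' m' : ℕ} (hm : m' < m) (hmn : 2 * m ≤ n)
    (h : n.choose m = n'.choose m') : n < n' := by
  by_contra! hle
  have h1 := Nat.choose_le_choose m' hle
  have h2 := choose_lt_choose_right hm hmn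
  omega

theorem add_le_add_of_choose_eq {n m n' m' : ℕ} (hm : m' < m) (hmn : 3 * m ≤ n)
    (h : n.choose m = n'.choose m') : n + m ≤ n' + m' := by
  have hnn := lt_of_choose_eq hm (by omega) h
  by_contra! hlt
  have h1 := choose_add_sub_le (j := n' - n) hmn (by omega)
  rw [Nat.add_sub_cancel' hnn.le] at h1
  have h2 := choose_lt_choose_right (n := n') (k := m') (m := m - (n' - n)) (by omega) (by omega)
  omega

theorem mul_log_two_le_of_choose_eq {n m n' m' : ℕ} (hmn : 2 * m ≤ n)
    (h : n.choose m = n'.choose m') : m * Real.log 2 ≤ m' * Real.log n' := by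
  have h1 : 2 ^ m ≤ n' ^ m' := (two_pow_le_choose hmn).trans (h ▸ Nat.choose_le_pow n' m')
  have h2 : (2 : ℝ) ^ m ≤ (n' : ℝ) ^ m' := by exact_mod_cast h1
  have h3 := Real.log_le_log (by positivity) h2
  rwa [Real.log_pow, Real.log_pow] at h3

theorem pow_mul_descFactorial_le {n n' : ℕ} (hn : n ≤ n') (k : ℕ) :
    n' ^ k * n.descFactorial k ≤ n ^ k * n'.descFactorial k := by
  induction k with
  | zero => simp
  | succ k ih =>
    rw [Nat.descFactorial_succ, Nat.descFactorial_succ, pow_succ, pow_succ]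
    have h : n' * (n - k) ≤ n * (n' - k) := by
      rw [Nat.mul_sub, Nat.mul_sub, mul_comm n' n]
      exact Nat.sub_le_sub_left (Nat.mul_le_mul_right k hn) _
    calc n' ^ k * n' * ((n - k) * n.descFactorial k)
        = (n' ^ k * n.descFactorial k) * (n' * (n - k)) := by ring
      _ ≤ (n ^ k * n'.descFactorial k) * (n * (n' - k)) := by gcongr
      _ = _ := by ring

theorem pow_mul_choose_le {n n' : ℕ} (hn : n ≤ n') (k : ℕ) :
    n' ^ k * n.choose k ≤ n ^ k * n'.choose k := by
  have h := pow_mul_descFactorial_le hn k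
  rw [Nat.descFactorial_eq_factorial_mul_choose, Nat.descFactorial_eq_factorial_mul_choose] at h
  refine Nat.le_of_mul_le_mul_left ?_ (Nat.factorial_pos k)
  calc _ = n' ^ k * (k.factorial * n.choose k) := by ring
    _ ≤ _ := h
    _ = _ := by ring

theorem choose_add_mul_pow_le (n k j : ℕ) : n.choose (k + j) * k ^ j ≤ n.choose k * n ^ j := by
  induction j with
  | zero => simp
  | succ j ih =>
    have h := Nat.choose_succ_right_eq n (k + j)
    calc n.choose (k + (j + 1)) * k ^ (j + 1) = (n.choose (k + j + 1) * k) * k ^ j := by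
          rw [pow_succ, add_assoc]; ring
      _ ≤ (n.choose (k + j + 1) * (k + j + 1)) * k ^ j := by
        gcongr
        omega
      _ = (n.choose (k + j) * k ^ j) * (n - (k + j)) := by rw [h]; ring
      _ ≤ (n.choose k * n ^ j) * n := by
        gcongr
        exact Nat.sub_le _ _
      _ = _ := by ring

theorem sub_le_mul_sub_of_choose_eq {n m n' m' : ℕ} {R : ℝ} (hm' : 1 ≤ m') (hm : m' < m)
    (hmn : 2 * m ≤ n) (hmm : m ≤ 2 * m') (hR : (n : ℝ) ≤ R * m)
    (h : n.choose m = n'.choose m') :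
    (n' : ℝ) - n ≤ 4 * R ^ 2 * Real.log (2 * R) * ((m : ℝ) - m') := by
  have hnn := lt_of_choose_eq hm hmn h
  obtain ⟨d, rfl⟩ := Nat.exists_eq_add_of_le hm.le
  have hm'0 : (0 : ℝ) < m' := by exact_mod_cast hm'
  have hn0 : (0 : ℝ) < n := by exact_mod_cast (by omega : 0 < n)
  have hn'0 : (0 : ℝ) < n' := by exact_mod_cast (by omega : 0 < n')
  have hc0 : (0 : ℝ) < n.choose m' := by exact_mod_cast Nat.choose_pos (by omega)
  have hnnR : (n : ℝ) < n' := by exact_mod_cast hnn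
  have hmmR : ((m' + d : ℕ) : ℝ) ≤ 2 * m' := by exact_mod_cast hmm
  have hmnR : 2 * ((m' + d : ℕ) : ℝ) ≤ n := by exact_mod_cast hmn
  have hmR0 : (0 : ℝ) < ((m' + d : ℕ) : ℝ) := by exact_mod_cast (by omega : 0 < m' + d)
  have hR2 : 2 ≤ R := le_of_mul_le_mul_right (hmnR.trans hR) hmR0
  have hnR : (n : ℝ) ≤ 2 * R * m' := by nlinarith
  have key : n' ^ m' * m' ^ d ≤ n ^ m' * n ^ d := by
    refine Nat.le_of_mul_le_mul_left ?_ (Nat.choose_pos (show m' ≤ n by omega))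
    calc n.choose m' * (n' ^ m' * m' ^ d) = (n' ^ m' * n.choose m') * m' ^ d := by ring
      _ ≤ (n ^ m' * n'.choose m') * m' ^ d := by
        gcongr ?_ * _
        exact pow_mul_choose_le hnn.le m'
      _ = n ^ m' * (n.choose (m' + d) * m' ^ d) := by rw [h]; ring
      _ ≤ n ^ m' * (n.choose m' * n ^ d) := by
        gcongr n ^ m' * ?_
        exact choose_add_mul_pow_le n m' d
      _ = _ := by ring
  have key' : ((n' : ℝ) / n) ^ m' ≤ (2 * R) ^ d := by
    have h1 : (n' : ℝ) ^ m' * m' ^ d ≤ (n : ℝ) ^ m' * n ^ d := by exact_mod_cast key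
    rw [div_pow, div_le_iff₀ (by positivity)]
    refine le_of_mul_le_mul_right ?_ (pow_pos hm'0 d)
    calc (n' : ℝ) ^ m' * m' ^ d ≤ (n : ℝ) ^ m' * n ^ d := h1
      _ ≤ (n : ℝ) ^ m' * (2 * R * m') ^ d := by gcongr
      _ = _ := by rw [mul_pow]; ring
  have h1R : 1 ≤ 2 * R := by linarith
  have hdm : d ≤ m' := by omega
  have hle : (n' : ℝ) / n ≤ 2 * R := by
    refine le_of_pow_le_pow_left₀ (n := m') (by omega) (by linarith) (key'.trans ?_)
    exact pow_le_pow_right₀ h1R hdm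
  have hlog := Real.log_le_log (by positivity) key'
  rw [Real.log_pow, Real.log_pow] at hlog
  have hlow := Real.one_sub_inv_le_log_of_pos (show (0 : ℝ) < n' / n by positivity)
  rw [inv_div] at hlow
  have h2 : (n' : ℝ) - n = n' * (1 - n / n') := by field_simp
  have h3 : 0 ≤ Real.log (2 * R) := Real.log_nonneg h1R
  push_cast
  rw [add_sub_cancel_left, h2]
  refine le_of_mul_le_mul_right ?_ hm'0
  have h4 : (n' : ℝ) ≤ 4 * R ^ 2 * m' := by
    rw [div_le_iff₀ hn0] at hle
    nlinarith
  calc (n' : ℝ) * (1 - n / n') * m' ≤ n' * Real.log (n' / n) * m' := by gcongr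
    _ = n' * (m' * Real.log (n' / n)) := by ring
    _ ≤ n' * (d * Real.log (2 * R)) := by gcongr
    _ ≤ (4 * R ^ 2 * m') * (d * Real.log (2 * R)) := by gcongr
    _ = _ := by ring

theorem eventually_exists_parameter {Q : ℕ → Prop} (hQ : ∀ᶠ P : ℕ in atTop, Q P) :
    ∀ᶠ M : ℕ in atTop, ∀ g : ℝ, ∃ P : ℕ, Q P ∧ 2 * (P * Real.log P ^ 15) ≤ M ∧
      (M : ℝ) ≤ P * Real.log P ^ 41 ∧ Real.log M ≤ 2 * Real.log P ∧
      (P * Real.log P ^ 15 ≤ g ∨ g ≤ P / 4) := by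
  obtain ⟨P₀, hP₀⟩ := eventually_atTop.1 hQ
  filter_upwards [tendsto_log_natCast.eventually_ge_atTop (2 ^ 50),
    tendsto_log_natCast.eventually (eventually_mul_pow_le_exp_rpow (P₀ + 2) 40 (c := 1 / 2)
      (a := 1) (by norm_num) one_pos), eventually_gt_atTop 0] with M hlog hexp hM0 g
  set ℓ := Real.log M with hℓ
  have hℓ0 : 0 < ℓ := by linarith
  have hℓ1 : 1 ≤ ℓ := by linarith
  have hM0' : (0 : ℝ) < M := by exact_mod_cast hM0
  rw [Real.rpow_one] at hexp
  have hexpM : Real.exp (1 / 2 * ℓ) * Real.exp (1 / 2 * ℓ) = M := by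
    rw [← Real.exp_add, ← Real.exp_log hM0']
    congr 1; ring
  have hexp1 : 1 ≤ Real.exp (1 / 2 * ℓ) := Real.one_le_exp (by positivity)
  have key : ∀ B : ℕ, 20 ≤ B → B ≤ 40 → ∃ P : ℕ, Q P ∧ (P : ℝ) ≤ M / ℓ ^ B ∧
      M / ℓ ^ B ≤ 2 * P ∧ Real.log P ≤ ℓ ∧ ℓ ≤ 2 * Real.log P := by
    intro B hB hB'
    have hpow : 1 ≤ ℓ ^ B := one_le_pow₀ hℓ1
    have h1 : (P₀ + 2) * Real.exp (1 / 2 * ℓ) ≤ M / ℓ ^ B := by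
      rw [le_div_iff₀ (by positivity), ← hexpM]
      calc (P₀ + 2) * Real.exp (1 / 2 * ℓ) * ℓ ^ B ≤ (P₀ + 2) * Real.exp (1 / 2 * ℓ) * ℓ ^ 40 := by
            gcongr
        _ = ((P₀ + 2) * ℓ ^ 40) * Real.exp (1 / 2 * ℓ) := by ring
        _ ≤ _ := by gcongr
    have hfl := Nat.floor_le (show 0 ≤ M / ℓ ^ B by positivity)
    have hfl' := Nat.lt_floor_add_one (M / ℓ ^ B)
    have h2 : (P₀ : ℝ) + 2 ≤ (P₀ + 2) * Real.exp (1 / 2 * ℓ) :=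
      le_mul_of_one_le_right (by positivity) hexp1
    have hP₀0 : (0 : ℝ) ≤ P₀ := Nat.cast_nonneg _
    have h3 : 2 * Real.exp (1 / 2 * ℓ) ≤ (P₀ + 2) * Real.exp (1 / 2 * ℓ) := by
      gcongr; linarith
    have hPexp : Real.exp (1 / 2 * ℓ) ≤ ⌊M / ℓ ^ B⌋₊ := by linarith
    refine ⟨⌊M / ℓ ^ B⌋₊, hP₀ _ (Nat.le_floor (by linarith)), hfl, by linarith, ?_, ?_⟩
    · refine Real.log_le_log (by linarith) (hfl.trans ?_)
      exact div_le_self hM0'.le hpow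
    · have := Real.log_le_log (Real.exp_pos _) hPexp
      rw [Real.log_exp] at this
      linarith
  have fin : ∀ B : ℕ, 20 ≤ B → B ≤ 40 → ∀ P : ℕ, (P : ℝ) ≤ M / ℓ ^ B → M / ℓ ^ B ≤ 2 * P →
      Real.log P ≤ ℓ → ℓ ≤ 2 * Real.log P →
      2 * (P * Real.log P ^ 15) ≤ M ∧ (M : ℝ) ≤ P * Real.log P ^ 41 := by
    intro B hB hB' P h1 h2 h3 h4
    have hlP : 0 < Real.log P := by linarith
    rw [le_div_iff₀ (by positivity)] at h1
    rw [div_le_iff₀ (by positivity)] at h2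
    constructor
    · refine le_trans ?_ h1
      calc 2 * (P * Real.log P ^ 15) ≤ ℓ * (P * ℓ ^ 15) := by gcongr; linarith
        _ = P * ℓ ^ 16 := by ring
        _ ≤ P * ℓ ^ B := by gcongr; omega
    · calc (M : ℝ) ≤ 2 * P * ℓ ^ B := h2
        _ ≤ 2 * P * ℓ ^ 40 := by gcongr
        _ ≤ 2 * P * (2 * Real.log P) ^ 40 := by gcongr
        _ = P * Real.log P ^ 40 * 2 ^ 41 := by ring
        _ ≤ P * Real.log P ^ 40 * Real.log P := by gcongr; linarith
        _ = _ := by ring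
  obtain ⟨P, hQP, h1, h2, h3, h4⟩ := key 40 (by norm_num) le_rfl
  obtain ⟨P', hQP', h1', h2', h3', h4'⟩ := key 20 le_rfl (by norm_num)
  have h5 := fin 40 (by norm_num) le_rfl P h1 h2 h3 h4
  have h5' := fin 20 le_rfl (by norm_num) P' h1' h2' h3' h4'
  by_cases hg : P * Real.log P ^ 15 ≤ g
  · exact ⟨P, hQP, h5.1, h5.2, h4, Or.inl hg⟩
  · refine ⟨P', hQP', h5'.1, h5'.2, h4', Or.inr ?_⟩
    have hlP : 0 < Real.log P := by linarith
    have h6 : P * Real.log P ^ 15 ≤ M / ℓ ^ 20 / 8 := by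
      calc P * Real.log P ^ 15 ≤ M / ℓ ^ 40 * ℓ ^ 15 := by gcongr
        _ = M / ℓ ^ 20 / ℓ ^ 5 := by field_simp
        _ ≤ M / ℓ ^ 20 / ℓ ^ 1 := by gcongr; norm_num
        _ ≤ M / ℓ ^ 20 / 8 := by rw [pow_one]; gcongr; linarith
    linarith

theorem eventually_exists_parameter_of_exp_rpow_le {Q : ℕ → Prop} (hQ : ∀ᶠ P : ℕ in atTop, Q P)
    {ε : ℝ} (hε : 0 < ε) (hε1 : ε ≤ 1) (h : ℝ) :
    ∀ᶠ L : ℝ in atTop, ∀ M : ℕ, Real.exp (L ^ (2 / 3 + ε / 2)) ≤ M → ∀ g : ℝ, ∃ P : ℕ, Q P ∧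
      2 * (P * Real.log P ^ 15) ≤ M ∧ (M : ℝ) ≤ P * Real.log P ^ 41 ∧
      h + L ≤ Real.log P ^ (3 / 2 - ε / 3) ∧
      (P * Real.log P ^ 15 ≤ g ∨ g ≤ P / 4) := by
  obtain ⟨M₀, hM₀⟩ := eventually_atTop.1 (eventually_exists_parameter hQ)
  have hpow : ∀ {a : ℝ}, 0 < a → Tendsto (fun L : ℝ => L ^ a) atTop atTop :=
    fun ha => tendsto_rpow_atTop ha
  filter_upwards [(Real.tendsto_exp_atTop.comp (hpow (show 0 < 2 / 3 + ε / 2 by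
      positivity))).eventually_ge_atTop (M₀ : ℝ),
    (hpow (show 0 < ε / 6 by positivity)).eventually_ge_atTop 2,
    (hpow (show 0 < ε / 9 by positivity)).eventually_ge_atTop 2, eventually_ge_atTop 1,
    eventually_ge_atTop h] with L h1 h2 h3 hL1 hLh
  intro M hM g
  have hL0 : 0 < L := by linarith
  obtain ⟨P, hQP, hP1, hP2, hP3, hP4⟩ := hM₀ M (by exact_mod_cast h1.trans hM) g
  refine ⟨P, hQP, hP1, hP2, ?_, hP4⟩
  have h4 : L ^ (2 / 3 + ε / 2) ≤ Real.log M := by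
    have := Real.log_le_log (Real.exp_pos _) hM
    rwa [Real.log_exp] at this
  have h5 : L ^ (2 / 3 + ε / 3) ≤ Real.log P := by
    have h6 : L ^ (2 / 3 + ε / 2) = L ^ (2 / 3 + ε / 3) * L ^ (ε / 6) := by
      rw [← Real.rpow_add hL0]; congr 1; ring
    have h7 : 0 ≤ L ^ (2 / 3 + ε / 3) := Real.rpow_nonneg hL0.le _
    nlinarith
  calc h + L ≤ L * 2 := by linarith
    _ ≤ L * L ^ (ε / 9) := by gcongr
    _ = L ^ (1 + ε / 9) := by rw [Real.rpow_add hL0, Real.rpow_one]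
    _ ≤ L ^ ((2 / 3 + ε / 3) * (3 / 2 - ε / 3)) := by
      refine Real.rpow_le_rpow_of_exponent_le hL1 ?_
      nlinarith
    _ = (L ^ (2 / 3 + ε / 3)) ^ (3 / 2 - ε / 3) := Real.rpow_mul hL0.le _ _
    _ ≤ _ := by
      have h7 : 0 ≤ L ^ (2 / 3 + ε / 3) := Real.rpow_nonneg hL0.le _
      gcongr
      linarith

theorem eventually_sub_le_of_choose_eq {ε : ℝ} (hε : 0 < ε) (hε1 : ε ≤ 1) :
    ∀ᶠ L : ℝ in atTop, ∀ n m n' m' : ℕ, 1 ≤ m' → m' < m → 2 * m ≤ n → 2 * m' ≤ n' →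
      n.choose m = n'.choose m' → L = Real.log (n + n') →
      (m : ℝ) - m' ≤ 2 * L * Real.exp (L ^ (2 / 3 + ε / 2)) := by
  obtain ⟨H, hH1, hH⟩ := exists_forall_choose_ne (ε := ε / 3) (by positivity) (by linarith)
  set K : ℝ := 4 * (4 * H) ^ 2 * Real.log (2 * (4 * H)) with hK
  have hQ := (hH 44).and ((tendsto_log_natCast.eventually_ge_atTop (K + 1)).and
    (tendsto_log_natCast.eventually_ge_atTop 2))
  filter_upwards [eventually_exists_parameter_of_exp_rpow_le hQ hε hε1 (Real.log (H + 1)),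
    eventually_ge_atTop 1] with L hL hL1
  intro n m n' m' hm' hm hmn hmn' hchoose hLdef
  by_contra! hlt
  set E := Real.exp (L ^ (2 / 3 + ε / 2)) with hE
  have hE0 : 0 < E := Real.exp_pos _
  have hnn := lt_of_choose_eq hm hmn hchoose
  have hnnR : (n : ℝ) < n' := by exact_mod_cast hnn
  have hn'0 : (0 : ℝ) < n' := by exact_mod_cast (by omega : 0 < n')
  have hmmR : (m' : ℝ) < m := by exact_mod_cast hm
  have hm'0 : (0 : ℝ) ≤ m' := Nat.cast_nonneg _
  have hHR : (1 : ℝ) ≤ H := by exact_mod_cast hH1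
  have hlogn' : Real.log n' ≤ L := by
    rw [hLdef]
    exact Real.log_le_log hn'0 (by linarith [Nat.cast_nonneg (α := ℝ) n])
  have hml : (m : ℝ) ≤ 2 * L * m' := by
    have h1 := mul_log_two_le_of_choose_eq hmn hchoose
    have h2 := Real.log_two_gt_d9
    have h3 : (m : ℝ) * (1 / 2) ≤ m * Real.log 2 := by gcongr; linarith
    have h4 : (m' : ℝ) * Real.log n' ≤ m' * L := by gcongr
    linarith
  have hEm' : E ≤ m' := by
    refine le_of_mul_le_mul_left ?_ (show 0 < 2 * L by linarith)
    linarith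
  have hEd : E ≤ (m - m' : ℕ) := by
    rw [Nat.cast_sub hm.le]
    exact le_trans (le_mul_of_one_le_left hE0.le (by linarith)) hlt.le
  have hlogX : ∀ P : ℕ, Real.log (H + 1) + L ≤ Real.log P ^ (3 / 2 - ε / 3) →
      Real.log ((H + 1) * n') ≤ Real.log P ^ (3 / 2 - ε / 3) := fun P hP => by
    rw [Real.log_mul (by positivity) hn'0.ne']
    linarith
  have hlogP : ∀ P : ℕ, Real.log (H + 1) + L ≤ Real.log P ^ (3 / 2 - ε / 3) → 2 ≤ Real.log P →
      2 * L ≤ Real.log P ^ 3 := fun P hP hP2 => by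
    have h1 : 0 ≤ Real.log (H + 1) := Real.log_nonneg (by linarith)
    have h2 : Real.log P ^ (3 / 2 - ε / 3) ≤ Real.log P ^ (2 : ℝ) :=
      Real.rpow_le_rpow_of_exponent_le (by linarith) (by linarith)
    rw [Real.rpow_two] at h2
    calc 2 * L ≤ 2 * Real.log P ^ 2 := by linarith
      _ ≤ Real.log P * Real.log P ^ 2 := by gcongr
      _ = _ := by ring
  have hcaseB : ∀ P : ℕ, Real.log (H + 1) + L ≤ Real.log P ^ (3 / 2 - ε / 3) → 2 ≤ Real.log P →
      (m' : ℝ) ≤ P * Real.log P ^ 41 → (m : ℝ) ≤ P * Real.log P ^ 44 := fun P hP hP2 h => by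
    calc (m : ℝ) ≤ 2 * L * m' := hml
      _ ≤ Real.log P ^ 3 * (P * Real.log P ^ 41) := by
        gcongr
        exact hlogP P hP hP2
      _ = _ := by ring
  have hpow : ∀ P : ℕ, 2 ≤ Real.log P → ∀ c : ℝ, c ≤ Real.log P →
      c * (P * Real.log P ^ 41) ≤ P * Real.log P ^ 44 := fun P hP c hc => by
    calc c * (P * Real.log P ^ 41) ≤ Real.log P * (P * Real.log P ^ 41) := by gcongr
      _ = P * Real.log P ^ 42 := by ring
      _ ≤ _ := by gcongr <;> [linarith; norm_num]
  rcases le_or_gt (4 * H * (m : ℝ)) n with hnm | hnm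
  · have hnm' : 4 * H * m ≤ n := by exact_mod_cast hnm
    have hadd := add_le_add_of_choose_eq hm (by nlinarith) hchoose
    have hED : E ≤ (n' - n : ℕ) := hEd.trans (by exact_mod_cast (by omega : m - m' ≤ n' - n))
    have haddR : (m : ℝ) - m' ≤ n' - n := by
      have : (n : ℝ) + m ≤ n' + m' := by exact_mod_cast hadd
      linarith
    obtain ⟨P, ⟨hP, hPK, hP2⟩, h1, h2, h3, h4⟩ := hL (min (n' - n) m')
      (by rw [Nat.cast_min]; exact le_min hED hEm') |(n' : ℝ) - m' - n|
    have hT : 0 ≤ (P : ℝ) * Real.log P ^ 15 := by positivity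
    rw [Nat.cast_min, Nat.cast_sub hnn.le] at h1 h2
    refine hP n m n' m' hm.le hmn hnn (hlogX P h3) ?_ (h1.trans (min_le_right _ _))
      (Or.inl ⟨hnm, by linarith [h1.trans (min_le_left _ _)], h4⟩) hchoose
    rcases min_le_iff.1 h2 with h5 | h5
    · left
      linarith [hpow P hP2 2 hP2]
    · exact Or.inr (hcaseB P h3 hP2 h5)
  · obtain ⟨P, ⟨hP, hPK, hP2⟩, h1, h2, h3, h4⟩ := hL (min (m - m') m')
      (by rw [Nat.cast_min]; exact le_min hEd hEm') ((n : ℝ) - 2 * m)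
    have hT : 0 ≤ (P : ℝ) * Real.log P ^ 15 := by positivity
    rw [Nat.cast_min, Nat.cast_sub hm.le] at h1 h2
    refine hP n m n' m' hm.le hmn hnn (hlogX P h3) ?_ (h1.trans (min_le_right _ _))
      (Or.inr ⟨by linarith [h1.trans (min_le_left _ _)], h4⟩) hchoose
    by_cases h5 : (m' : ℝ) ≤ P * Real.log P ^ 41
    · exact Or.inr (hcaseB P h3 hP2 h5)
    · have h6 : (m : ℝ) - m' ≤ P * Real.log P ^ 41 := (min_le_iff.1 h2).resolve_right h5
      have hmm2 : m ≤ 2 * m' := by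
        have : (m : ℝ) ≤ 2 * m' := by linarith
        exact_mod_cast this
      have h7 := sub_le_mul_sub_of_choose_eq hm' hm hmn hmm2 hnm.le hchoose
      rw [← hK] at h7
      have hK0 : 0 ≤ K := by
        have := Real.log_nonneg (show (1 : ℝ) ≤ 2 * (4 * H) by linarith)
        positivity
      left
      calc (n' : ℝ) - n + (m - m') ≤ (K + 1) * (m - m') := by linarith
        _ ≤ (K + 1) * (P * Real.log P ^ 41) := by gcongr
        _ ≤ _ := hpow P hP2 _ hPK

theorem exists_forall_sub_le {ε : ℝ} (hε : 0 < ε) (hε1 : ε ≤ 1) :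
    ∃ C : ℝ, 0 ≤ C ∧ ∀ n m n' m' : ℕ, 1 ≤ m' → m' < m → 2 * m ≤ n → 2 * m' ≤ n' →
      n.choose m = n'.choose m' →
      (m : ℝ) - m' ≤ C * Real.exp (Real.log (n + n') ^ (2 / 3 + ε)) := by
  have hev : ∀ᶠ L : ℝ in atTop, 2 * L * Real.exp (L ^ (2 / 3 + ε / 2)) ≤
      Real.exp (L ^ (2 / 3 + ε)) := by
    filter_upwards [eventually_mul_pow_le_exp_rpow 2 1 one_pos (show 0 < 2 / 3 + ε / 2 by positivity),
      (tendsto_rpow_atTop (show 0 < ε / 2 by positivity)).eventually_ge_atTop 2,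
      eventually_gt_atTop 0] with L h1 h2 hL0
    rw [pow_one, one_mul] at h1
    calc 2 * L * Real.exp (L ^ (2 / 3 + ε / 2))
        ≤ Real.exp (L ^ (2 / 3 + ε / 2)) * Real.exp (L ^ (2 / 3 + ε / 2)) := by gcongr
      _ = Real.exp (L ^ (2 / 3 + ε / 2) * 2) := by rw [← Real.exp_add]; ring_nf
      _ ≤ Real.exp (L ^ (2 / 3 + ε / 2) * L ^ (ε / 2)) := by gcongr
      _ = _ := by rw [← Real.rpow_add hL0]; ring_nf
  obtain ⟨L₀, hL₀⟩ := eventually_atTop.1 ((eventually_sub_le_of_choose_eq hε hε1).and hev)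
  refine ⟨Real.exp L₀ + 1, by positivity, fun n m n' m' hm' hm hmn hmn' hchoose => ?_⟩
  have hpos : (0 : ℝ) < n + n' := by exact_mod_cast (by omega : 0 < n + n')
  have hlog0 : 0 ≤ Real.log (n + n') :=
    Real.log_nonneg (by exact_mod_cast (by omega : 1 ≤ n + n'))
  rcases le_total L₀ (Real.log (n + n')) with hL | hL
  · obtain ⟨h1, h2⟩ := hL₀ _ hL
    refine ((h1 n m n' m' hm' hm hmn hmn' hchoose rfl).trans h2).trans ?_
    exact le_mul_of_one_le_left (Real.exp_pos _).le (by linarith [Real.exp_pos L₀])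
  · have h1 : (n : ℝ) + n' ≤ Real.exp L₀ := (Real.log_le_iff_le_exp hpos).1 hL
    have h2 : (m : ℝ) ≤ n + n' := by exact_mod_cast (by omega : m ≤ n + n')
    have h3 : 1 ≤ Real.exp (Real.log (n + n') ^ (2 / 3 + ε)) :=
      Real.one_le_exp (Real.rpow_nonneg hlog0 _)
    have h4 : (Real.exp L₀ + 1) * 1 ≤
        (Real.exp L₀ + 1) * Real.exp (Real.log (n + n') ^ (2 / 3 + ε)) := by gcongr
    linarith [Nat.cast_nonneg (α := ℝ) m']

end Distance

end Singmaster

/-- Distance estimate, first part: for every `ε > 0` there is a constant `C(ε)` such that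
any two solutions `(n,m)`, `(n',m')` of `C(n,m) = C(n',m') = t` in the left half of
Pascal's triangle satisfy `|m - m'| ≤ C(ε) · exp((log(n+n'))^(2/3+ε))`. -/
theorem stmt_4 (ε : ℝ) (hε : 0 < ε) :
    ∃ C : ℝ, ∀ t n m n' m' : ℕ, 2 ≤ t →
      1 ≤ m → 2 * m ≤ n → 1 ≤ m' → 2 * m' ≤ n' →
      Nat.choose n m = t → Nat.choose n' m' = t →
      |(m : ℝ) - (m' : ℝ)| ≤
        C * Real.exp ((Real.log ((n : ℝ) + (n' : ℝ))) ^ ((2 : ℝ) / 3 + ε)) := by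
  obtain ⟨C, hC0, hC⟩ := Singmaster.exists_forall_sub_le (ε := min ε 1) (lt_min hε one_pos)
    (min_le_right _ _)
  refine ⟨C, fun t n m n' m' _ hm hmn hm' hmn' h h' => ?_⟩
  have hlog : 1 ≤ Real.log ((n : ℝ) + n') := by
    have h4 : (4 : ℝ) ≤ n + n' := by exact_mod_cast (by omega : 4 ≤ n + n')
    rw [Real.le_log_iff_exp_le (by linarith)]
    linarith [Real.exp_one_lt_d9]
  have hexp : C * Real.exp (Real.log ((n : ℝ) + n') ^ (2 / 3 + min ε 1)) ≤
      C * Real.exp (Real.log ((n : ℝ) + n') ^ ((2 : ℝ) / 3 + ε)) := by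
    gcongr
    exact min_le_left _ _
  refine le_trans ?_ hexp
  rcases lt_trichotomy m' m with hlt | rfl | hlt
  · rw [abs_of_pos (sub_pos.2 (by exact_mod_cast hlt))]
    exact hC n m n' m' hm' hlt hmn hmn' (h.trans h'.symm)
  · rw [sub_self, abs_zero]
    positivity
  · rw [abs_sub_comm, abs_of_pos (sub_pos.2 (by exact_mod_cast hlt)), add_comm (n : ℝ)]
    exact hC n' m' n m hm hlt hmn' hmn (h'.trans h.symm)
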